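/- Let d ≥ 1, T > 0. Suppose (hⁿ,cⁿ) and (h,c) all satisfy Assumption A with a uniform bound on ‖hⁿ‖_{L²_t L²_x}, ‖div hⁿ‖_{L²_t L^r_x ∩ L¹_t L^∞_x} and ‖cⁿ‖_{L²_t L^r_x ∩ L¹_t L^∞_x}, and let f₀ⁿ, f₀ ∈ L²(𝕋^d). If f₀ⁿ → f₀ weakly in L²(𝕋^d), hⁿ → h weakly in L²([0,T]×𝕋^d), and div hⁿ → div h and cⁿ → c weakly in L²_t L^r_x, then the unique weak solutions fⁿ ∈ L^∞_t L²_x ∩ L²_t H¹_x of ∂_t fⁿ − Δfⁿ = hⁿ·∇fⁿ + cⁿ fⁿ with fⁿ(0) = f₀ⁿ converge to the solution f associated with (f₀,h,c): weakly in L²_t H¹_x, strongly in L²([0,T]×𝕋^d), and strongly in C⁰_t H^{−δ} for every δ > 0. -/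

import Mathlib

open MeasureTheory Filter
open scoped ENNReal NNReal

noncomputable section

namespace GaleatiLuo

/-- The unit box `[0,1)^d ⊆ ℝ^d`, a fundamental domain for the torus `𝕋^d = ℝ^d/ℤ^d`. -/
def box (d : ℕ) : Set (Fin d → ℝ) := Set.univ.pi fun _ => Set.Ico (0 : ℝ) 1

/-- Lebesgue measure restricted to the fundamental domain: the measure of the torus. -/
def μT (d : ℕ) : Measure (Fin d → ℝ) := volume.restrict (box d)

/-- `ℤ^d`-periodicity of a scalar function on `ℝ^d`. -/
def ZPeriodic {d : ℕ} (f : (Fin d → ℝ) → ℝ) : Prop :=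
  ∀ (x : Fin d → ℝ) (k : Fin d → ℤ), f (x + fun i => (k i : ℝ)) = f x

/-- `ℤ^d`-periodicity of a vector field on `ℝ^d`. -/
def ZPeriodicV {d : ℕ} (h : (Fin d → ℝ) → Fin d → ℝ) : Prop :=
  ∀ (x : Fin d → ℝ) (k : Fin d → ℤ), h (x + fun i => (k i : ℝ)) = h x

/-- Euclidean norm of a lattice point `k ∈ ℤ^d`. -/
def znorm {d : ℕ} (k : Fin d → ℤ) : ℝ := Real.sqrt (∑ i, ((k i : ℝ)) ^ 2)

/-- The `k`-th Fourier coefficient `f̂(k) = ∫_{[0,1)^d} f(x) e^{-2πik·x} dx`. -/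
def fc {d : ℕ} (f : (Fin d → ℝ) → ℝ) (k : Fin d → ℤ) : ℂ :=
  ∫ x, (f x : ℂ) *
    Complex.exp (-(2 * (Real.pi : ℂ) * Complex.I) * ((∑ i, (k i : ℝ) * x i : ℝ) : ℂ)) ∂(μT d)

/-- Squared Sobolev norm `‖f‖_{H^s}² = Σ_k (1+|k|²)^s |f̂(k)|²` (valued in `ℝ≥0∞`). -/
def sobNormSq {d : ℕ} (s : ℝ) (f : (Fin d → ℝ) → ℝ) : ℝ≥0∞ :=
  ∑' k : Fin d → ℤ, ENNReal.ofReal ((1 + znorm k ^ 2) ^ s) * (‖fc f k‖₊ : ℝ≥0∞) ^ 2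

/-- Sobolev norm `‖f‖_{H^s}`. -/
def sobNorm {d : ℕ} (s : ℝ) (f : (Fin d → ℝ) → ℝ) : ℝ≥0∞ := sobNormSq s f ^ (1 / 2 : ℝ)

/-- Squared `H^s` norm of a vector field (sum over components). -/
def sobNormSqV {d : ℕ} (s : ℝ) (h : (Fin d → ℝ) → Fin d → ℝ) : ℝ≥0∞ :=
  ∑ i, sobNormSq s (fun x => h x i)

/-- `L^p(𝕋^d)` norm. -/
def spLp {d : ℕ} (p : ℝ≥0∞) (f : (Fin d → ℝ) → ℝ) : ℝ≥0∞ := eLpNorm f p (μT d)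

/-- `L^p(𝕋^d)` norm of a vector field. -/
def spLpV {d : ℕ} (p : ℝ≥0∞) (h : (Fin d → ℝ) → Fin d → ℝ) : ℝ≥0∞ := eLpNorm h p (μT d)

/-- Mixed norm `‖u‖_{L^q_t L^p_x}` on `[0,T]` (essential supremum when `q = ∞`). -/
def LqLp {d : ℕ} (T : ℝ) (q p : ℝ≥0∞) (u : ℝ → (Fin d → ℝ) → ℝ) : ℝ≥0∞ :=
  if q = ∞ then essSup (fun t => spLp p (u t)) (volume.restrict (Set.Icc (0:ℝ) T))
  else (∫⁻ t in Set.Icc (0:ℝ) T, spLp p (u t) ^ q.toReal) ^ (1 / q.toReal)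

/-- Mixed norm `‖u‖_{L^q_t L^p_x}` for vector fields. -/
def LqLpV {d : ℕ} (T : ℝ) (q p : ℝ≥0∞) (u : ℝ → (Fin d → ℝ) → Fin d → ℝ) : ℝ≥0∞ :=
  if q = ∞ then essSup (fun t => spLpV p (u t)) (volume.restrict (Set.Icc (0:ℝ) T))
  else (∫⁻ t in Set.Icc (0:ℝ) T, spLpV p (u t) ^ q.toReal) ^ (1 / q.toReal)

/-- `i`-th partial derivative. -/
def pd {d : ℕ} (i : Fin d) (φ : (Fin d → ℝ) → ℝ) : (Fin d → ℝ) → ℝ :=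
  fun x => fderiv ℝ φ x (Pi.single i 1)

/-- Laplacian. -/
def lap {d : ℕ} (φ : (Fin d → ℝ) → ℝ) : (Fin d → ℝ) → ℝ :=
  fun x => ∑ i, pd i (pd i φ) x

/-- `L²(𝕋^d)` pairing `⟨f, g⟩ = ∫_{𝕋^d} f g`. -/
def pairT {d : ℕ} (f g : (Fin d → ℝ) → ℝ) : ℝ := ∫ x, f x * g x ∂(μT d)

/-- Smooth periodic test function. -/
def Test {d : ℕ} (φ : (Fin d → ℝ) → ℝ) : Prop := ContDiff ℝ (⊤ : ℕ∞) φ ∧ ZPeriodic φ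

/-- `D` is the distributional divergence of the vector field `h` on the torus. -/
def IsWeakDiv {d : ℕ} (h : (Fin d → ℝ) → Fin d → ℝ) (D : (Fin d → ℝ) → ℝ) : Prop :=
  ∀ φ, Test φ →
    ∫ x, (∑ i, h x i * pd i φ x) ∂(μT d) = - ∫ x, D x * φ x ∂(μT d)

/-- `g` is the weak spatial gradient of `f` on the torus. -/
def HasWeakGrad {d : ℕ} (f : (Fin d → ℝ) → ℝ) (g : (Fin d → ℝ) → Fin d → ℝ) : Prop :=
  ∀ φ, Test φ → ∀ i,
    ∫ x, f x * pd i φ x ∂(μT d) = - ∫ x, g x i * φ x ∂(μT d)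

/-- Continuity in time with values in `L^p(𝕋^d)`. -/
def ContLp {d : ℕ} (T : ℝ) (p : ℝ≥0∞) (f : ℝ → (Fin d → ℝ) → ℝ) : Prop :=
  ∀ t ∈ Set.Icc (0:ℝ) T, ∀ ε : ℝ, 0 < ε → ∃ δ > (0:ℝ), ∀ s ∈ Set.Icc (0:ℝ) T,
    |s - t| < δ → spLp p (fun x => f s x - f t x) < ENNReal.ofReal ε

/-- Continuity in time with values in `H^{s₀}(𝕋^d)`. -/
def ContSob {d : ℕ} (T s₀ : ℝ) (f : ℝ → (Fin d → ℝ) → ℝ) : Prop :=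
  ∀ t ∈ Set.Icc (0:ℝ) T, ∀ ε : ℝ, 0 < ε → ∃ δ > (0:ℝ), ∀ s ∈ Set.Icc (0:ℝ) T,
    |s - t| < δ → sobNorm s₀ (fun x => f s x - f t x) < ENNReal.ofReal ε

/-- `C⁰_t H^s` norm: `sup_{t∈[0,T]} ‖f_t‖_{H^s}`. -/
def supSob {d : ℕ} (T s : ℝ) (f : ℝ → (Fin d → ℝ) → ℝ) : ℝ≥0∞ :=
  ⨆ t ∈ Set.Icc (0:ℝ) T, sobNorm s (f t)

/-- `sup_{t∈[0,T]} ‖f_t‖_{L^p}`. -/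
def supLp {d : ℕ} (T : ℝ) (p : ℝ≥0∞) (f : ℝ → (Fin d → ℝ) → ℝ) : ℝ≥0∞ :=
  ⨆ t ∈ Set.Icc (0:ℝ) T, spLp p (f t)

/-- `L²_t H¹_x` norm. -/
def L2H1 {d : ℕ} (T : ℝ) (f : ℝ → (Fin d → ℝ) → ℝ) : ℝ≥0∞ :=
  (∫⁻ t in Set.Icc (0:ℝ) T, sobNormSq 1 (f t)) ^ (1 / 2 : ℝ)

/-- A measurable periodic path, bounded in `L^∞([0,T]×𝕋^d)`. -/
def BddClass {d : ℕ} (T : ℝ) (f : ℝ → (Fin d → ℝ) → ℝ) : Prop :=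
  Measurable (Function.uncurry f) ∧ (∀ t, ZPeriodic (f t)) ∧ LqLp T ∞ ∞ f < ∞

/-- Membership in `L^∞_t L²_x ∩ L²_t H¹_x` (with a weak spatial gradient). -/
def SolClassL2 {d : ℕ} (T : ℝ) (f : ℝ → (Fin d → ℝ) → ℝ) : Prop :=
  Measurable (Function.uncurry f) ∧ (∀ t, ZPeriodic (f t)) ∧ supLp T 2 f < ∞ ∧
  ∃ g : ℝ → (Fin d → ℝ) → Fin d → ℝ,
    (∀ t ∈ Set.Icc (0:ℝ) T, HasWeakGrad (f t) (g t)) ∧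
    (∫⁻ t in Set.Icc (0:ℝ) T, (spLp 2 (f t) ^ 2 + spLpV 2 (g t) ^ 2)) < ∞

end GaleatiLuo
namespace GaleatiLuo

/-- Assumption A of the paper, with the distributional divergence `divh` of `h` given
explicitly: `h ∈ L²_t L²_x`, and `div h, c ∈ L²_t L^r_x ∩ L¹_t L^∞_x` for the fixed
exponent `r > 2d/(d+2)`. All data are measurable and `ℤ^d`-periodic. -/
def AssumptionA {d : ℕ} (T r : ℝ) (h : ℝ → (Fin d → ℝ) → Fin d → ℝ)
    (divh c : ℝ → (Fin d → ℝ) → ℝ) : Prop :=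
  r > 2 * d / (d + 2) ∧
  Measurable (Function.uncurry h) ∧ (∀ t, ZPeriodicV (h t)) ∧
  Measurable (Function.uncurry divh) ∧ (∀ t, ZPeriodic (divh t)) ∧
  Measurable (Function.uncurry c) ∧ (∀ t, ZPeriodic (c t)) ∧
  LqLpV T 2 2 h < ∞ ∧
  (∀ t ∈ Set.Icc (0:ℝ) T, IsWeakDiv (h t) (divh t)) ∧
  LqLp T 2 (ENNReal.ofReal r) divh < ∞ ∧ LqLp T 1 ∞ divh < ∞ ∧
  LqLp T 2 (ENNReal.ofReal r) c < ∞ ∧ LqLp T 1 ∞ c < ∞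

/-- Weak solution of `∂_t f − Δf = h·∇f + c f`, `f(0) = f₀`, on `[0,T] × 𝕋^d`:
for every smooth periodic test function `φ` and every `t ∈ [0,T]`,
`⟨f_t, φ⟩ = ⟨f₀, φ⟩ + ∫₀ᵗ [⟨f_s, Δφ⟩ − ⟨f_s h_s, ∇φ⟩ + ⟨(c_s − div h_s) f_s, φ⟩] ds`. -/
def IsWeakSol {d : ℕ} (T : ℝ) (h : ℝ → (Fin d → ℝ) → Fin d → ℝ)
    (divh c : ℝ → (Fin d → ℝ) → ℝ) (f0 : (Fin d → ℝ) → ℝ)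
    (f : ℝ → (Fin d → ℝ) → ℝ) : Prop :=
  ∀ φ : (Fin d → ℝ) → ℝ, Test φ → ∀ t ∈ Set.Icc (0:ℝ) T,
    pairT (f t) φ =
      pairT f0 φ + ∫ s in Set.Ioc (0:ℝ) t,
        (pairT (f s) (lap φ)
          - (∫ x, f s x * (∑ i, h s x i * pd i φ x) ∂(μT d))
          + ∫ x, (c s x - divh s x) * f s x * φ x ∂(μT d))

end GaleatiLuo
namespace GaleatiLuo

/-- Conjugate Hölder exponent `r' = r/(r-1)`. -/
def conjExp (r : ℝ) : ℝ := r / (r - 1)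

/-- `H^s` pairing `⟨f, g⟩_{H^s} = Σ_k (1+|k|²)^s f̂(k) conj(ĝ(k))`. -/
def sobPair {d : ℕ} (s : ℝ) (f g : (Fin d → ℝ) → ℝ) : ℂ :=
  ∑' k : Fin d → ℤ, (((1 + znorm k ^ 2) ^ s : ℝ) : ℂ) * (fc f k * star (fc g k))

lemma absolutelyContinuousOnInterval_comp {u β : ℝ → ℝ} {a b : ℝ} {K : ℝ≥0} {s : Set ℝ}
    (hu : AbsolutelyContinuousOnInterval u a b) (hβ : LipschitzOnWith K β s)
    (hs : ∀ x ∈ Set.uIcc a b, u x ∈ s) :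
    AbsolutelyContinuousOnInterval (fun x => β (u x)) a b := by
  rw [absolutelyContinuousOnInterval_iff] at hu ⊢
  intro ε hε
  obtain ⟨δ, hδ, H⟩ := hu (ε / (K + 1)) (by positivity)
  refine ⟨δ, hδ, fun E hE hlt => ?_⟩
  have h1 := H E hE hlt
  have hmem : ∀ i ∈ Finset.range E.1, (E.2 i).1 ∈ Set.uIcc a b ∧ (E.2 i).2 ∈ Set.uIcc a b :=
    fun i hi => hE.1 i hi
  calc ∑ i ∈ Finset.range E.1, dist (β (u (E.2 i).1)) (β (u (E.2 i).2))
      ≤ ∑ i ∈ Finset.range E.1, K * dist (u (E.2 i).1) (u (E.2 i).2) :=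
        Finset.sum_le_sum fun i hi =>
          hβ.dist_le_mul _ (hs _ (hmem i hi).1) _ (hs _ (hmem i hi).2)
    _ = K * ∑ i ∈ Finset.range E.1, dist (u (E.2 i).1) (u (E.2 i).2) := by
        rw [Finset.mul_sum]
    _ ≤ K * (ε / (K + 1)) := by gcongr
    _ < ε := by
        have : (K : ℝ) / (K + 1) < 1 := by
          rw [div_lt_one (by positivity)]; linarith
        calc (K : ℝ) * (ε / (K + 1)) = ε * (K / (K + 1)) := by ring
          _ < ε * 1 := by gcongr
          _ = ε := mul_one ε

/-- Chain rule for a `C¹` function composed with an absolutely continuous primitive. -/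
lemma comp_primitive_sub {T : ℝ} {g β β' : ℝ → ℝ}
    (hg : IntervalIntegrable g volume 0 T) (hβ : ∀ x, HasDerivAt β (β' x) x)
    (hβ' : Continuous β') (u0 : ℝ) :
    β (u0 + ∫ s in (0:ℝ)..T, g s) - β u0 =
      ∫ s in (0:ℝ)..T, β' (u0 + ∫ r in (0:ℝ)..s, g r) * g s := by
  set u : ℝ → ℝ := fun s => u0 + ∫ r in (0:ℝ)..s, g r with hu
  have hac0 := hg.absolutelyContinuousOnInterval_intervalIntegral (c := 0) (by simp)
  have hac : AbsolutelyContinuousOnInterval u 0 T :=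
    ((LipschitzWith.const u0).lipschitzOnWith.absolutelyContinuousOnInterval).add hac0
  obtain ⟨C, hC⟩ := hac.exists_bound
  obtain ⟨K, hK⟩ := (isCompact_closedBall (0:ℝ) C).exists_bound_of_continuousOn hβ'.continuousOn
  have hlip : LipschitzOnWith K.toNNReal β (Metric.closedBall (0:ℝ) C) := by
    refine (convex_closedBall (0:ℝ) C).lipschitzOnWith_of_nnnorm_hasDerivWithin_le
      (f' := β') (fun x _ => (hβ x).hasDerivWithinAt) fun x hx => ?_
    rw [← NNReal.coe_le_coe, coe_nnnorm]
    exact (hK x hx).trans (Real.le_coe_toNNReal K)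
  have hac2 := absolutelyContinuousOnInterval_comp hac hlip
    (fun x hx => by simpa using hC x hx)
  have := hac2.integral_deriv_eq_sub
  have hu0 : u 0 = u0 := by simp [hu]
  rw [hu0] at this
  rw [← this]
  apply intervalIntegral.integral_congr_ae
  filter_upwards [hg.ae_hasDerivAt_integral] with x hx hx'
  have h1 := hx (Set.uIoc_subset_uIcc hx') 0 (by simp)
  have h2 : HasDerivAt u (g x) x := by simpa [hu] using h1.const_add u0
  exact ((hβ (u x)).comp x h2).deriv

/-- A Gronwall inequality with integrable coefficient. -/
lemma gronwall_integrable {T X B : ℝ} {m y : ℝ → ℝ} (hX : 0 ≤ X)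
    (hm : IntervalIntegrable m volume 0 T) (hm0 : ∀ s, 0 ≤ m s)
    (hyB : ∀ t ∈ Set.Icc (0:ℝ) T, y t ≤ B)
    (hmy : IntervalIntegrable (fun s => m s * y s) volume 0 T)
    (h : ∀ t ∈ Set.Icc (0:ℝ) T, y t ≤ X + ∫ s in (0:ℝ)..t, m s * y s) :
    ∀ t ∈ Set.Icc (0:ℝ) T, y t ≤ 2 * X * Real.exp (2 * ∫ s in (0:ℝ)..t, m s) := by
  rcases lt_or_ge T 0 with hT | hT
  · intro t ht; exact absurd (ht.1.trans ht.2) (not_le.2 hT)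
  set a : ℝ → ℝ := fun t => ∫ s in (0:ℝ)..t, m s with ha
  have hsub : ∀ t ∈ Set.Icc (0:ℝ) T, Set.uIcc 0 t ⊆ Set.uIcc 0 T := fun t ht => by
    rw [Set.uIcc_of_le ht.1, Set.uIcc_of_le hT]; exact Set.Icc_subset_Icc_right ht.2
  have hacont : ContinuousOn a (Set.uIcc 0 T) :=
    (hm.absolutelyContinuousOnInterval_intervalIntegral (c := 0) (by simp)).continuousOn
  have ha0 : ∀ t ∈ Set.Icc (0:ℝ) T, 0 ≤ a t := fun t ht =>
    intervalIntegral.integral_nonneg ht.1 fun s _ => hm0 s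
  have hexp : ∀ t ∈ Set.Icc (0:ℝ) T,
      ∫ s in (0:ℝ)..t, Real.exp (2 * a s) * m s = (Real.exp (2 * a t) - 1) / 2 := by
    intro t ht
    have := comp_primitive_sub (T := t) (g := m) (β := fun x => Real.exp (2 * x) / 2)
      (β' := fun x => Real.exp (2 * x)) (hm.mono_set (hsub t ht))
      (fun x => by
        have := ((hasDerivAt_id x).const_mul 2).exp.div_const 2
        simpa using this)
      (by fun_prop) 0
    simp only [zero_add, mul_zero, Real.exp_zero] at this
    rw [ha]; rw [← this]; ring
  have key : ∀ z : ℝ, (∀ t ∈ Set.Icc (0:ℝ) T, y t ≤ z * Real.exp (2 * a t)) → 0 ≤ z →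
      ∀ t ∈ Set.Icc (0:ℝ) T, y t ≤ X + z * ((Real.exp (2 * a t) - 1) / 2) := by
    intro z hz _ t ht
    refine (h t ht).trans ?_
    rw [← hexp t ht, ← intervalIntegral.integral_const_mul]
    gcongr
    refine intervalIntegral.integral_mono_on ht.1 (hmy.mono_set (hsub t ht)) ?_ fun s hs => ?_
    · refine IntervalIntegrable.const_mul ?_ z
      refine ((hm.mono_set (hsub t ht))).continuousOn_mul ?_
      exact (Real.continuous_exp.comp_continuousOn
        ((continuousOn_const.mul (hacont.mono (hsub t ht)))))
    · have := hz s ⟨hs.1, hs.2.trans ht.2⟩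
      nlinarith [hm0 s]
  have hX0 : ∀ j : ℕ,
      ∀ t ∈ Set.Icc (0:ℝ) T, y t ≤ (2 * X + |B| / 2 ^ j) * Real.exp (2 * a t) := by
    intro j
    induction j with
    | zero =>
      intro t ht
      have h1 : 1 ≤ Real.exp (2 * a t) := Real.one_le_exp (by linarith [ha0 t ht])
      have := hyB t ht
      have h2 := le_abs_self B
      simp only [pow_zero, div_one]
      nlinarith [abs_nonneg B]
    | succ j ih =>
      intro t ht
      have h1 : 1 ≤ Real.exp (2 * a t) := Real.one_le_exp (by linarith [ha0 t ht])
      have := key _ ih (by positivity) t ht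
      have hp : (0:ℝ) ≤ |B| / 2 ^ j := by positivity
      have h3 : |B| / 2 ^ (j + 1) = |B| / 2 ^ j / 2 := by rw [pow_succ]; field_simp
      rw [h3]
      nlinarith
  intro t ht
  have hl : Tendsto (fun j : ℕ => (2 * X + |B| / 2 ^ j) * Real.exp (2 * a t)) atTop
        (nhds ((2 * X + 0) * Real.exp (2 * a t))) := by
      refine Tendsto.mul_const _ (Tendsto.const_add _ ?_)
      have := (tendsto_pow_atTop_nhds_zero_of_lt_one (r := (1/2 : ℝ)) (by norm_num)
        (by norm_num)).const_mul |B|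
      simpa [div_eq_mul_inv] using this
  rw [add_zero] at hl
  exact ge_of_tendsto' hl fun j => hX0 j t ht

lemma μT_eq_pi (d : ℕ) : μT d = Measure.pi fun _ : Fin d => (volume.restrict (Set.Ico (0:ℝ) 1)) := by
  rw [μT, box, volume_pi, Measure.restrict_pi_pi]

lemma μT_eq_Ioc (d : ℕ) :
    μT d = volume.restrict {x : Fin d → ℝ | ∀ i, x i ∈ Set.Ioc ((0 : Fin d → ℝ) i) ((0 : Fin d → ℝ) i + 1)} := by
  have h1 : {x : Fin d → ℝ | ∀ i, x i ∈ Set.Ioc ((0 : Fin d → ℝ) i) ((0 : Fin d → ℝ) i + 1)}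
      = Set.univ.pi fun _ => Set.Ioc (0:ℝ) 1 := by ext x; simp
  rw [h1, μT, box]
  exact Measure.restrict_congr_set
    ((Measure.univ_pi_Ico_ae_eq_Icc (f := fun _ : Fin d => (0:ℝ)) (g := fun _ => 1)).trans
      (Measure.univ_pi_Ioc_ae_eq_Icc (f := fun _ : Fin d => (0:ℝ)) (g := fun _ => 1)).symm)

lemma μT_eq_Icc (d : ℕ) : μT d = volume.restrict (Set.Icc (0 : Fin d → ℝ) 1) :=
  Measure.restrict_congr_set
    (Measure.univ_pi_Ico_ae_eq_Icc (f := fun _ : Fin d => (0:ℝ)) (g := fun _ => 1))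

instance (d : ℕ) : IsProbabilityMeasure (μT d) := by
  rw [μT_eq_pi]
  have : IsProbabilityMeasure (volume.restrict (Set.Ico (0:ℝ) 1)) := ⟨by simp⟩
  infer_instance

/-- The phase `2π k·x`. -/
def ph {d : ℕ} (k : Fin d → ℤ) (x : Fin d → ℝ) : ℝ := 2 * Real.pi * ∑ i, (k i : ℝ) * x i

lemma fc_eq {d : ℕ} (f : (Fin d → ℝ) → ℝ) (k : Fin d → ℤ) :
    fc f k = ∫ x, (f x : ℂ) * Complex.exp (-(ph k x : ℂ) * Complex.I) ∂(μT d) := by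
  unfold fc ph
  congr 1; ext x; congr 2; push_cast; ring

/-- Parseval's identity on the unit box. -/
lemma parseval {d : ℕ} {f : (Fin d → ℝ) → ℝ} (hf : MemLp f 2 (μT d)) :
    HasSum (fun k => ‖fc f k‖ ^ 2) (∫ x, f x ^ 2 ∂(μT d)) := by
  let _ : MeasureSpace UnitAddCircle := ⟨AddCircle.haarAddCircle⟩
  set σ : UnitAddTorus (Fin d) → (Fin d → ℝ) :=
    fun y => (UnitAddTorus.measurableEquivPiIoc (0 : Fin d → ℝ) y).1 with hσdef
  have hσ : MeasurePreserving σ volume (μT d) := by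
    rw [μT_eq_Ioc]
    have h1 := UnitAddTorus.measurePreserving_equivPiIoc (0 : Fin d → ℝ)
    have h2 := measurePreserving_subtype_coe (μa := (volume : Measure (Fin d → ℝ)))
      (MeasurableSet.univ_pi' (fun i : Fin d =>
        measurableSet_Ioc (a := (0 : Fin d → ℝ) i) (b := (0 : Fin d → ℝ) i + 1)))
    exact h2.comp h1
  have hmk : ∀ y, (fun i => ((σ y i : ℝ) : UnitAddCircle)) = y := fun y =>
    (UnitAddTorus.measurableEquivPiIoc (0 : Fin d → ℝ)).symm_apply_apply y
  have hfC : MemLp (fun x => (f x : ℂ)) 2 (μT d) := hf.ofReal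
  have hF : MemLp (fun y => (f (σ y) : ℂ)) 2 volume := hfC.comp_measurePreserving hσ
  have hP := UnitAddTorus.hasSum_sq_mFourierCoeff (hF.toLp _)
  have hint : ∫ t, ‖(hF.toLp _ : _ → ℂ) t‖ ^ 2 = ∫ x, f x ^ 2 ∂(μT d) := by
    calc ∫ t, ‖(hF.toLp _ : _ → ℂ) t‖ ^ 2 = ∫ t, f (σ t) ^ 2 := by
          apply integral_congr_ae
          filter_upwards [hF.coeFn_toLp] with t ht
          rw [ht]; simp
      _ = ∫ x, f x ^ 2 ∂(μT d) := by
          rw [← hσ.map_eq, integral_map hσ.measurable.aemeasurable]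
          rw [hσ.map_eq]; exact (hf.1.pow 2)
  rw [hint] at hP
  convert hP using 1
  ext k
  congr 2
  unfold UnitAddTorus.mFourierCoeff
  calc fc f k = ∫ y, (f (σ y) : ℂ) * Complex.exp (-(ph k (σ y) : ℂ) * Complex.I) := by
        rw [fc_eq, ← hσ.map_eq, integral_map hσ.measurable.aemeasurable]
        rw [hσ.map_eq]
        refine hfC.1.mul (Continuous.aestronglyMeasurable ?_)
        unfold ph; fun_prop
    _ = _ := by
        apply integral_congr_ae
        filter_upwards [hF.coeFn_toLp] with y hy
        rw [hy, smul_eq_mul, mul_comm]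
        congr 1
        conv_rhs => rw [← hmk y]
        unfold UnitAddTorus.mFourier
        simp only [ContinuousMap.coe_mk, Pi.neg_apply, fourier_coe_apply]
        rw [← Complex.exp_sum]
        congr 1
        unfold ph
        push_cast
        rw [Finset.mul_sum, neg_mul, Finset.sum_mul, ← Finset.sum_neg_distrib]
        refine Finset.sum_congr rfl fun i _ => ?_
        ring

/-- The integral over a period cell of a partial derivative of a periodic function vanishes. -/
lemma integral_pd_eq_zero {d : ℕ} {ψ : (Fin d → ℝ) → ℝ} (hψ : ContDiff ℝ 1 ψ)
    (hp : ZPeriodic ψ) (i : Fin d) : ∫ x, pd i ψ x ∂(μT d) = 0 := by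
  obtain _ | n := d
  · exact i.elim0
  have hcont : Continuous (pd i ψ) := by
    unfold pd; exact (hψ.continuous_fderiv one_ne_zero).clm_apply continuous_const
  rw [μT_eq_Icc]
  have key := integral_divergence_of_hasFDerivAt_off_countable' (n := n) (E := ℝ)
    (0 : Fin (n+1) → ℝ) 1 (fun j => by simp) (fun j x => if j = i then ψ x else 0)
    (fun j x => if j = i then fderiv ℝ ψ x else 0) ∅ Set.countable_empty
    (fun j => by
      by_cases h : j = i
      · simp only [h, if_true]; exact hψ.continuous.continuousOn
      · simp only [h, if_false]; exact continuousOn_const)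
    (fun x _ j => by
      by_cases h : j = i
      · simp only [h, if_true]
        exact ((hψ.differentiable (by norm_num)) x).hasFDerivAt
      · simp only [h, if_false]; exact hasFDerivAt_const _ _)
    (by
      have : (fun x => ∑ j, (if j = i then fderiv ℝ ψ x else 0) (Pi.single j 1)) = pd i ψ := by
        ext x
        rw [Finset.sum_eq_single i] <;> simp +contextual [pd]
      rw [this]
      exact hcont.continuousOn.integrableOn_compact isCompact_Icc)
  have e : ∀ x, ∑ j, (if j = i then fderiv ℝ ψ x else 0) (Pi.single j 1) = pd i ψ x := by
    intro x
    rw [Finset.sum_eq_single i] <;> simp +contextual [pd]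
  simp_rw [e] at key
  rw [key, Finset.sum_eq_zero]
  intro j _
  by_cases h : j = i
  · subst h
    simp only [if_true, Pi.one_apply, Pi.zero_apply]
    rw [sub_eq_zero]
    congr 1
    ext x
    have := hp (j.insertNth 0 x) (Pi.single j 1)
    rw [← this]
    congr 1
    ext l
    refine Fin.succAboveCases j ?_ (fun l => ?_) l
    · simp
    · simp [Fin.succAbove_ne]
  · simp [h]

lemma exists_bound_of_periodic {d : ℕ} {φ : (Fin d → ℝ) → ℝ} (hc : Continuous φ)
    (hp : ZPeriodic φ) : ∃ C, 0 ≤ C ∧ ∀ x, |φ x| ≤ C := by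
  obtain ⟨C, hC⟩ := (isCompact_Icc (a := (0 : Fin d → ℝ)) (b := 1)).exists_bound_of_continuousOn
    hc.continuousOn
  have h : ∀ x, |φ x| ≤ C := by
    intro x
    have := hp (fun i => Int.fract (x i)) (fun i => ⌊x i⌋)
    have hx : ((fun i => Int.fract (x i)) + fun i => ((⌊x i⌋ : ℤ) : ℝ)) = x := by
      ext i; simp [Int.fract_add_floor]
    rw [hx] at this
    rw [this]
    exact hC _ ⟨fun i => Int.fract_nonneg _, fun i => (Int.fract_lt_one _).le⟩
  exact ⟨C, (abs_nonneg _).trans (h 0), h⟩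

lemma Test.bound {d : ℕ} {φ : (Fin d → ℝ) → ℝ} (h : Test φ) : ∃ C, 0 ≤ C ∧ ∀ x, |φ x| ≤ C :=
  exists_bound_of_periodic h.1.continuous h.2

lemma Test.continuous {d : ℕ} {φ : (Fin d → ℝ) → ℝ} (h : Test φ) : Continuous φ := h.1.continuous

lemma Test.memLp {d : ℕ} {φ : (Fin d → ℝ) → ℝ} (h : Test φ) (p : ℝ≥0∞) : MemLp φ p (μT d) := by
  obtain ⟨C, -, hC⟩ := h.bound
  exact MemLp.of_bound h.continuous.aestronglyMeasurable C (ae_of_all _ hC)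

lemma Test.integrable {d : ℕ} {φ : (Fin d → ℝ) → ℝ} (h : Test φ) : Integrable φ (μT d) :=
  memLp_one_iff_integrable.1 (h.memLp 1)

lemma Test.hasFDerivAt {d : ℕ} {φ : (Fin d → ℝ) → ℝ} (h : Test φ) (x) :
    HasFDerivAt φ (fderiv ℝ φ x) x :=
  ((h.1.differentiable (by simp)) x).hasFDerivAt

lemma Test.pd {d : ℕ} {φ : (Fin d → ℝ) → ℝ} (h : Test φ) (i : Fin d) : Test (pd i φ) := by
  refine ⟨?_, fun x k => ?_⟩
  · unfold GaleatiLuo.pd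
    exact (h.1.fderiv_right (m := (⊤ : ℕ∞)) (by simp)).clm_apply contDiff_const
  · unfold GaleatiLuo.pd
    have : φ = fun y => φ (y + fun i => (k i : ℝ)) := funext fun y => (h.2 y k).symm
    conv_rhs => rw [this]
    rw [fderiv_comp_add_right]

lemma Test.mul {d : ℕ} {φ ψ : (Fin d → ℝ) → ℝ} (h : Test φ) (h' : Test ψ) :
    Test (fun x => φ x * ψ x) :=
  ⟨h.1.mul h'.1, fun x k => by simp only [h.2 x k, h'.2 x k]⟩

lemma Test.add {d : ℕ} {φ ψ : (Fin d → ℝ) → ℝ} (h : Test φ) (h' : Test ψ) :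
    Test (fun x => φ x + ψ x) :=
  ⟨h.1.add h'.1, fun x k => by simp only [h.2 x k, h'.2 x k]⟩

lemma Test.sub {d : ℕ} {φ ψ : (Fin d → ℝ) → ℝ} (h : Test φ) (h' : Test ψ) :
    Test (fun x => φ x - ψ x) :=
  ⟨h.1.sub h'.1, fun x k => by simp only [h.2 x k, h'.2 x k]⟩

lemma Test.const_mul {d : ℕ} {φ : (Fin d → ℝ) → ℝ} (h : Test φ) (c : ℝ) :
    Test (fun x => c * φ x) :=
  ⟨contDiff_const.mul h.1, fun x k => by simp only [h.2 x k]⟩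

lemma Test.comp {d : ℕ} {φ : (Fin d → ℝ) → ℝ} (h : Test φ) {β : ℝ → ℝ}
    (hβ : ContDiff ℝ (⊤ : ℕ∞) β) : Test (fun x => β (φ x)) :=
  ⟨hβ.comp h.1, fun x k => by simp only [h.2 x k]⟩

lemma Test.sum {d : ℕ} {ι : Type*} {φ : ι → (Fin d → ℝ) → ℝ} (s : Finset ι)
    (h : ∀ i ∈ s, Test (φ i)) : Test (fun x => ∑ i ∈ s, φ i x) :=
  ⟨ContDiff.sum fun i hi => (h i hi).1, fun x k => Finset.sum_congr rfl fun i hi => (h i hi).2 x k⟩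

lemma Test.lap {d : ℕ} {φ : (Fin d → ℝ) → ℝ} (h : Test φ) : Test (lap φ) :=
  Test.sum _ fun i _ => (h.pd i).pd i

lemma pd_mul {d : ℕ} {φ ψ : (Fin d → ℝ) → ℝ} (h : Test φ) (h' : Test ψ) (i : Fin d) (x) :
    pd i (fun x => φ x * ψ x) x = φ x * pd i ψ x + ψ x * pd i φ x := by
  unfold pd
  have e : HasFDerivAt (fun x => φ x * ψ x) _ x := (h.hasFDerivAt x).mul (h'.hasFDerivAt x)
  rw [e.fderiv]
  simp

lemma pd_comp {d : ℕ} {φ : (Fin d → ℝ) → ℝ} (h : Test φ) {β β' : ℝ → ℝ}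
    (hβ : ∀ z, HasDerivAt β (β' z) z) (i : Fin d) (x) :
    pd i (fun x => β (φ x)) x = β' (φ x) * pd i φ x := by
  unfold pd
  have e : HasFDerivAt (fun x => β (φ x)) _ x := (hβ (φ x)).comp_hasFDerivAt x (h.hasFDerivAt x)
  rw [e.fderiv]
  simp

/-- Integration by parts for smooth periodic functions. -/
lemma integral_mul_pd {d : ℕ} {φ ψ : (Fin d → ℝ) → ℝ} (h : Test φ) (h' : Test ψ) (i : Fin d) :
    ∫ x, φ x * pd i ψ x ∂(μT d) = - ∫ x, pd i φ x * ψ x ∂(μT d) := by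
  have h0 := integral_pd_eq_zero ((h.mul h').1.of_le (by simp)) (h.mul h').2 i
  have e : ∀ x, pd i (fun x => φ x * ψ x) x = φ x * pd i ψ x + pd i φ x * ψ x := fun x => by
    rw [pd_mul h h']; ring
  simp_rw [e] at h0
  rw [integral_add (h.mul (h'.pd i)).integrable ((h.pd i).mul h').integrable] at h0
  linarith

lemma ph_add_left {d : ℕ} (k l : Fin d → ℤ) (x) : ph (k + l) x = ph k x + ph l x := by
  unfold ph; rw [← mul_add, ← Finset.sum_add_distrib]
  congr 2; ext i; push_cast [Pi.add_apply]; ring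

lemma ph_sub_left {d : ℕ} (k l : Fin d → ℤ) (x) : ph (k - l) x = ph k x - ph l x := by
  unfold ph; rw [← mul_sub, ← Finset.sum_sub_distrib]
  congr 2; ext i; push_cast [Pi.sub_apply]; ring

lemma ph_neg {d : ℕ} (k : Fin d → ℤ) (x) : ph (-k) x = - ph k x := by
  have := ph_sub_left 0 k x
  simp only [zero_sub] at this
  rw [this]; simp [ph]

lemma ph_zero {d : ℕ} (x : Fin d → ℝ) : ph 0 x = 0 := by simp [ph]

lemma ph_shift {d : ℕ} (k : Fin d → ℤ) (x) (n : Fin d → ℤ) :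
    ph k (x + fun i => (n i : ℝ)) = ph k x + (∑ i, k i * n i : ℤ) * (2 * Real.pi) := by
  unfold ph; push_cast
  rw [mul_comm (∑ i, (k i : ℝ) * n i), ← mul_add, ← Finset.sum_add_distrib]
  congr 2; ext i; simp; ring

/-- `cos(2π k·x)`. -/
def cs {d : ℕ} (k : Fin d → ℤ) (x : Fin d → ℝ) : ℝ := Real.cos (ph k x)

/-- `sin(2π k·x)`. -/
def sn {d : ℕ} (k : Fin d → ℤ) (x : Fin d → ℝ) : ℝ := Real.sin (ph k x)

lemma contDiff_ph {d : ℕ} (k : Fin d → ℤ) : ContDiff ℝ (⊤ : ℕ∞) (ph k) := by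
  unfold ph; fun_prop

lemma test_cs {d : ℕ} (k : Fin d → ℤ) : Test (cs k) :=
  ⟨Real.contDiff_cos.comp (contDiff_ph k), fun x n => by
    unfold cs; rw [ph_shift, Real.cos_add_int_mul_two_pi]⟩

lemma test_sn {d : ℕ} (k : Fin d → ℤ) : Test (sn k) :=
  ⟨Real.contDiff_sin.comp (contDiff_ph k), fun x n => by
    unfold sn; rw [ph_shift, Real.sin_add_int_mul_two_pi]⟩

lemma cs_neg {d : ℕ} (k : Fin d → ℤ) : cs (-k) = cs k := by ext x; simp [cs, ph_neg]
lemma sn_neg {d : ℕ} (k : Fin d → ℤ) : sn (-k) = fun x => - sn k x := by ext x; simp [sn, ph_neg]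
lemma abs_cs_le {d : ℕ} (k : Fin d → ℤ) (x) : |cs k x| ≤ 1 := Real.abs_cos_le_one _
lemma abs_sn_le {d : ℕ} (k : Fin d → ℤ) (x) : |sn k x| ≤ 1 := Real.abs_sin_le_one _

/-- The frequency `2π k_i`. -/
def fq {d : ℕ} (i : Fin d) (k : Fin d → ℤ) : ℝ := 2 * Real.pi * k i

lemma hasFDerivAt_ph {d : ℕ} (k : Fin d → ℤ) (x) :
    HasFDerivAt (ph k) ((2 * Real.pi) • ∑ i, (k i : ℝ) • ContinuousLinearMap.proj (R := ℝ)
      (φ := fun _ : Fin d => ℝ) i) x := by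
  unfold ph
  refine HasFDerivAt.const_mul ?_ _
  exact HasFDerivAt.fun_sum fun i _ => (hasFDerivAt_apply i x).const_mul _

lemma fderiv_ph_single {d : ℕ} (k : Fin d → ℤ) (i : Fin d) :
    ((2 * Real.pi) • ∑ i, (k i : ℝ) • ContinuousLinearMap.proj (R := ℝ)
      (φ := fun _ : Fin d => ℝ) i) (Pi.single i 1) = fq i k := by
  simp [fq, Pi.single_apply]

lemma pd_cs {d : ℕ} (k : Fin d → ℤ) (i : Fin d) : pd i (cs k) = fun x => -(fq i k) * sn k x := by
  ext x
  unfold pd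
  have : HasFDerivAt (cs k) _ x := (hasFDerivAt_ph k x).cos
  rw [this.fderiv, smul_apply, fderiv_ph_single]
  simp [sn]; ring

lemma pd_sn {d : ℕ} (k : Fin d → ℤ) (i : Fin d) : pd i (sn k) = fun x => fq i k * cs k x := by
  ext x
  unfold pd
  have : HasFDerivAt (sn k) _ x := (hasFDerivAt_ph k x).sin
  rw [this.fderiv, smul_apply, fderiv_ph_single]
  simp [cs]; ring

lemma fq_ne_zero {d : ℕ} {k : Fin d → ℤ} {i : Fin d} (h : k i ≠ 0) : fq i k ≠ 0 := by
  unfold fq; have := Real.pi_pos; positivity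

lemma integral_sn {d : ℕ} (k : Fin d → ℤ) : ∫ x, sn k x ∂(μT d) = 0 := by
  by_cases hk : k = 0
  · subst hk; simp [sn, ph_zero]
  · obtain ⟨i, hi⟩ := Function.ne_iff.1 hk
    have := integral_pd_eq_zero ((test_cs k).1.of_le (by simp)) (test_cs k).2 i
    rw [pd_cs, integral_const_mul] at this
    simpa [fq_ne_zero hi] using this

lemma integral_cs {d : ℕ} (k : Fin d → ℤ) : ∫ x, cs k x ∂(μT d) = if k = 0 then 1 else 0 := by
  split_ifs with hk
  · subst hk; simp [cs, ph_zero]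
  · obtain ⟨i, hi⟩ := Function.ne_iff.1 hk
    have := integral_pd_eq_zero ((test_sn k).1.of_le (by simp)) (test_sn k).2 i
    rw [pd_sn, integral_const_mul] at this
    simpa [fq_ne_zero hi] using this

lemma integral_cs_mul_cs {d : ℕ} (q k : Fin d → ℤ) : ∫ x, cs q x * cs k x ∂(μT d) =
    ((if q = k then 1 else 0) + if q = -k then 1 else 0) / 2 := by
  have e : ∀ x, cs q x * cs k x = (cs (q - k) x + cs (q + k) x) / 2 := fun x => by
    unfold cs; rw [ph_sub_left, ph_add_left, Real.cos_add, Real.cos_sub]; ring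
  simp_rw [e]
  rw [integral_div, integral_add (test_cs _).integrable (test_cs _).integrable, integral_cs,
    integral_cs]
  simp only [sub_eq_zero, add_eq_zero_iff_eq_neg]

lemma integral_sn_mul_sn {d : ℕ} (q k : Fin d → ℤ) : ∫ x, sn q x * sn k x ∂(μT d) =
    ((if q = k then 1 else 0) - if q = -k then 1 else 0) / 2 := by
  have e : ∀ x, sn q x * sn k x = (cs (q - k) x - cs (q + k) x) / 2 := fun x => by
    unfold cs sn; rw [ph_sub_left, ph_add_left, Real.cos_add, Real.cos_sub]; ring
  simp_rw [e]
  rw [integral_div, integral_sub (test_cs _).integrable (test_cs _).integrable, integral_cs,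
    integral_cs]
  simp only [sub_eq_zero, add_eq_zero_iff_eq_neg]

lemma integral_sn_mul_cs {d : ℕ} (q k : Fin d → ℤ) : ∫ x, sn q x * cs k x ∂(μT d) = 0 := by
  have e : ∀ x, sn q x * cs k x = (sn (q - k) x + sn (q + k) x) / 2 := fun x => by
    unfold cs sn; rw [ph_sub_left, ph_add_left, Real.sin_add, Real.sin_sub]; ring
  simp_rw [e]
  rw [integral_div, integral_add (test_sn _).integrable (test_sn _).integrable, integral_sn,
    integral_sn]
  simp

lemma integrable_mul_test {d : ℕ} {f φ : (Fin d → ℝ) → ℝ} (hf : Integrable f (μT d))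
    (hφ : Test φ) : Integrable (fun x => f x * φ x) (μT d) := by
  obtain ⟨C, -, hC⟩ := hφ.bound
  exact hf.mul_bdd hφ.continuous.aestronglyMeasurable (ae_of_all _ hC)

lemma fc_eq_pairT {d : ℕ} {f : (Fin d → ℝ) → ℝ} (hf : Integrable f (μT d)) (k : Fin d → ℤ) :
    fc f k = (pairT f (cs k) : ℂ) - (pairT f (sn k) : ℂ) * Complex.I := by
  rw [fc_eq, pairT, pairT, ← integral_complex_ofReal, ← integral_complex_ofReal,
    ← integral_mul_const, ← integral_sub]
  · congr 1; ext x
    rw [Complex.exp_mul_I, Complex.cos_neg, Complex.sin_neg]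
    unfold cs sn; push_cast; ring
  · exact (integrable_mul_test hf (test_cs k)).ofReal
  · exact ((integrable_mul_test hf (test_sn k)).ofReal).mul_const _

lemma fc_pd {d : ℕ} {ψ : (Fin d → ℝ) → ℝ} (h : Test ψ) (i : Fin d) (k : Fin d → ℤ) :
    fc (pd i ψ) k = fq i k * Complex.I * fc ψ k := by
  rw [fc_eq_pairT (h.pd i).integrable, fc_eq_pairT h.integrable]
  have h1 : pairT (pd i ψ) (cs k) = fq i k * pairT ψ (sn k) := by
    have := integral_mul_pd h (test_cs k) i
    unfold pairT
    rw [← integral_const_mul, ← neg_eq_iff_eq_neg.2 this, pd_cs, ← integral_neg]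
    congr 1; ext x; ring
  have h2 : pairT (pd i ψ) (sn k) = - fq i k * pairT ψ (cs k) := by
    have := integral_mul_pd h (test_sn k) i
    unfold pairT
    rw [← integral_const_mul, ← neg_eq_iff_eq_neg.2 this, pd_sn, ← integral_neg]
    congr 1; ext x; ring
  rw [h1, h2]; push_cast
  linear_combination (fq i k * pairT ψ (sn k) : ℂ) * Complex.I_sq

/-- The cube `{0, …, N}^d` of lattice points. -/
def cube (d N : ℕ) : Finset (Fin d → ℤ) := Fintype.piFinset fun _ => Finset.Icc (0 : ℤ) N

lemma card_cube (d N : ℕ) : (cube d N).card = (N + 1) ^ d := by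
  simp [cube, Fintype.card_piFinset]

lemma card_cube_pos (d N : ℕ) : (0 : ℝ) < (cube d N).card := by
  rw [card_cube]; positivity

/-- The multiplier of the Fejér operator. -/
def mult {d : ℕ} (N : ℕ) (k : Fin d → ℤ) : ℝ :=
  ((cube d N).card : ℝ)⁻¹ * ∑ p ∈ cube d N ×ˢ cube d N, if p.1 - p.2 = k then 1 else 0

/-- The Fejér mean of the trigonometric series with coefficients `A`, `B`. -/
def syn {d : ℕ} (N : ℕ) (A B : (Fin d → ℤ) → ℝ) (x : Fin d → ℝ) : ℝ :=
  ((cube d N).card : ℝ)⁻¹ * ∑ p ∈ cube d N ×ˢ cube d N,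
    (A (p.1 - p.2) * cs (p.1 - p.2) x + B (p.1 - p.2) * sn (p.1 - p.2) x)

/-- The Fejér mean of a function. -/
def fej {d : ℕ} (N : ℕ) (f : (Fin d → ℝ) → ℝ) : (Fin d → ℝ) → ℝ :=
  syn N (fun k => pairT f (cs k)) fun k => pairT f (sn k)

lemma mult_nonneg {d : ℕ} (N : ℕ) (k : Fin d → ℤ) : 0 ≤ mult N k := by
  unfold mult; positivity

lemma mult_eq {d : ℕ} (N : ℕ) (k : Fin d → ℤ) : mult N k = ((cube d N).card : ℝ)⁻¹ *
    ((cube d N ×ˢ cube d N).filter fun p => p.1 - p.2 = k).card := by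
  unfold mult; rw [Finset.sum_ite]; simp

lemma mult_le_one {d : ℕ} (N : ℕ) (k : Fin d → ℤ) : mult N k ≤ 1 := by
  rw [mult_eq, inv_mul_le_one₀ (card_cube_pos d N), Nat.cast_le]
  refine Finset.card_le_card_of_injOn (fun p => p.1) (fun p hp => ?_) ?_
  · simp at hp; exact hp.1.1
  · rintro ⟨a, b⟩ hp ⟨a', b'⟩ hp' h
    simp at hp hp' h
    subst h
    rw [Prod.mk.injEq]
    refine ⟨rfl, ?_⟩
    have := hp.2.trans hp'.2.symm
    simpa using this

lemma mult_zero {d : ℕ} (N : ℕ) : mult N (0 : Fin d → ℤ) = 1 := by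
  refine le_antisymm (mult_le_one _ _) ?_
  rw [mult_eq, ← div_eq_inv_mul, one_le_div (card_cube_pos d N), Nat.cast_le]
  refine Finset.card_le_card_of_injOn (fun p => (p, p)) (fun p hp => ?_) ?_
  · simpa using hp
  · intro a _ b _ h; simpa using h

lemma mult_neg {d : ℕ} (N : ℕ) (k : Fin d → ℤ) : mult N (-k) = mult N k := by
  unfold mult
  congr 1
  refine Finset.sum_nbij' (fun p => (p.2, p.1)) (fun p => (p.2, p.1)) ?_ ?_ ?_ ?_ ?_
  · intro p hp; simp at hp ⊢; exact hp.symm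
  · intro p hp; simp at hp ⊢; exact hp.symm
  · intro p _; rfl
  · intro p _; rfl
  · intro p _
    have : (p.1 - p.2 = -k) ↔ (p.2 - p.1 = k) := by
      rw [← neg_sub, neg_inj]
    simp only [this]

lemma mult_lower {d : ℕ} (N : ℕ) (k : Fin d → ℤ) (hk : ∀ i, |k i| ≤ N) :
    ∏ i, (1 - |(k i : ℝ)| / (N + 1)) ≤ mult N k := by
  have hN : (0 : ℝ) < (N : ℝ) + 1 := by positivity
  have e : ∏ i, (1 - |(k i : ℝ)| / (N + 1)) =
      ((cube d N).card : ℝ)⁻¹ * ∏ i, ((N : ℝ) + 1 - |(k i : ℝ)|) := by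
    rw [card_cube]
    have : ∀ i, (1 - |(k i : ℝ)| / (N + 1)) = ((N : ℝ) + 1 - |(k i : ℝ)|) / (N + 1) :=
      fun i => by field_simp
    simp_rw [this]
    rw [Finset.prod_div_distrib]; simp; field_simp
  rw [e, mult_eq]
  refine mul_le_mul_of_nonneg_left ?_ (by positivity)
  have h1 : (Fintype.piFinset fun i => Finset.Icc (max 0 (k i)) (min (N : ℤ) (N + k i))).card ≤
      ((cube d N ×ˢ cube d N).filter fun p => p.1 - p.2 = k).card := by
    refine Finset.card_le_card_of_injOn (fun p => (p, p - k)) (fun p hp => ?_) ?_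
    · rw [Finset.mem_coe, Fintype.mem_piFinset] at hp
      have hp' := fun i => Finset.mem_Icc.1 (hp i)
      rw [Finset.mem_coe, Finset.mem_filter, Finset.mem_product, cube, Fintype.mem_piFinset,
        Fintype.mem_piFinset]
      refine ⟨⟨fun i => Finset.mem_Icc.2 ?_, fun i => Finset.mem_Icc.2 ?_⟩, by simp⟩ <;>
      · have := hp' i
        simp only [Pi.sub_apply]
        omega
    · intro a _ b _ h; simp at h; exact h
  refine le_trans (le_of_eq ?_) (Nat.cast_le.2 h1)
  rw [Fintype.card_piFinset]; push_cast
  refine Finset.prod_congr rfl fun i _ => ?_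
  rw [Int.card_Icc]
  have h2 := abs_le.1 (hk i)
  have h3 : (min (N : ℤ) (N + k i) + 1 - max 0 (k i)) = N + 1 - |k i| := by
    rcases abs_cases (k i) with h | h <;> omega
  have h4 : ((min (N : ℤ) (N + k i) + 1 - max 0 (k i)).toNat : ℤ) = N + 1 - |k i| := by
    rw [h3, Int.toNat_of_nonneg]; have := hk i; omega
  have : (((min (N : ℤ) (N + k i) + 1 - max 0 (k i)).toNat : ℤ) : ℝ) =
      ((N + 1 - |k i| : ℤ) : ℝ) := by rw [h4]
  push_cast at this
  rw [← this]

lemma tendsto_mult {d : ℕ} (k : Fin d → ℤ) : Tendsto (fun N => mult N k) atTop (nhds 1) := by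
  have h1 : Tendsto (fun N : ℕ => ∏ i, (1 - |(k i : ℝ)| / ((N : ℝ) + 1))) atTop (nhds 1) := by
    have : nhds (1 : ℝ) = nhds (∏ i : Fin d, (1 - 0)) := by simp
    rw [this]
    refine tendsto_finsetProd _ fun i _ => tendsto_const_nhds.sub ?_
    exact tendsto_const_nhds.div_atTop (tendsto_natCast_atTop_atTop.atTop_add tendsto_const_nhds)
  refine tendsto_of_tendsto_of_tendsto_of_le_of_le' h1 tendsto_const_nhds ?_
    (Eventually.of_forall fun N => mult_le_one _ _)
  filter_upwards [eventually_ge_atTop (∑ i, (k i).natAbs)] with N hN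
  refine mult_lower N k fun i => ?_
  have : (k i).natAbs ≤ ∑ i, (k i).natAbs :=
    Finset.single_le_sum (f := fun i => (k i).natAbs) (fun _ _ => Nat.zero_le _) (Finset.mem_univ i)
  rw [Int.abs_eq_natAbs]
  exact_mod_cast this.trans hN

section Syn
variable {d : ℕ} (N : ℕ)

lemma test_syn (A B : (Fin d → ℤ) → ℝ) : Test (syn N A B) := by
  unfold syn
  exact (Test.sum _ fun p _ => ((test_cs _).const_mul _).add ((test_sn _).const_mul _)).const_mul _

lemma pd_syn (A B : (Fin d → ℤ) → ℝ) (i : Fin d) : pd i (syn N A B) =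
    syn N (fun k => fq i k * B k) (fun k => -(fq i k * A k)) := by
  ext x
  have e : HasFDerivAt (syn N A B) (((cube d N).card : ℝ)⁻¹ • ∑ p ∈ cube d N ×ˢ cube d N,
      (A (p.1 - p.2) • fderiv ℝ (cs (p.1 - p.2)) x +
        B (p.1 - p.2) • fderiv ℝ (sn (p.1 - p.2)) x)) x := by
    unfold syn
    refine HasFDerivAt.const_mul (HasFDerivAt.fun_sum fun p _ => HasFDerivAt.fun_add ?_ ?_) _
    · exact ((test_cs _).hasFDerivAt x).const_mul _
    · exact ((test_sn _).hasFDerivAt x).const_mul _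
  unfold pd
  rw [e.fderiv]
  simp only [smul_apply, sum_apply, add_apply, smul_eq_mul]
  unfold syn
  congr 1
  refine Finset.sum_congr rfl fun p _ => ?_
  have h1 := congrFun (pd_cs (p.1 - p.2) i) x
  have h2 := congrFun (pd_sn (p.1 - p.2) i) x
  unfold pd at h1 h2
  rw [h1, h2]; ring

lemma lap_syn (A B : (Fin d → ℤ) → ℝ) : lap (syn N A B) =
    syn N (fun k => -(∑ i, fq i k ^ 2) * A k) (fun k => -(∑ i, fq i k ^ 2) * B k) := by
  ext x
  unfold lap
  simp_rw [pd_syn]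
  unfold syn
  rw [← Finset.mul_sum, Finset.sum_comm]
  congr 1
  refine Finset.sum_congr rfl fun p _ => ?_
  beta_reduce
  rw [neg_mul, neg_mul, Finset.sum_mul, Finset.sum_mul, ← Finset.sum_neg_distrib,
    ← Finset.sum_neg_distrib, Finset.sum_mul, Finset.sum_mul, ← Finset.sum_add_distrib]
  refine Finset.sum_congr rfl fun i _ => ?_
  ring

lemma syn_add (A B A' B' : (Fin d → ℤ) → ℝ) (x) :
    syn N (fun k => A k + A' k) (fun k => B k + B' k) x = syn N A B x + syn N A' B' x := by
  unfold syn
  rw [← mul_add, ← Finset.sum_add_distrib]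
  congr 1; refine Finset.sum_congr rfl fun p _ => ?_
  ring

lemma syn_sub (A B A' B' : (Fin d → ℤ) → ℝ) (x) :
    syn N (fun k => A k - A' k) (fun k => B k - B' k) x = syn N A B x - syn N A' B' x := by
  unfold syn
  rw [← mul_sub, ← Finset.sum_sub_distrib]
  congr 1; refine Finset.sum_congr rfl fun p _ => ?_
  ring

lemma abs_syn_le (A B : (Fin d → ℤ) → ℝ) (x) : |syn N A B x| ≤
    ((cube d N).card : ℝ)⁻¹ * ∑ p ∈ cube d N ×ˢ cube d N,
      (|A (p.1 - p.2)| + |B (p.1 - p.2)|) := by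
  unfold syn
  rw [abs_mul, abs_of_nonneg (by positivity)]
  refine mul_le_mul_of_nonneg_left ((Finset.abs_sum_le_sum_abs _ _).trans
    (Finset.sum_le_sum fun p _ => (abs_add_le _ _).trans ?_)) (by positivity)
  rw [abs_mul, abs_mul]
  exact add_le_add (mul_le_of_le_one_right (abs_nonneg _) (abs_cs_le _ _))
    (mul_le_of_le_one_right (abs_nonneg _) (abs_sn_le _ _))

lemma pairT_cs_neg (f : (Fin d → ℝ) → ℝ) (k) : pairT f (cs (-k)) = pairT f (cs k) := by
  rw [cs_neg]

lemma pairT_sn_neg (f : (Fin d → ℝ) → ℝ) (k) : pairT f (sn (-k)) = - pairT f (sn k) := by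
  rw [sn_neg]; unfold pairT; rw [← integral_neg]; congr 1; ext x; ring

lemma pairT_syn_cs {A B : (Fin d → ℤ) → ℝ} (hA : ∀ k, A (-k) = A k) (k) :
    pairT (syn N A B) (cs k) = mult N k * A k := by
  have e : ∀ x, syn N A B x * cs k x = ∑ p ∈ cube d N ×ˢ cube d N, ((cube d N).card : ℝ)⁻¹ *
      (A (p.1 - p.2) * (cs (p.1 - p.2) x * cs k x) +
        B (p.1 - p.2) * (sn (p.1 - p.2) x * cs k x)) := fun x => by
    unfold syn; rw [mul_assoc, Finset.sum_mul, Finset.mul_sum]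
    refine Finset.sum_congr rfl fun p _ => ?_
    ring
  unfold pairT; simp_rw [e]
  rw [integral_finsetSum]
  · simp_rw [integral_const_mul]
    have : ∀ p : (Fin d → ℤ) × (Fin d → ℤ), ∫ x, (A (p.1 - p.2) * (cs (p.1 - p.2) x * cs k x) +
        B (p.1 - p.2) * (sn (p.1 - p.2) x * cs k x)) ∂(μT d) =
        ((if p.1 - p.2 = k then 1 else 0) + (if p.1 - p.2 = -k then 1 else 0)) * (A k / 2) := by
      intro p
      rw [integral_add, integral_const_mul, integral_const_mul, integral_cs_mul_cs,
        integral_sn_mul_cs]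
      · split_ifs with h1 h2 h2
        · rw [h1]; ring
        · rw [h1]; ring
        · rw [h2, hA]; ring
        · ring
      · exact (((test_cs _).mul (test_cs _)).const_mul _).integrable
      · exact (((test_sn _).mul (test_cs _)).const_mul _).integrable
    simp_rw [this]
    rw [← Finset.mul_sum, ← Finset.sum_mul, Finset.sum_add_distrib, ← mul_assoc, mul_add]
    change (mult N k + mult N (-k)) * _ = _
    rw [mult_neg]; ring
  · intro p _
    exact ((((test_cs _).mul (test_cs _)).const_mul _).add
      (((test_sn _).mul (test_cs _)).const_mul _)).const_mul _ |>.integrable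

lemma pairT_syn_sn {A B : (Fin d → ℤ) → ℝ} (hB : ∀ k, B (-k) = - B k) (k) :
    pairT (syn N A B) (sn k) = mult N k * B k := by
  have e : ∀ x, syn N A B x * sn k x = ∑ p ∈ cube d N ×ˢ cube d N, ((cube d N).card : ℝ)⁻¹ *
      (A (p.1 - p.2) * (sn k x * cs (p.1 - p.2) x) +
        B (p.1 - p.2) * (sn (p.1 - p.2) x * sn k x)) := fun x => by
    unfold syn; rw [mul_assoc, Finset.sum_mul, Finset.mul_sum]
    refine Finset.sum_congr rfl fun p _ => ?_
    ring
  unfold pairT; simp_rw [e]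
  rw [integral_finsetSum]
  · simp_rw [integral_const_mul]
    have : ∀ p : (Fin d → ℤ) × (Fin d → ℤ), ∫ x, (A (p.1 - p.2) * (sn k x * cs (p.1 - p.2) x) +
        B (p.1 - p.2) * (sn (p.1 - p.2) x * sn k x)) ∂(μT d) =
        ((if p.1 - p.2 = k then 1 else 0) + (if p.1 - p.2 = -k then 1 else 0)) * (B k / 2) := by
      intro p
      rw [integral_add, integral_const_mul, integral_const_mul, integral_sn_mul_sn,
        integral_sn_mul_cs]
      · split_ifs with h1 h2 h2
        · have : B k = 0 := by
            have := hB k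
            rw [← h2, h1] at this; linarith
          rw [h1, this]; ring
        · rw [h1]; ring
        · rw [h2, hB]; ring
        · ring
      · exact (((test_sn _).mul (test_cs _)).const_mul _).integrable
      · exact (((test_sn _).mul (test_sn _)).const_mul _).integrable
    simp_rw [this]
    rw [← Finset.mul_sum, ← Finset.sum_mul, Finset.sum_add_distrib, ← mul_assoc, mul_add]
    change (mult N k + mult N (-k)) * _ = _
    rw [mult_neg]; ring
  · intro p _
    exact ((((test_sn _).mul (test_cs _)).const_mul _).add
      (((test_sn _).mul (test_sn _)).const_mul _)).const_mul _ |>.integrable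

lemma test_fej (f : (Fin d → ℝ) → ℝ) : Test (fej N f) := test_syn _ _ _

lemma fc_fej {f : (Fin d → ℝ) → ℝ} (hf : Integrable f (μT d)) (k) :
    fc (fej N f) k = mult N k * fc f k := by
  rw [fc_eq_pairT (test_fej N f).integrable, fc_eq_pairT hf]
  unfold fej
  rw [pairT_syn_cs N (pairT_cs_neg f), pairT_syn_sn N (pairT_sn_neg f)]
  push_cast; ring

/-- The Fejér kernel. -/
def fejK (x y : Fin d → ℝ) : ℝ := ((cube d N).card : ℝ)⁻¹ *
  ((∑ p ∈ cube d N, Real.cos (ph p x - ph p y)) ^ 2 +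
    (∑ p ∈ cube d N, Real.sin (ph p x - ph p y)) ^ 2)

lemma fejK_nonneg (x y : Fin d → ℝ) : 0 ≤ fejK N x y := by unfold fejK; positivity

lemma fejK_eq (x y : Fin d → ℝ) : fejK N x y = ((cube d N).card : ℝ)⁻¹ *
    ∑ p ∈ cube d N ×ˢ cube d N,
      (cs (p.1 - p.2) y * cs (p.1 - p.2) x + sn (p.1 - p.2) y * sn (p.1 - p.2) x) := by
  unfold fejK
  rw [sq, sq, Finset.sum_mul_sum, Finset.sum_mul_sum, ← Finset.sum_product', ← Finset.sum_product',
    ← Finset.sum_add_distrib]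
  congr 1
  refine Finset.sum_congr rfl fun p _ => ?_
  unfold cs sn
  rw [← Real.cos_sub, mul_comm (Real.cos (ph (p.1 - p.2) y)),
    mul_comm (Real.sin (ph (p.1 - p.2) y)), ← Real.cos_sub, ph_sub_left, ph_sub_left]
  congr 1; ring

lemma fej_eq_integral {f : (Fin d → ℝ) → ℝ} (hf : Integrable f (μT d)) (x) :
    fej N f x = ∫ y, f y * fejK N x y ∂(μT d) := by
  simp_rw [fejK_eq]
  have e : ∀ y, f y * (((cube d N).card : ℝ)⁻¹ * ∑ p ∈ cube d N ×ˢ cube d N,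
      (cs (p.1 - p.2) y * cs (p.1 - p.2) x + sn (p.1 - p.2) y * sn (p.1 - p.2) x)) =
      ((cube d N).card : ℝ)⁻¹ * ∑ p ∈ cube d N ×ˢ cube d N,
      (f y * cs (p.1 - p.2) y * cs (p.1 - p.2) x + f y * sn (p.1 - p.2) y * sn (p.1 - p.2) x) := by
    intro y
    rw [mul_left_comm, Finset.mul_sum]
    congr 1
    refine Finset.sum_congr rfl fun p _ => ?_
    ring
  simp_rw [e]
  have i1 := fun q : Fin d → ℤ => (integrable_mul_test hf (test_cs q)).mul_const (cs q x)
  have i2 := fun q : Fin d → ℤ => (integrable_mul_test hf (test_sn q)).mul_const (sn q x)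
  rw [integral_const_mul, integral_finsetSum _ fun p _ => by exact (i1 _).add (i2 _)]
  unfold fej syn
  congr 1
  refine Finset.sum_congr rfl fun p _ => ?_
  rw [integral_add (i1 _) (i2 _), integral_mul_const, integral_mul_const]
  rfl

lemma abs_fej_le {f : (Fin d → ℝ) → ℝ} (hf : Integrable f (μT d)) (x) :
    |fej N f x| ≤ fej N (fun y => |f y|) x := by
  rw [fej_eq_integral N hf, fej_eq_integral N hf.abs]
  refine (abs_integral_le_integral_abs).trans (le_of_eq ?_)
  congr 1; ext y
  rw [abs_mul, abs_of_nonneg (fejK_nonneg N x y)]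

lemma integral_fej {f : (Fin d → ℝ) → ℝ} : ∫ x, fej N f x ∂(μT d) = ∫ x, f x ∂(μT d) := by
  have h1 : ∀ g : (Fin d → ℝ) → ℝ, pairT g (cs 0) = ∫ x, g x ∂(μT d) := fun g => by
    simp [pairT, cs, ph_zero]
  rw [← h1, ← h1]
  unfold fej
  rw [pairT_syn_cs N (pairT_cs_neg f), mult_zero, one_mul]

lemma integral_abs_fej_le {f : (Fin d → ℝ) → ℝ} (hf : Integrable f (μT d)) :
    ∫ x, |fej N f x| ∂(μT d) ≤ ∫ x, |f x| ∂(μT d) := by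
  rw [← integral_fej N (f := fun x => |f x|)]
  exact integral_mono (test_fej N f).integrable.abs (test_fej N _).integrable (abs_fej_le N hf)

end Syn

section L2
variable {α : Type*} {m0 : MeasurableSpace α} {μ : Measure α}

lemma integral_abs_mul_le {f g : α → ℝ} (hf : MemLp f 2 μ) (hg : MemLp g 2 μ) :
    ∫ x, |f x * g x| ∂μ ≤ √(∫ x, f x ^ 2 ∂μ) * √(∫ x, g x ^ 2 ∂μ) := by
  have := integral_mul_norm_le_Lp_mul_Lq (p := 2) (q := 2) (μ := μ) (f := f) (g := g)
    (Real.HolderConjugate.two_two) (by simpa using hf) (by simpa using hg)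
  simp only [Real.norm_eq_abs, ← Real.sqrt_eq_rpow, Real.rpow_two, sq_abs] at this
  simpa [abs_mul] using this

lemma abs_integral_mul_le {f g : α → ℝ} (hf : MemLp f 2 μ) (hg : MemLp g 2 μ) :
    |∫ x, f x * g x ∂μ| ≤ √(∫ x, f x ^ 2 ∂μ) * √(∫ x, g x ^ 2 ∂μ) :=
  abs_integral_le_integral_abs.trans (integral_abs_mul_le hf hg)

lemma eLpNorm_two_sq {f : α → ℝ} (hf : MemLp f 2 μ) :
    eLpNorm f 2 μ ^ 2 = ENNReal.ofReal (∫ x, f x ^ 2 ∂μ) := by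
  rw [eLpNorm_eq_lintegral_rpow_enorm_toReal (by simp) (by simp),
    ofReal_integral_eq_lintegral_ofReal hf.integrable_sq (ae_of_all _ fun x => sq_nonneg _),
    ← ENNReal.rpow_natCast, ← ENNReal.rpow_mul]
  simp only [ENNReal.toReal_ofNat, Nat.cast_ofNat, one_div, ne_eq, OfNat.ofNat_ne_zero,
    not_false_eq_true, inv_mul_cancel₀, ENNReal.rpow_one]
  refine lintegral_congr fun x => ?_
  rw [ENNReal.rpow_two, Real.enorm_eq_ofReal_abs, ← ENNReal.ofReal_pow (abs_nonneg _), sq_abs]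

lemma exists_l2_limit {ψ : ℕ → α → ℝ} (hψ : ∀ n, MemLp (ψ n) 2 μ)
    (hc : ∀ ε > 0, ∃ N, ∀ n ≥ N, ∀ m ≥ N, ∫ x, (ψ n x - ψ m x) ^ 2 ∂μ < ε) :
    ∃ g : α → ℝ, Measurable g ∧ MemLp g 2 μ ∧
      Tendsto (fun n => ∫ x, (ψ n x - g x) ^ 2 ∂μ) atTop (nhds 0) := by
  have hcau : CauchySeq fun n => (hψ n).toLp (ψ n) := by
    rw [EMetric.cauchySeq_iff]
    intro ε hε
    obtain ⟨e, he, hee⟩ : ∃ e : ℝ, 0 < e ∧ ENNReal.ofReal e ≤ ε := by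
      by_cases h : ε = ∞
      · exact ⟨1, one_pos, h ▸ le_top⟩
      · exact ⟨ε.toReal, ENNReal.toReal_pos hε.ne' h, ENNReal.ofReal_toReal_le⟩
    obtain ⟨N, hN⟩ := hc (e ^ 2) (by positivity)
    refine ⟨N, fun n hn m hm => lt_of_lt_of_le ?_ hee⟩
    rw [Lp.edist_toLp_toLp]
    have h1 := eLpNorm_two_sq ((hψ n).sub (hψ m))
    have h2 : eLpNorm (ψ n - ψ m) 2 μ ^ 2 < ENNReal.ofReal e ^ 2 := by
      rw [h1, ← ENNReal.ofReal_pow he.le]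
      exact (ENNReal.ofReal_lt_ofReal_iff (by positivity)).2 (hN n hn m hm)
    exact lt_of_not_ge fun h => absurd h2 (not_lt.2 (pow_le_pow_left' h 2))
  obtain ⟨G, hG⟩ := cauchySeq_tendsto_of_complete hcau
  obtain ⟨g, hgm, hg⟩ := (Lp.aestronglyMeasurable G)
  have hg2 : MemLp g 2 μ := (memLp_congr_ae hg).1 (Lp.memLp G)
  refine ⟨g, hgm.measurable, hg2, ?_⟩
  have h3 : Tendsto (fun n => eLpNorm (ψ n - g) 2 μ) atTop (nhds 0) := by
    have := (Lp.tendsto_Lp_iff_tendsto_eLpNorm' (fun n => (hψ n).toLp (ψ n)) G).1 hG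
    refine this.congr fun n => eLpNorm_congr_ae ?_
    filter_upwards [(hψ n).coeFn_toLp, hg] with x h1 h2
    simp [h1, h2]
  have h4 : ∀ n, ∫ x, (ψ n x - g x) ^ 2 ∂μ = (eLpNorm (ψ n - g) 2 μ ^ 2).toReal := fun n => by
    rw [eLpNorm_two_sq ((hψ n).sub hg2), ENNReal.toReal_ofReal
      (integral_nonneg fun x => sq_nonneg _)]; rfl
  simp_rw [h4]
  have := (ENNReal.continuous_pow 2).tendsto 0 |>.comp h3
  have h5 := (ENNReal.tendsto_toReal (a := 0 ^ 2) (by simp)).comp this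
  rw [zero_pow two_ne_zero, ENNReal.toReal_zero] at h5
  exact h5

end L2

section FourierL2
variable {d : ℕ}

lemma integrable_of_memLp_two {f : (Fin d → ℝ) → ℝ} (hf : MemLp f 2 (μT d)) :
    Integrable f (μT d) := hf.integrable (by norm_num)

lemma pairT_sub {f g φ : (Fin d → ℝ) → ℝ} (hf : Integrable f (μT d)) (hg : Integrable g (μT d))
    (hφ : Test φ) : pairT (fun x => f x - g x) φ = pairT f φ - pairT g φ := by
  unfold pairT
  rw [← integral_sub (integrable_mul_test hf hφ) (integrable_mul_test hg hφ)]
  congr 1; ext x; ring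

lemma fc_sub {f g : (Fin d → ℝ) → ℝ} (hf : Integrable f (μT d)) (hg : Integrable g (μT d)) (k) :
    fc (fun x => f x - g x) k = fc f k - fc g k := by
  rw [fc_eq_pairT hf, fc_eq_pairT hg, fc_eq_pairT (by exact hf.sub hg),
    pairT_sub hf hg (test_cs k), pairT_sub hf hg (test_sn k)]
  push_cast; ring

lemma fej_sub (N : ℕ) {f g : (Fin d → ℝ) → ℝ} (hf : Integrable f (μT d))
    (hg : Integrable g (μT d)) (x) :
    fej N (fun x => f x - g x) x = fej N f x - fej N g x := by
  unfold fej
  rw [← syn_sub]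
  simp_rw [pairT_sub hf hg (test_cs _), pairT_sub hf hg (test_sn _)]

lemma fc_fej_sub (N : ℕ) {f : (Fin d → ℝ) → ℝ} (hf : Integrable f (μT d)) (k) :
    ‖fc (fun x => fej N f x - f x) k‖ ^ 2 = (1 - mult N k) ^ 2 * ‖fc f k‖ ^ 2 := by
  rw [fc_sub (test_fej N f).integrable hf, fc_fej N hf]
  rw [← neg_sub, norm_neg, ← one_sub_mul, norm_mul, mul_pow]
  congr 1
  rw [← Complex.ofReal_one, ← Complex.ofReal_sub, Complex.norm_real, Real.norm_eq_abs, sq_abs]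

lemma integral_fej_sq_le (N : ℕ) {f : (Fin d → ℝ) → ℝ} (hf : MemLp f 2 (μT d)) :
    ∫ x, fej N f x ^ 2 ∂(μT d) ≤ ∫ x, f x ^ 2 ∂(μT d) := by
  refine hasSum_le (fun k => ?_) (parseval ((test_fej N f).memLp 2)) (parseval hf)
  rw [fc_fej N (integrable_of_memLp_two hf), norm_mul, mul_pow, Complex.norm_real, Real.norm_eq_abs,
    sq_abs]
  exact mul_le_of_le_one_left (sq_nonneg _) (pow_le_one₀ (mult_nonneg N k) (mult_le_one N k))

lemma sq_one_sub_mult_le (N : ℕ) (k : Fin d → ℤ) : (1 - mult N k) ^ 2 ≤ 1 :=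
  pow_le_one₀ (sub_nonneg.2 (mult_le_one N k)) (by linarith [mult_nonneg N k])

lemma tendsto_tsum_one_sub_mult {a : (Fin d → ℤ) → ℝ} (ha : Summable a) (ha0 : ∀ k, 0 ≤ a k) :
    Tendsto (fun N => ∑' k, (1 - mult N k) ^ 2 * a k) atTop (nhds 0) := by
  have h0 : (0 : ℝ) = ∑' k : Fin d → ℤ, (0 : ℝ) := by simp
  rw [h0]
  refine tendsto_tsum_of_dominated_convergence ha (fun k => ?_) (Eventually.of_forall fun N k => ?_)
  · have := (((tendsto_mult k).const_sub 1).pow 2).mul_const (a k)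
    simpa using this
  · rw [Real.norm_eq_abs, abs_of_nonneg (mul_nonneg (sq_nonneg _) (ha0 k))]
    exact mul_le_of_le_one_left (ha0 k) (sq_one_sub_mult_le N k)

lemma tendsto_fej_l2 {f : (Fin d → ℝ) → ℝ} (hf : MemLp f 2 (μT d)) :
    Tendsto (fun N => ∫ x, (fej N f x - f x) ^ 2 ∂(μT d)) atTop (nhds 0) := by
  have h : ∀ N, ∫ x, (fej N f x - f x) ^ 2 ∂(μT d) =
      ∑' k, (1 - mult N k) ^ 2 * ‖fc f k‖ ^ 2 := fun N => by
    have := (parseval (((test_fej N f).memLp 2).sub hf)).tsum_eq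
    simp only [Pi.sub_apply] at this
    rw [← this]
    exact tsum_congr fun k => fc_fej_sub N (integrable_of_memLp_two hf) k
  simp_rw [h]
  exact tendsto_tsum_one_sub_mult (parseval hf).summable fun k => sq_nonneg _

lemma integral_abs_le_sqrt {f : (Fin d → ℝ) → ℝ} (hf : MemLp f 2 (μT d)) :
    ∫ x, |f x| ∂(μT d) ≤ √(∫ x, f x ^ 2 ∂(μT d)) := by
  have := integral_abs_mul_le hf (memLp_const (1 : ℝ))
  simpa using this

lemma tendsto_fej_l1 {f : (Fin d → ℝ) → ℝ} (hf : Integrable f (μT d)) :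
    Tendsto (fun N => ∫ x, |fej N f x - f x| ∂(μT d)) atTop (nhds 0) := by
  rw [Metric.tendsto_atTop]
  intro ε hε
  obtain ⟨g, hg, hgL⟩ := (memLp_one_iff_integrable.2 hf).exists_simpleFunc_eLpNorm_sub_lt (by simp)
    (ε := ENNReal.ofReal (ε / 4)) (by simpa using hε)
  have hg2 : MemLp g 2 (μT d) := SimpleFunc.memLp_of_isFiniteMeasure g 2 _
  have hg1 : Integrable g (μT d) := (integrable_of_memLp_two hg2)
  have hfg : ∫ x, |f x - g x| ∂(μT d) < ε / 4 := by
    have := (hf.sub hg1)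
    rw [eLpNorm_one_eq_lintegral_enorm, ← ofReal_integral_norm_eq_lintegral_enorm this,
      ENNReal.ofReal_lt_ofReal_iff (by positivity)] at hg
    exact hg
  have h2 := (tendsto_fej_l2 hg2).sqrt
  rw [Real.sqrt_zero, Metric.tendsto_atTop] at h2
  obtain ⟨N0, hN0⟩ := h2 (ε / 2) (by positivity)
  refine ⟨N0, fun N hN => ?_⟩
  have h3 := hN0 N hN
  rw [Real.dist_0_eq_abs] at h3 ⊢
  rw [abs_of_nonneg (integral_nonneg fun x => abs_nonneg _)]
  have h4 : ∫ x, |fej N f x - f x| ∂(μT d) ≤ ∫ x, (|fej N (fun x => f x - g x) x| +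
      |fej N g x - g x| + |f x - g x|) ∂(μT d) := by
    refine integral_mono ((test_fej N f).integrable.sub hf).abs ?_ fun x => ?_
    · exact ((test_fej N _).integrable.abs.add ((test_fej N g).integrable.sub hg1).abs).add
        (hf.sub hg1).abs
    · beta_reduce
      rw [fej_sub N hf hg1]
      have e : fej N f x - f x = (fej N f x - fej N g x) + (fej N g x - g x) - (f x - g x) := by
        ring
      rw [e]
      exact (abs_sub _ _).trans (add_le_add_left (abs_add_le _ _) _)
  rw [integral_add, integral_add] at h4
  · have h5 := integral_abs_fej_le N (hf.sub hg1)
    have h6 := integral_abs_le_sqrt (((test_fej N g).memLp 2).sub hg2)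
    simp only [Pi.sub_apply] at h5 h6
    have h7 := le_abs_self (√(∫ x, (fej N g x - g x) ^ 2 ∂(μT d)))
    change ∫ x, |fej N (fun x => f x - g x) x| ∂(μT d) ≤ _ at h5
    linarith
  · exact (test_fej N _).integrable.abs
  · exact ((test_fej N g).integrable.sub hg1).abs
  · exact ((test_fej N _).integrable.abs.add ((test_fej N g).integrable.sub hg1).abs)
  · exact (hf.sub hg1).abs

end FourierL2

section Gradient
variable {d : ℕ}

/-- The Dirichlet energy `∑ |2πk|² |û(k)|²`. -/
def gradE (u : (Fin d → ℝ) → ℝ) : ℝ := ∑' k, (∑ i, fq i k ^ 2) * ‖fc u k‖ ^ 2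

/-- Membership in `H¹(𝕋^d)`. -/
def InH1 (u : (Fin d → ℝ) → ℝ) : Prop :=
  MemLp u 2 (μT d) ∧ Summable fun k => (∑ i, fq i k ^ 2) * ‖fc u k‖ ^ 2

lemma norm_fc_sq_le {f : (Fin d → ℝ) → ℝ} (hf : MemLp f 2 (μT d)) (k) :
    ‖fc f k‖ ^ 2 ≤ ∫ x, f x ^ 2 ∂(μT d) :=
  le_hasSum (parseval hf) k fun _ _ => sq_nonneg _

lemma fc_of_tendsto_l2 {ψ : ℕ → (Fin d → ℝ) → ℝ} {g : (Fin d → ℝ) → ℝ}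
    (hψ : ∀ n, MemLp (ψ n) 2 (μT d)) (hg : MemLp g 2 (μT d))
    (h : Tendsto (fun n => ∫ x, (ψ n x - g x) ^ 2 ∂(μT d)) atTop (nhds 0)) (k) :
    Tendsto (fun n => fc (ψ n) k) atTop (nhds (fc g k)) := by
  rw [tendsto_iff_norm_sub_tendsto_zero]
  have h1 := h.sqrt
  rw [Real.sqrt_zero] at h1
  refine squeeze_zero (fun n => norm_nonneg _) (fun n => ?_) h1
  refine Real.le_sqrt_of_sq_le ?_
  rw [← fc_sub (integrable_of_memLp_two (hψ n)) (integrable_of_memLp_two hg)]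
  exact norm_fc_sq_le ((hψ n).sub hg) k

lemma exists_partial {u : (Fin d → ℝ) → ℝ} (hu : InH1 u) (i : Fin d) :
    ∃ g : (Fin d → ℝ) → ℝ, MemLp g 2 (μT d) ∧ ∀ k, fc g k = fq i k * Complex.I * fc u k := by
  have hui := integrable_of_memLp_two hu.1
  set a : (Fin d → ℤ) → ℝ := fun k => fq i k ^ 2 * ‖fc u k‖ ^ 2 with ha
  have ha0 : ∀ k, 0 ≤ a k := fun k => by positivity
  have hasum : Summable a := by
    refine Summable.of_nonneg_of_le ha0 (fun k => ?_) hu.2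
    exact mul_le_mul_of_nonneg_right (Finset.single_le_sum (f := fun i => fq i k ^ 2)
      (fun _ _ => sq_nonneg _) (Finset.mem_univ i)) (sq_nonneg _)
  set ψ : ℕ → (Fin d → ℝ) → ℝ := fun N => pd i (fej N u) with hψ
  have hT : ∀ N, Test (ψ N) := fun N => (test_fej N u).pd i
  have hfc : ∀ N k, fc (ψ N) k = mult N k * (fq i k * Complex.I * fc u k) := fun N k => by
    rw [hψ]; simp only
    rw [fc_pd (test_fej N u), fc_fej N hui]; ring
  have hlim := tendsto_tsum_one_sub_mult hasum ha0
  have hsm : ∀ N, Summable fun k => (1 - mult N k) ^ 2 * a k := fun N =>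
    Summable.of_nonneg_of_le (fun k => mul_nonneg (sq_nonneg _) (ha0 k))
      (fun k => mul_le_of_le_one_left (ha0 k) (sq_one_sub_mult_le N k)) hasum
  have hle : ∀ n m, ∫ x, (ψ n x - ψ m x) ^ 2 ∂(μT d) ≤
      2 * (∑' k, (1 - mult n k) ^ 2 * a k) + 2 * ∑' k, (1 - mult m k) ^ 2 * a k := by
    intro n m
    refine hasSum_le (fun k => ?_) (parseval (((hT n).sub (hT m)).memLp 2))
      (((hsm n).hasSum.mul_left 2).add ((hsm m).hasSum.mul_left 2))
    rw [fc_sub (hT n).integrable (hT m).integrable, hfc, hfc, ← sub_mul, norm_mul, mul_pow,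
      norm_mul, norm_mul, mul_pow, mul_pow, Complex.norm_I, ← Complex.ofReal_sub,
      Complex.norm_real, Complex.norm_real, Real.norm_eq_abs, Real.norm_eq_abs, sq_abs, sq_abs,
      one_pow, mul_one]
    change _ * a k ≤ _
    nlinarith [mul_nonneg (ha0 k) (sq_nonneg ((1 - mult n k) + (1 - mult m k)))]
  obtain ⟨g, -, hg2, hg⟩ := exists_l2_limit (fun n => (hT n).memLp 2) (μ := μT d) (fun ε hε => by
    have := (hlim.eventually (gt_mem_nhds (show 0 < ε / 4 by positivity)))
    obtain ⟨N, hN⟩ := eventually_atTop.1 this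
    refine ⟨N, fun n hn m hm => (hle n m).trans_lt ?_⟩
    have h1 := hN n hn
    have h2 := hN m hm
    linarith)
  refine ⟨g, hg2, fun k => ?_⟩
  have h1 := fc_of_tendsto_l2 (fun n => (hT n).memLp 2) hg2 hg k
  refine tendsto_nhds_unique h1 ?_
  simp_rw [hfc]
  have h2 := ((Complex.continuous_ofReal.tendsto 1).comp (tendsto_mult k)).mul_const
    (fq i k * Complex.I * fc u k)
  simpa using h2

lemma fej_partial {u g : (Fin d → ℝ) → ℝ} (hu : Integrable u (μT d)) (hg : Integrable g (μT d))
    {i : Fin d} (h : ∀ k, fc g k = fq i k * Complex.I * fc u k) (N : ℕ) :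
    pd i (fej N u) = fej N g := by
  unfold fej
  rw [pd_syn]
  have : ∀ k, pairT g (cs k) = fq i k * pairT u (sn k) ∧
      pairT g (sn k) = -(fq i k * pairT u (cs k)) := fun k => by
    have := h k
    rw [fc_eq_pairT hu, fc_eq_pairT hg] at this
    have h1 := congrArg Complex.re this
    have h2 := congrArg Complex.im this
    simp at h1 h2
    exact ⟨by linarith, by linarith⟩
  congr 1
  · ext k; exact (this k).1.symm
  · ext k; exact (this k).2.symm

lemma exists_grad {u : (Fin d → ℝ) → ℝ} (hu : InH1 u) :
    ∃ g : Fin d → (Fin d → ℝ) → ℝ, (∀ i, MemLp (g i) 2 (μT d)) ∧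
      (∀ i N, pd i (fej N u) = fej N (g i)) ∧ ∑ i, ∫ x, g i x ^ 2 ∂(μT d) = gradE u := by
  choose g hg hgc using exists_partial hu
  refine ⟨g, hg, fun i N => fej_partial (integrable_of_memLp_two hu.1)
    (integrable_of_memLp_two (hg i)) (hgc i) N, ?_⟩
  have := hasSum_sum (s := Finset.univ) fun i _ => parseval (hg i)
  rw [← this.tsum_eq, gradE]
  refine tsum_congr fun k => ?_
  rw [Finset.sum_mul]
  refine Finset.sum_congr rfl fun i _ => ?_
  rw [hgc, norm_mul, norm_mul, mul_pow, mul_pow, Complex.norm_I, Complex.norm_real,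
    Real.norm_eq_abs, sq_abs, one_pow, mul_one]

lemma tendsto_integral_abs_mul_fej {w f : (Fin d → ℝ) → ℝ} (hw : MemLp w 2 (μT d))
    (hf : MemLp f 2 (μT d)) :
    Tendsto (fun N => ∫ x, |w x * (fej N f x - f x)| ∂(μT d)) atTop (nhds 0) := by
  have h1 := ((tendsto_fej_l2 hf).sqrt).const_mul (√(∫ x, w x ^ 2 ∂(μT d)))
  rw [Real.sqrt_zero, mul_zero] at h1
  exact squeeze_zero (fun N => integral_nonneg fun x => abs_nonneg _)
    (fun N => integral_abs_mul_le hw (((test_fej N f).memLp 2).sub hf)) h1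

lemma tendsto_integral_mul_fej {w f : (Fin d → ℝ) → ℝ} (hw : MemLp w 2 (μT d))
    (hf : MemLp f 2 (μT d)) :
    Tendsto (fun N => ∫ x, w x * fej N f x ∂(μT d)) atTop (nhds (∫ x, w x * f x ∂(μT d))) := by
  rw [tendsto_iff_norm_sub_tendsto_zero]
  refine squeeze_zero (fun N => norm_nonneg _) (fun N => ?_) (tendsto_integral_abs_mul_fej hw hf)
  rw [← integral_sub (by exact hw.integrable_mul ((test_fej N f).memLp 2))
    (by exact hw.integrable_mul hf)]
  simp_rw [← mul_sub]
  exact abs_integral_le_integral_abs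

lemma memLp_two_mul_bdd {f w : (Fin d → ℝ) → ℝ} {C : ℝ} (hf : MemLp f 2 (μT d))
    (hw : AEStronglyMeasurable w (μT d)) (hC : ∀ᵐ x ∂(μT d), |w x| ≤ C) :
    MemLp (fun x => w x * f x) 2 (μT d) := by
  refine hf.of_le_mul (c := C) (hw.mul hf.1) ?_
  filter_upwards [hC] with x hx
  rw [norm_mul]
  exact mul_le_mul_of_nonneg_right hx (norm_nonneg _)

lemma Test.memLp_mul {f φ : (Fin d → ℝ) → ℝ} (hφ : Test φ) (hf : MemLp f 2 (μT d)) :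
    MemLp (fun x => φ x * f x) 2 (μT d) := by
  obtain ⟨C, -, hC⟩ := hφ.bound
  exact memLp_two_mul_bdd hf hφ.continuous.aestronglyMeasurable (ae_of_all _ hC)

/-- Distributional product rule `h·∇u = div (u h) - u div h`. -/
lemma integral_grad_mul {u D : (Fin d → ℝ) → ℝ} {h : (Fin d → ℝ) → Fin d → ℝ} {CD : ℝ}
    (hu : MemLp u 2 (μT d)) {g : Fin d → (Fin d → ℝ) → ℝ} (hg : ∀ i, MemLp (g i) 2 (μT d))
    (hgu : ∀ i N, pd i (fej N u) = fej N (g i))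
    (hh : ∀ i, MemLp (fun x => h x i) 2 (μT d)) (hD : AEStronglyMeasurable D (μT d))
    (hDb : ∀ᵐ x ∂(μT d), |D x| ≤ CD) (hdiv : IsWeakDiv h D) {φ : (Fin d → ℝ) → ℝ}
    (hφ : Test φ) :
    ∫ x, (∑ i, h x i * g i x) * φ x ∂(μT d) =
      -(∫ x, u x * (∑ i, h x i * pd i φ x) ∂(μT d)) - ∫ x, D x * u x * φ x ∂(μT d) := by
  have e1 : ∀ N, ∑ i, ∫ x, (φ x * h x i) * fej N (g i) x ∂(μT d) +
      ∑ i, ∫ x, (pd i φ x * h x i) * fej N u x ∂(μT d) =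
      - ∫ x, (φ x * D x) * fej N u x ∂(μT d) := by
    intro N
    have h1 := hdiv _ ((test_fej N u).mul hφ)
    have h2 : ∀ x, ∑ i, h x i * pd i (fun x => fej N u x * φ x) x =
        ∑ i, (φ x * h x i) * fej N (g i) x + ∑ i, (pd i φ x * h x i) * fej N u x := fun x => by
      rw [← Finset.sum_add_distrib]
      refine Finset.sum_congr rfl fun i _ => ?_
      rw [pd_mul (test_fej N u) hφ, hgu]; ring
    simp_rw [h2] at h1
    rw [integral_add, integral_finsetSum, integral_finsetSum] at h1
    · rw [h1]; congr 1; congr 1; ext x; ring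
    · exact fun i _ => ((hφ.pd i).memLp_mul (hh i)).integrable_mul ((test_fej N u).memLp 2)
    · exact fun i _ => (hφ.memLp_mul (hh i)).integrable_mul ((test_fej N _).memLp 2)
    · exact integrable_finsetSum _ fun i _ =>
        (hφ.memLp_mul (hh i)).integrable_mul ((test_fej N _).memLp 2)
    · exact integrable_finsetSum _ fun i _ =>
        ((hφ.pd i).memLp_mul (hh i)).integrable_mul ((test_fej N u).memLp 2)
  have hD2 : MemLp D 2 (μT d) := MemLp.of_bound hD CD hDb
  have l1 := (tendsto_finsetSum Finset.univ fun i _ =>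
    tendsto_integral_mul_fej (hφ.memLp_mul (hh i)) (hg i)).add
    (tendsto_finsetSum Finset.univ fun i _ =>
      tendsto_integral_mul_fej ((hφ.pd i).memLp_mul (hh i)) hu)
  have l2 := (tendsto_integral_mul_fej (hφ.memLp_mul hD2) hu).neg
  simp_rw [e1] at l1
  have e2 := tendsto_nhds_unique l1 l2
  rw [← integral_finsetSum, ← integral_finsetSum] at e2
  · have e3 : ∀ x, (∑ i, h x i * g i x) * φ x = ∑ i, φ x * h x i * g i x := fun x => by
      rw [Finset.sum_mul]; refine Finset.sum_congr rfl fun i _ => by ring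
    have e4 : ∀ x, u x * (∑ i, h x i * pd i φ x) = ∑ i, pd i φ x * h x i * u x := fun x => by
      rw [Finset.mul_sum]; refine Finset.sum_congr rfl fun i _ => by ring
    have e5 : ∀ x, D x * u x * φ x = φ x * D x * u x := fun x => by ring
    simp_rw [e3, e4, e5]
    linarith
  · exact fun i _ => ((hφ.pd i).memLp_mul (hh i)).integrable_mul hu
  · exact fun i _ => (hφ.memLp_mul (hh i)).integrable_mul (hg i)

/-- The weak form of the spatial operator, as it appears in `IsWeakSol`. -/
def gen (u : (Fin d → ℝ) → ℝ) (h : (Fin d → ℝ) → Fin d → ℝ) (D c φ : (Fin d → ℝ) → ℝ) : ℝ :=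
  pairT u (lap φ) - (∫ x, u x * (∑ i, h x i * pd i φ x) ∂(μT d))
    + ∫ x, (c x - D x) * u x * φ x ∂(μT d)

/-- The Fejér mean of the spatial operator. -/
def fejGen (N : ℕ) (u : (Fin d → ℝ) → ℝ) (h : (Fin d → ℝ) → Fin d → ℝ)
    (D c : (Fin d → ℝ) → ℝ) : (Fin d → ℝ) → ℝ :=
  syn N (fun k => gen u h D c (cs k)) fun k => gen u h D c (sn k)

/-- The commutator error of the Fejér regularisation. -/
def resid (N : ℕ) (u : (Fin d → ℝ) → ℝ) (h : (Fin d → ℝ) → Fin d → ℝ)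
    (D c : (Fin d → ℝ) → ℝ) (x : Fin d → ℝ) : ℝ :=
  fejGen N u h D c x - lap (fej N u) x - (∑ i, h x i * pd i (fej N u) x) - c x * fej N u x

lemma lap_cs (k : Fin d → ℤ) : lap (cs k) = fun x => -(∑ i, fq i k ^ 2) * cs k x := by
  ext x
  unfold lap
  have : ∀ i, pd i (pd i (cs k)) x = -(fq i k ^ 2 * cs k x) := fun i => by
    rw [pd_cs]
    have e : HasFDerivAt (fun x => -fq i k * sn k x) _ x :=
      ((test_sn k).hasFDerivAt x).const_mul (-fq i k)
    have h1 := congrFun (pd_sn k i) x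
    unfold pd at h1 ⊢
    rw [e.fderiv]
    simp only [smul_apply, smul_eq_mul, h1]; ring
  simp_rw [this]
  rw [Finset.sum_neg_distrib, neg_mul, Finset.sum_mul]

lemma lap_sn (k : Fin d → ℤ) : lap (sn k) = fun x => -(∑ i, fq i k ^ 2) * sn k x := by
  ext x
  unfold lap
  have : ∀ i, pd i (pd i (sn k)) x = -(fq i k ^ 2 * sn k x) := fun i => by
    rw [pd_sn]
    have e : HasFDerivAt (fun x => fq i k * cs k x) _ x :=
      ((test_cs k).hasFDerivAt x).const_mul (fq i k)
    have h1 := congrFun (pd_cs k i) x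
    unfold pd at h1 ⊢
    rw [e.fderiv]
    simp only [smul_apply, smul_eq_mul, h1]; ring
  simp_rw [this]
  rw [Finset.sum_neg_distrib, neg_mul, Finset.sum_mul]

lemma pairT_const_mul (u φ : (Fin d → ℝ) → ℝ) (a : ℝ) :
    pairT u (fun x => a * φ x) = a * pairT u φ := by
  unfold pairT; rw [← integral_const_mul]; congr 1; ext x; ring

end Gradient

section EnergyPointwise
variable {d : ℕ}

lemma integrable_mul_two {α : Type*} {m0 : MeasurableSpace α} {μ : Measure α} {f g : α → ℝ}
    (hf : MemLp f 2 μ) (hg : MemLp g 2 μ) : Integrable (fun x => f x * g x) μ :=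
  hf.integrable_mul hg

/-- A smooth nonnegative renormalisation function with `z β'(z) ≤ 2 β(z)` and `|β'| ≤ L`. -/
structure Renorm (β β' β'' : ℝ → ℝ) (L : ℝ) : Prop where
  smooth : ContDiff ℝ (⊤ : ℕ∞) β
  smooth' : ContDiff ℝ (⊤ : ℕ∞) β'
  smooth'' : ContDiff ℝ (⊤ : ℕ∞) β''
  deriv1 : ∀ z, HasDerivAt β (β' z) z
  deriv2 : ∀ z, HasDerivAt β' (β'' z) z
  nonneg : ∀ z, 0 ≤ β z
  bound : ∀ z, |β' z| ≤ L
  growth : ∀ z, |z * β' z| ≤ 2 * β z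
  nonneg'' : ∀ z, 0 ≤ β'' z

/-- The standing assumptions on the data at a fixed time. -/
structure Slice (u : (Fin d → ℝ) → ℝ) (h : (Fin d → ℝ) → Fin d → ℝ) (D c : (Fin d → ℝ) → ℝ)
    (CD Cc : ℝ) : Prop where
  u_mem : InH1 u
  h_mem : ∀ i, MemLp (fun x => h x i) 2 (μT d)
  D_meas : AEStronglyMeasurable D (μT d)
  c_meas : AEStronglyMeasurable c (μT d)
  D_bdd : ∀ᵐ x ∂(μT d), |D x| ≤ CD
  c_bdd : ∀ᵐ x ∂(μT d), |c x| ≤ Cc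
  div : IsWeakDiv h D

namespace Slice
variable {u : (Fin d → ℝ) → ℝ} {h : (Fin d → ℝ) → Fin d → ℝ} {D c : (Fin d → ℝ) → ℝ}
  {CD Cc : ℝ} (S : Slice u h D c CD Cc)
include S

lemma D_mem : MemLp D 2 (μT d) := MemLp.of_bound S.D_meas CD S.D_bdd
lemma c_mem : MemLp c 2 (μT d) := MemLp.of_bound S.c_meas Cc S.c_bdd
lemma CD_nonneg : 0 ≤ CD := by
  obtain ⟨x, hx⟩ := S.D_bdd.exists; exact (abs_nonneg _).trans hx
lemma Cc_nonneg : 0 ≤ Cc := by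
  obtain ⟨x, hx⟩ := S.c_bdd.exists; exact (abs_nonneg _).trans hx

variable {g : Fin d → (Fin d → ℝ) → ℝ} (hg : ∀ i, MemLp (g i) 2 (μT d))
  (hgu : ∀ i N, pd i (fej N u) = fej N (g i))

lemma integrable_grad (hg : ∀ i, MemLp (g i) 2 (μT d)) :
    Integrable (fun x => ∑ i, h x i * g i x) (μT d) :=
  integrable_finsetSum _ fun i _ => integrable_mul_two (S.h_mem i) (hg i)

lemma integrable_rhs (hg : ∀ i, MemLp (g i) 2 (μT d)) :
    Integrable (fun x => ∑ i, h x i * g i x + c x * u x) (μT d) :=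
  (S.integrable_grad hg).add (integrable_mul_two S.c_mem S.u_mem.1)

lemma gen_eq (hg : ∀ i, MemLp (g i) 2 (μT d)) (hgu : ∀ i N, pd i (fej N u) = fej N (g i))
    {φ : (Fin d → ℝ) → ℝ} (hφ : Test φ) :
    gen u h D c φ = pairT u (lap φ) + pairT (fun x => ∑ i, h x i * g i x + c x * u x) φ := by
  have h1 := integral_grad_mul S.u_mem.1 hg hgu S.h_mem S.D_meas S.D_bdd S.div hφ
  have e1 : ∀ x, (c x - D x) * u x * φ x = c x * u x * φ x - D x * u x * φ x := fun x => by ring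
  have e2 : ∀ x, (∑ i, h x i * g i x + c x * u x) * φ x =
    (∑ i, h x i * g i x) * φ x + c x * u x * φ x := fun x => by ring
  have i1 := integrable_mul_test (integrable_mul_two S.c_mem S.u_mem.1) hφ
  have i2 := integrable_mul_test (integrable_mul_two S.D_mem S.u_mem.1) hφ
  unfold gen
  rw [show pairT (fun x => ∑ i, h x i * g i x + c x * u x) φ =
    ∫ x, (∑ i, h x i * g i x + c x * u x) * φ x ∂(μT d) from rfl]
  simp_rw [e1, e2]
  rw [integral_sub i1 i2, integral_add (integrable_mul_test (S.integrable_grad hg) hφ) i1, h1]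
  ring

lemma fejGen_eq (hg : ∀ i, MemLp (g i) 2 (μT d)) (hgu : ∀ i N, pd i (fej N u) = fej N (g i))
    (N : ℕ) (x) : fejGen N u h D c x =
      lap (fej N u) x + fej N (fun x => ∑ i, h x i * g i x + c x * u x) x := by
  unfold fejGen
  simp_rw [S.gen_eq hg hgu (test_cs _), S.gen_eq hg hgu (test_sn _)]
  rw [syn_add]
  unfold fej
  rw [lap_syn]
  simp_rw [lap_cs, lap_sn, pairT_const_mul]

lemma resid_eq (hg : ∀ i, MemLp (g i) 2 (μT d)) (hgu : ∀ i N, pd i (fej N u) = fej N (g i))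
    (N : ℕ) (x) : resid N u h D c x =
      fej N (fun x => ∑ i, h x i * g i x + c x * u x) x - (∑ i, h x i * fej N (g i) x)
        - c x * fej N u x := by
  unfold resid
  rw [S.fejGen_eq hg hgu]
  simp_rw [hgu]
  ring

lemma integrable_resid (N : ℕ) : Integrable (resid N u h D c) (μT d) := by
  unfold resid
  refine (((test_syn _ _ _).integrable.sub (test_fej N u).lap.integrable).sub ?_).sub ?_
  · exact integrable_finsetSum _ fun i _ =>
      integrable_mul_two (S.h_mem i) (((test_fej N u).pd i).memLp 2)
  · exact integrable_mul_two S.c_mem ((test_fej N u).memLp 2)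

lemma tendsto_resid : Tendsto (fun N => ∫ x, |resid N u h D c x| ∂(μT d)) atTop (nhds 0) := by
  obtain ⟨g, hg, hgu, -⟩ := exists_grad S.u_mem
  set q := fun x => ∑ i, h x i * g i x + c x * u x with hq
  have hqi := S.integrable_rhs hg
  have l1 := ((tendsto_fej_l1 hqi).add (tendsto_finsetSum Finset.univ fun i _ =>
    tendsto_integral_abs_mul_fej (S.h_mem i) (hg i))).add
    (tendsto_integral_abs_mul_fej S.c_mem S.u_mem.1)
  simp only [Finset.sum_const_zero, add_zero] at l1
  refine squeeze_zero (fun N => integral_nonneg fun x => abs_nonneg _) (fun N => ?_) l1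
  have i1 : Integrable (fun x => |fej N q x - q x|) (μT d) :=
    ((test_fej N q).integrable.sub hqi).abs
  have i2 : ∀ i ∈ Finset.univ,
      Integrable (fun x => |h x i * (fej N (g i) x - g i x)|) (μT d) := fun i _ =>
    (integrable_mul_two (S.h_mem i) (((test_fej N (g i)).memLp 2).sub (hg i))).abs
  have i3 : Integrable (fun x => |c x * (fej N u x - u x)|) (μT d) :=
    (integrable_mul_two S.c_mem (((test_fej N u).memLp 2).sub S.u_mem.1)).abs
  rw [← integral_finsetSum _ i2, ← integral_add i1 (integrable_finsetSum _ i2),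
    ← integral_add (by exact i1.add (integrable_finsetSum _ i2)) i3]
  refine integral_mono (S.integrable_resid N).abs
    ((i1.add (integrable_finsetSum _ i2)).add i3) fun x => ?_
  beta_reduce
  rw [S.resid_eq hg hgu]
  have e : fej N q x - (∑ i, h x i * fej N (g i) x) - c x * fej N u x =
      (fej N q x - q x) - (∑ i, h x i * (fej N (g i) x - g i x)) - c x * (fej N u x - u x) := by
    rw [hq]; simp_rw [mul_sub]; rw [Finset.sum_sub_distrib]; ring
  change |fej N q x - _ - _| ≤ _
  rw [e]
  refine (abs_sub _ _).trans (add_le_add_left ((abs_sub _ _).trans (add_le_add_right ?_ _)) _)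
  exact Finset.abs_sum_le_sum_abs _ _

lemma integral_resid_le (N : ℕ) : ∫ x, |resid N u h D c x| ∂(μT d) ≤
    (∑ i, ∫ x, h x i ^ 2 ∂(μT d)) + gradE u + 2 * Cc * √(∫ x, u x ^ 2 ∂(μT d)) := by
  obtain ⟨g, hg, hgu, hgE⟩ := exists_grad S.u_mem
  set q := fun x => ∑ i, h x i * g i x + c x * u x with hq
  have hqi := S.integrable_rhs hg
  have hc : ∀ w : (Fin d → ℝ) → ℝ, MemLp w 2 (μT d) →
      ∫ x, |c x * w x| ∂(μT d) ≤ Cc * √(∫ x, w x ^ 2 ∂(μT d)) := fun w hw => by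
    refine le_trans ?_ (mul_le_mul_of_nonneg_left (integral_abs_le_sqrt hw) S.Cc_nonneg)
    rw [← integral_const_mul]
    refine integral_mono_ae (integrable_mul_two S.c_mem hw).abs
      ((integrable_of_memLp_two hw).abs.const_mul _) ?_
    filter_upwards [S.c_bdd] with x hx
    rw [abs_mul]
    exact mul_le_mul_of_nonneg_right hx (abs_nonneg _)
  have hh : ∀ i, ∀ w : (Fin d → ℝ) → ℝ, MemLp w 2 (μT d) →
      ∫ x, w x ^ 2 ∂(μT d) ≤ ∫ x, g i x ^ 2 ∂(μT d) → ∫ x, |h x i * w x| ∂(μT d) ≤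
      (∫ x, h x i ^ 2 ∂(μT d)) / 2 + (∫ x, g i x ^ 2 ∂(μT d)) / 2 := fun i w hw hle => by
    refine (integral_abs_mul_le (S.h_mem i) hw).trans ?_
    have a1 := Real.sq_sqrt (integral_nonneg (μ := μT d) fun x => sq_nonneg (h x i))
    have a2 := Real.sq_sqrt (integral_nonneg (μ := μT d) fun x => sq_nonneg (w x))
    nlinarith [sq_nonneg (√(∫ x, h x i ^ 2 ∂(μT d)) - √(∫ x, w x ^ 2 ∂(μT d)))]
  have i1 : Integrable (fun x => |fej N q x|) (μT d) := (test_fej N q).integrable.abs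
  have i2 : ∀ i ∈ Finset.univ,
      Integrable (fun x => |h x i * fej N (g i) x|) (μT d) := fun i _ =>
    (integrable_mul_two (S.h_mem i) ((test_fej N (g i)).memLp 2)).abs
  have i3 : Integrable (fun x => |c x * fej N u x|) (μT d) :=
    (integrable_mul_two S.c_mem ((test_fej N u).memLp 2)).abs
  have j2 : ∀ i ∈ Finset.univ,
      Integrable (fun x => |h x i * g i x|) (μT d) := fun i _ =>
    (integrable_mul_two (S.h_mem i) (hg i)).abs
  have j3 : Integrable (fun x => |c x * u x|) (μT d) :=
    (integrable_mul_two S.c_mem S.u_mem.1).abs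
  have b1 : ∫ x, |resid N u h D c x| ∂(μT d) ≤ ∫ x, |fej N q x| ∂(μT d) +
      ∑ i, ∫ x, |h x i * fej N (g i) x| ∂(μT d) + ∫ x, |c x * fej N u x| ∂(μT d) := by
    rw [← integral_finsetSum _ i2, ← integral_add i1 (integrable_finsetSum _ i2),
      ← integral_add (by exact i1.add (integrable_finsetSum _ i2)) i3]
    refine integral_mono (S.integrable_resid N).abs
      ((i1.add (integrable_finsetSum _ i2)).add i3) fun x => ?_
    beta_reduce
    rw [S.resid_eq hg hgu]
    refine (abs_sub _ _).trans (add_le_add_left ((abs_sub _ _).trans (add_le_add_right ?_ _)) _)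
    exact Finset.abs_sum_le_sum_abs _ _
  have b2 : ∫ x, |fej N q x| ∂(μT d) ≤
      ∑ i, ∫ x, |h x i * g i x| ∂(μT d) + ∫ x, |c x * u x| ∂(μT d) := by
    refine (integral_abs_fej_le N hqi).trans ?_
    rw [← integral_finsetSum _ j2, ← integral_add (integrable_finsetSum _ j2) j3]
    refine integral_mono hqi.abs ((integrable_finsetSum _ j2).add j3) fun x => ?_
    exact (abs_add_le _ _).trans (add_le_add_left (Finset.abs_sum_le_sum_abs _ _) _)
  have b3 : ∑ i, ∫ x, |h x i * fej N (g i) x| ∂(μT d) ≤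
      ∑ i, ((∫ x, h x i ^ 2 ∂(μT d)) / 2 + (∫ x, g i x ^ 2 ∂(μT d)) / 2) :=
    Finset.sum_le_sum fun i _ => hh i _ ((test_fej N _).memLp 2) (integral_fej_sq_le N (hg i))
  have b4 : ∑ i, ∫ x, |h x i * g i x| ∂(μT d) ≤
      ∑ i, ((∫ x, h x i ^ 2 ∂(μT d)) / 2 + (∫ x, g i x ^ 2 ∂(μT d)) / 2) :=
    Finset.sum_le_sum fun i _ => hh i _ (hg i) le_rfl
  have b5 := hc _ ((test_fej N u).memLp 2)
  have b6 := hc _ S.u_mem.1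
  have b7 := mul_le_mul_of_nonneg_left (Real.sqrt_le_sqrt (integral_fej_sq_le N S.u_mem.1))
    S.Cc_nonneg
  rw [Finset.sum_add_distrib, ← Finset.sum_div, ← Finset.sum_div, hgE] at b3 b4
  linarith

/-- The renormalised energy inequality at a fixed time. -/
lemma energy (N : ℕ) {β β' β'' : ℝ → ℝ} {L : ℝ} (R : Renorm β β' β'' L) :
    ∫ x, β' (fej N u x) * fejGen N u h D c x ∂(μT d)
      + ∫ x, β'' (fej N u x) * ∑ i, pd i (fej N u) x ^ 2 ∂(μT d) ≤
    (CD + 2 * Cc) * ∫ x, β (fej N u x) ∂(μT d) + L * ∫ x, |resid N u h D c x| ∂(μT d) := by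
  set v := fej N u with hv
  have hvT : Test v := test_fej N u
  have hb : Test (fun x => β (v x)) := hvT.comp R.smooth
  have hb' : Test (fun x => β' (v x)) := hvT.comp R.smooth'
  have hb'' : Test (fun x => β'' (v x)) := hvT.comp R.smooth''
  have e1 : ∀ x, β' (v x) * fejGen N u h D c x = β' (v x) * lap v x +
      ∑ i, h x i * pd i (fun x => β (v x)) x + c x * (v x * β' (v x)) +
        β' (v x) * resid N u h D c x := fun x => by
    have : ∑ i, h x i * pd i (fun x => β (v x)) x = β' (v x) * ∑ i, h x i * pd i v x := by
      rw [Finset.mul_sum]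
      refine Finset.sum_congr rfl fun i _ => ?_
      rw [pd_comp hvT R.deriv1]; ring
    rw [this]; unfold resid; ring
  have e2 : ∫ x, β' (v x) * lap v x ∂(μT d) = - ∫ x, β'' (v x) * ∑ i, pd i v x ^ 2 ∂(μT d) := by
    unfold lap
    simp_rw [Finset.mul_sum]
    rw [integral_finsetSum _ fun i _ => (hb'.mul ((hvT.pd i).pd i)).integrable,
      integral_finsetSum _ fun i _ => by
        simp_rw [sq]; exact (hb''.mul ((hvT.pd i).mul (hvT.pd i))).integrable,
      ← Finset.sum_neg_distrib]
    refine Finset.sum_congr rfl fun i _ => ?_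
    rw [integral_mul_pd hb' (hvT.pd i)]
    congr 2; ext x
    rw [pd_comp hvT R.deriv2]; ring
  have e3 := S.div _ hb
  have i1 : Integrable (fun x => β' (v x) * lap v x) (μT d) := (hb'.mul hvT.lap).integrable
  have i2 : Integrable (fun x => ∑ i, h x i * pd i (fun x => β (v x)) x) (μT d) :=
    integrable_finsetSum _ fun i _ => integrable_mul_two (S.h_mem i) ((hb.pd i).memLp 2)
  have i3 : Integrable (fun x => c x * (v x * β' (v x))) (μT d) :=
    integrable_mul_two S.c_mem ((hvT.mul hb').memLp 2)
  have i4 : Integrable (fun x => β' (v x) * resid N u h D c x) (μT d) := by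
    simpa only [mul_comm] using integrable_mul_test (S.integrable_resid N) hb'
  have i5 : Integrable (fun x => D x * β (v x)) (μT d) :=
    integrable_mul_two S.D_mem (hb.memLp 2)
  simp_rw [e1]
  have i12 : Integrable (fun x => β' (v x) * lap v x + ∑ i, h x i * pd i (fun x => β (v x)) x)
    (μT d) := i1.add i2
  have i123 : Integrable (fun x => β' (v x) * lap v x + ∑ i, h x i * pd i (fun x => β (v x)) x
    + c x * (v x * β' (v x))) (μT d) := i12.add i3
  rw [integral_add i123 i4, integral_add i12 i3, integral_add i1 i2, e2, e3]
  have b1 : -∫ x, D x * β (v x) ∂(μT d) ≤ CD * ∫ x, β (v x) ∂(μT d) := by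
    rw [← integral_neg, ← integral_const_mul]
    refine integral_mono_ae i5.neg (hb.integrable.const_mul _) ?_
    filter_upwards [S.D_bdd] with x hx
    have := R.nonneg (v x)
    nlinarith [neg_abs_le (D x)]
  have b2 : ∫ x, c x * (v x * β' (v x)) ∂(μT d) ≤ 2 * Cc * ∫ x, β (v x) ∂(μT d) := by
    rw [← integral_const_mul]
    refine integral_mono_ae i3 (hb.integrable.const_mul _) ?_
    filter_upwards [S.c_bdd] with x hx
    refine (le_abs_self _).trans ?_
    rw [abs_mul, mul_comm 2 Cc, mul_assoc]
    exact mul_le_mul hx (R.growth (v x)) (abs_nonneg _) S.Cc_nonneg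
  have b3 : ∫ x, β' (v x) * resid N u h D c x ∂(μT d) ≤
      L * ∫ x, |resid N u h D c x| ∂(μT d) := by
    rw [← integral_const_mul]
    refine integral_mono i4 ((S.integrable_resid N).abs.const_mul _) fun x => ?_
    refine (le_abs_self _).trans ?_
    rw [abs_mul]
    exact mul_le_mul_of_nonneg_right (R.bound _) (abs_nonneg _)
  linarith

end Slice
end EnergyPointwise

section RenormFamily

/-- The renormalisation `β_M(z) = 2M (√(M² + z²) - M)`, which increases to `z²`. -/
def bt (M z : ℝ) : ℝ := 2 * M * (√(M ^ 2 + z ^ 2) - M)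

/-- The derivative of `bt M`. -/
def bt' (M z : ℝ) : ℝ := 2 * M * (z / √(M ^ 2 + z ^ 2))

/-- The second derivative of `bt M`. -/
def bt'' (M z : ℝ) : ℝ := 2 * M ^ 3 / √(M ^ 2 + z ^ 2) ^ 3

variable {M : ℝ}

lemma bt_sqrt (hM : 0 < M) (z : ℝ) : M ≤ √(M ^ 2 + z ^ 2) ∧ |z| ≤ √(M ^ 2 + z ^ 2) ∧
    √(M ^ 2 + z ^ 2) ≤ M + |z| ∧ √(M ^ 2 + z ^ 2) ^ 2 = M ^ 2 + z ^ 2 := by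
  refine ⟨Real.le_sqrt_of_sq_le (by nlinarith [sq_nonneg z]),
    Real.le_sqrt_of_sq_le (by rw [sq_abs]; nlinarith [sq_nonneg M]), ?_, Real.sq_sqrt (by positivity)⟩
  refine Real.sqrt_le_iff.2 ⟨by positivity, ?_⟩
  rw [add_sq, sq_abs]
  nlinarith [abs_nonneg z]

lemma contDiff_sqrt (hM : 0 < M) : ContDiff ℝ (⊤ : ℕ∞) fun z : ℝ => √(M ^ 2 + z ^ 2) :=
  (contDiff_const.add (contDiff_id.pow 2)).sqrt fun z => by positivity

lemma hasDerivAt_sqrt (hM : 0 < M) (z : ℝ) :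
    HasDerivAt (fun z : ℝ => √(M ^ 2 + z ^ 2)) (z / √(M ^ 2 + z ^ 2)) z := by
  have h1 : HasDerivAt (fun z : ℝ => M ^ 2 + z ^ 2) (2 * z) z := by
    simpa using (hasDerivAt_pow 2 z).const_add (M ^ 2)
  convert h1.sqrt (by positivity) using 1
  ring

lemma renorm_bt (hM : 0 < M) : Renorm (bt M) (bt' M) (bt'' M) (2 * M) where
  smooth := contDiff_const.mul ((contDiff_sqrt hM).sub contDiff_const)
  smooth' := contDiff_const.mul (contDiff_id.div (contDiff_sqrt hM) fun z => by positivity)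
  smooth'' := contDiff_const.div ((contDiff_sqrt hM).pow 3) fun z => by positivity
  deriv1 z := ((hasDerivAt_sqrt hM z).sub_const M).const_mul _
  deriv2 z := by
    obtain ⟨h1, -, -, h4⟩ := bt_sqrt hM z
    have hs : 0 < √(M ^ 2 + z ^ 2) := hM.trans_le h1
    refine (((hasDerivAt_id z).div (hasDerivAt_sqrt hM z) hs.ne').const_mul (2 * M)).congr_deriv ?_
    unfold bt''
    simp only [id]
    field_simp
    rw [h4]; ring
  nonneg z := by
    have := (bt_sqrt hM z).1
    exact mul_nonneg (by positivity) (sub_nonneg.2 this)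
  bound z := by
    obtain ⟨h1, h2, -, -⟩ := bt_sqrt hM z
    have hs : 0 < √(M ^ 2 + z ^ 2) := hM.trans_le h1
    unfold bt'
    rw [abs_mul, abs_div, abs_of_pos hs, abs_of_pos (by positivity : 0 < 2 * M)]
    exact mul_le_of_le_one_right (by positivity) ((div_le_one hs).2 h2)
  growth z := by
    obtain ⟨h1, h2, -, h4⟩ := bt_sqrt hM z
    have hs : 0 < √(M ^ 2 + z ^ 2) := hM.trans_le h1
    unfold bt' bt
    have e : z * (2 * M * (z / √(M ^ 2 + z ^ 2))) = 2 * M * (z ^ 2 / √(M ^ 2 + z ^ 2)) := by ring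
    rw [e, abs_of_nonneg (by positivity), show 2 * (2 * M * (√(M ^ 2 + z ^ 2) - M)) =
      2 * M * (2 * (√(M ^ 2 + z ^ 2) - M)) by ring]
    refine mul_le_mul_of_nonneg_left ?_ (by positivity)
    rw [div_le_iff₀ hs]
    nlinarith [sq_nonneg (√(M ^ 2 + z ^ 2) - M)]
  nonneg'' z := by unfold bt''; positivity

lemma bt_le_sq (hM : 0 < M) (z : ℝ) : bt M z ≤ z ^ 2 := by
  obtain ⟨h1, -, -, h4⟩ := bt_sqrt hM z
  unfold bt
  nlinarith [sq_nonneg (√(M ^ 2 + z ^ 2) - M)]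

lemma bt''_le (hM : 0 < M) (z : ℝ) : bt'' M z ≤ 2 := by
  obtain ⟨h1, -, -, -⟩ := bt_sqrt hM z
  have hs : 0 < √(M ^ 2 + z ^ 2) := hM.trans_le h1
  unfold bt''
  rw [div_le_iff₀ (by positivity)]
  exact mul_le_mul_of_nonneg_left (pow_le_pow_left₀ hM.le h1 3) (by norm_num)

lemma two_sub_bt''_le (hM : 0 < M) (z : ℝ) : 2 - bt'' M z ≤ 6 / M * |z| := by
  obtain ⟨h1, h2, h3, -⟩ := bt_sqrt hM z
  set s := √(M ^ 2 + z ^ 2) with hs'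
  have hs : 0 < s := hM.trans_le h1
  have e : bt'' M z = 2 * (M / s) ^ 3 := by unfold bt''; rw [← hs']; ring
  set q := M / s with hq
  have q1 : q ≤ 1 := (div_le_one hs).2 h1
  have q0 : 0 ≤ q := by positivity
  have q2 : 1 - q ≤ |z| / M := by
    rw [le_div_iff₀ hM, hq, sub_mul, div_mul_eq_mul_div, one_mul, sub_le_iff_le_add]
    have : M - |z| ≤ M * M / s := by
      rw [le_div_iff₀ hs]
      nlinarith [mul_nonneg hM.le (sub_nonneg.2 h3), mul_nonneg (abs_nonneg z) (sub_nonneg.2 h1)]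
    linarith
  rw [e, div_mul_eq_mul_div, mul_div_assoc]
  nlinarith [mul_nonneg q0 (sub_nonneg.2 q1), mul_nonneg (sub_nonneg.2 q1) (mul_nonneg q0 q0),
    mul_nonneg (sub_nonneg.2 q1) q0]

lemma abs_bt_sub_le (hM : 0 < M) (a b : ℝ) : |bt M a - bt M b| ≤ 2 * M * |a - b| := by
  have := Convex.norm_image_sub_le_of_norm_hasDerivWithin_le (f := bt M) (f' := bt' M)
    (s := Set.univ) (x := b) (y := a) (C := 2 * M)
    (fun x _ => ((renorm_bt hM).deriv1 x).hasDerivWithinAt)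
    (fun x _ => (renorm_bt hM).bound x) convex_univ trivial trivial
  simpa using this

lemma tendsto_bt (z : ℝ) : Tendsto (fun n : ℕ => bt (n + 1) z) atTop (nhds (z ^ 2)) := by
  rw [tendsto_iff_norm_sub_tendsto_zero]
  have hlim : Tendsto (fun n : ℕ => |z| ^ 3 / 2 * (1 / ((n : ℝ) + 1))) atTop (nhds 0) := by
    simpa only [mul_zero] using
      (tendsto_one_div_add_atTop_nhds_zero_nat (𝕜 := ℝ)).const_mul (|z| ^ 3 / 2)
  refine squeeze_zero (fun n => norm_nonneg _) (fun n => ?_) hlim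
  have hM : (0 : ℝ) < n + 1 := by positivity
  set M : ℝ := n + 1
  obtain ⟨h1, h2, h3, h4⟩ := bt_sqrt hM z
  rw [Real.norm_eq_abs, abs_sub_comm, abs_of_nonneg (sub_nonneg.2 (bt_le_sq hM z)), mul_one_div,
    le_div_iff₀ hM]
  unfold bt
  set s := √(M ^ 2 + z ^ 2)
  set w := |z| with hw
  have hw0 : 0 ≤ w := abs_nonneg z
  have hz : z ^ 2 = w ^ 2 := (sq_abs z).symm
  rw [hz] at h4 ⊢
  have e : w ^ 2 - 2 * M * (s - M) = (s - M) ^ 2 := by nlinarith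
  rw [e]
  have f : (s - M) * (s + M) = w ^ 2 := by nlinarith
  have a0 : 0 ≤ s - M := sub_nonneg.2 h1
  have a1 : s - M ≤ w := by linarith
  have a2 : (s - M) * M ≤ w ^ 2 / 2 := by nlinarith
  nlinarith [mul_le_mul a1 a2 (by positivity) hw0]

end RenormFamily

section GradientBound
variable {d : ℕ}

/-- The error of the Fejér approximation of the gradient. -/
def gradErr (N : ℕ) (u : (Fin d → ℝ) → ℝ) : ℝ :=
  ∑' k, (1 - mult N k) ^ 2 * ((∑ i, fq i k ^ 2) * ‖fc u k‖ ^ 2)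

lemma gradE_nonneg (u : (Fin d → ℝ) → ℝ) : 0 ≤ gradE u := tsum_nonneg fun k => by positivity

lemma gradErr_nonneg (N : ℕ) (u : (Fin d → ℝ) → ℝ) : 0 ≤ gradErr N u :=
  tsum_nonneg fun k => by positivity

lemma gradErr_le {u : (Fin d → ℝ) → ℝ} (hu : InH1 u) (N : ℕ) : gradErr N u ≤ gradE u := by
  have : ∀ k, (1 - mult N k) ^ 2 * ((∑ i, fq i k ^ 2) * ‖fc u k‖ ^ 2) ≤
      (∑ i, fq i k ^ 2) * ‖fc u k‖ ^ 2 := fun k =>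
    mul_le_of_le_one_left (by positivity) (sq_one_sub_mult_le N k)
  exact Summable.tsum_le_tsum this
    (Summable.of_nonneg_of_le (fun k => by positivity) this hu.2) hu.2

lemma tendsto_gradErr {u : (Fin d → ℝ) → ℝ} (hu : InH1 u) :
    Tendsto (fun N => gradErr N u) atTop (nhds 0) :=
  tendsto_tsum_one_sub_mult hu.2 fun k => by positivity

lemma exists_grad_err {u : (Fin d → ℝ) → ℝ} (hu : InH1 u) :
    ∃ g : Fin d → (Fin d → ℝ) → ℝ, (∀ i, MemLp (g i) 2 (μT d)) ∧
      (∀ i N, pd i (fej N u) = fej N (g i)) ∧ ∑ i, ∫ x, g i x ^ 2 ∂(μT d) = gradE u ∧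
      ∀ N, ∑ i, ∫ x, (fej N (g i) x - g i x) ^ 2 ∂(μT d) = gradErr N u := by
  choose g hg hgc using exists_partial hu
  have hn : ∀ i k, ‖fc (g i) k‖ ^ 2 = fq i k ^ 2 * ‖fc u k‖ ^ 2 := fun i k => by
    rw [hgc, norm_mul, norm_mul, Complex.norm_I, Complex.norm_real, Real.norm_eq_abs, mul_one,
      mul_pow, sq_abs]
  refine ⟨g, hg, fun i N => fej_partial (integrable_of_memLp_two hu.1)
    (integrable_of_memLp_two (hg i)) (hgc i) N, ?_, fun N => ?_⟩
  · have := hasSum_sum (s := Finset.univ) fun i _ => parseval (hg i)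
    simp_rw [hn, ← Finset.sum_mul] at this
    exact this.tsum_eq.symm
  · have := hasSum_sum (s := Finset.univ) fun i _ => parseval
      (((test_fej N (g i)).memLp 2).sub (hg i))
    have e : ∀ i k, ‖fc (fej N (g i) - g i) k‖ ^ 2 =
        (1 - mult N k) ^ 2 * (fq i k ^ 2 * ‖fc u k‖ ^ 2) := fun i k => by
      rw [← hn]; exact fc_fej_sub N (integrable_of_memLp_two (hg i)) k
    simp_rw [e, ← Finset.mul_sum, ← Finset.sum_mul] at this
    exact this.tsum_eq.symm

/-- The norm of the `N`-th Fejér operator from `L²` to `L^∞`. -/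
def fejC (d N : ℕ) : ℝ := ((cube d N).card : ℝ)⁻¹ * ∑ _p ∈ cube d N ×ˢ cube d N, (1 + 1)

lemma abs_pairT_le {f φ : (Fin d → ℝ) → ℝ} (hf : MemLp f 2 (μT d)) (hφ : ∀ x, |φ x| ≤ 1) :
    |pairT f φ| ≤ √(∫ x, f x ^ 2 ∂(μT d)) := by
  refine le_trans ?_ (integral_abs_le_sqrt hf)
  unfold pairT
  refine norm_integral_le_of_norm_le (f := fun x => f x * φ x) (integrable_of_memLp_two hf).abs
    (ae_of_all _ fun x => ?_)
  rw [Real.norm_eq_abs, abs_mul]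
  exact mul_le_of_le_one_right (abs_nonneg _) (hφ x)

lemma abs_fej_le_fejC (N : ℕ) {f : (Fin d → ℝ) → ℝ} (hf : MemLp f 2 (μT d)) (x) :
    |fej N f x| ≤ fejC d N * √(∫ x, f x ^ 2 ∂(μT d)) := by
  refine (abs_syn_le N _ _ x).trans ?_
  unfold fejC
  rw [mul_assoc, Finset.sum_mul]
  refine mul_le_mul_of_nonneg_left (Finset.sum_le_sum fun p _ => ?_) (by positivity)
  rw [add_mul, one_mul]
  exact add_le_add (abs_pairT_le hf (abs_cs_le _)) (abs_pairT_le hf (abs_sn_le _))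

lemma gradE_le {u : (Fin d → ℝ) → ℝ} (hu : InH1 u) {M : ℝ} (hM : 0 < M) (N K : ℕ) :
    gradE u ≤ ∫ x, bt'' M (fej N u x) * ∑ i, pd i (fej N u) x ^ 2 ∂(μT d) +
      10 * gradErr N u + 8 * gradErr K u +
      12 / M * fejC d K ^ 2 * √(∫ x, u x ^ 2 ∂(μT d)) * gradE u := by
  obtain ⟨g, hg, hgu, hgE, hgErr⟩ := exists_grad_err hu
  have ig : ∀ i, Integrable (fun x => g i x ^ 2) (μT d) := fun i => (hg i).integrable_sq
  have ie : ∀ N i, Integrable (fun x => (fej N (g i) x - g i x) ^ 2) (μT d) := fun N i =>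
    (((test_fej N (g i)).memLp 2).sub (hg i)).integrable_sq
  have iv : Integrable (fun x => |fej N u x|) (μT d) := (test_fej N u).integrable.abs
  have hb'' : Test (fun x => bt'' M (fej N u x)) := (test_fej N u).comp (renorm_bt hM).smooth''
  have ib : Integrable (fun x => bt'' M (fej N u x) * ∑ i, fej N (g i) x ^ 2) (μT d) := by
    simp_rw [Finset.mul_sum, sq]
    exact integrable_finsetSum _ fun i _ =>
      (hb''.mul ((test_fej N _).mul (test_fej N _))).integrable
  simp_rw [hgu]
  set Q : ℝ := fejC d K ^ 2 * gradE u with hQ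
  have hK : ∀ x, ∑ i, fej K (g i) x ^ 2 ≤ Q := fun x => by
    rw [hQ, ← hgE, Finset.mul_sum]
    refine Finset.sum_le_sum fun i _ => ?_
    have := abs_fej_le_fejC K (hg i) x
    rw [← sq_abs, ← Real.sq_sqrt (integral_nonneg (μ := μT d) fun x => sq_nonneg (g i x)),
      ← mul_pow]
    exact pow_le_pow_left₀ (abs_nonneg _) this 2
  have key : ∀ x, ∑ i, g i x ^ 2 ≤ bt'' M (fej N u x) * ∑ i, fej N (g i) x ^ 2 +
      10 * ∑ i, (fej N (g i) x - g i x) ^ 2 + 8 * ∑ i, (fej K (g i) x - g i x) ^ 2 +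
      12 / M * Q * |fej N u x| := fun x => by
    set b := bt'' M (fej N u x) with hb
    have b0 : 0 ≤ b := (renorm_bt hM).nonneg'' _
    have b2 : 0 ≤ 2 - b := sub_nonneg.2 (bt''_le hM _)
    have c1 : ∑ i, g i x ^ 2 ≤ b * ∑ i, fej N (g i) x ^ 2 +
      10 * ∑ i, (fej N (g i) x - g i x) ^ 2 + 8 * ∑ i, (fej K (g i) x - g i x) ^ 2 +
      2 * (2 - b) * ∑ i, fej K (g i) x ^ 2 := by
      simp_rw [Finset.mul_sum, ← Finset.sum_add_distrib]
      refine Finset.sum_le_sum fun i _ => ?_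
      generalize fej N (g i) x = p
      generalize fej K (g i) x = q
      generalize g i x = r
      have s1 : r ^ 2 ≤ 2 * p ^ 2 + 2 * (p - r) ^ 2 := by nlinarith [sq_nonneg (2 * p - r)]
      have s2 : p ^ 2 ≤ 2 * q ^ 2 + 4 * (p - r) ^ 2 + 4 * (q - r) ^ 2 := by
        nlinarith [sq_nonneg (p - 2 * q), sq_nonneg (p + q - 2 * r)]
      nlinarith [mul_le_mul_of_nonneg_left s2 b2, mul_nonneg b0 (sq_nonneg (p - r)),
        mul_nonneg b0 (sq_nonneg (q - r))]
    have c2 : 2 * (2 - b) * ∑ i, fej K (g i) x ^ 2 ≤ 12 / M * Q * |fej N u x| := by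
      have := mul_le_mul (two_sub_bt''_le hM (fej N u x)) (hK x)
        (Finset.sum_nonneg fun i _ => sq_nonneg _) (by positivity)
      calc _ = 2 * ((2 - b) * ∑ i, fej K (g i) x ^ 2) := by ring
        _ ≤ 2 * (6 / M * |fej N u x| * Q) := by linarith
        _ = _ := by ring
    linarith
  have j1 := (integrable_finsetSum Finset.univ fun i _ => ie N i).const_mul 10
  have j2 := (integrable_finsetSum Finset.univ fun i _ => ie K i).const_mul 8
  have j3 := iv.const_mul (12 / M * Q)
  have J1 := ib.add j1
  have J2 := J1.add j2
  have J3 := J2.add j3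
  have H := integral_mono (integrable_finsetSum Finset.univ fun i _ => ig i) J3 key
  rw [integral_finsetSum _ fun i _ => ig i, hgE] at H
  have e : ∫ x, (((fun x => bt'' M (fej N u x) * ∑ i, fej N (g i) x ^ 2) +
      (fun x => 10 * ∑ i, (fej N (g i) x - g i x) ^ 2) +
      (fun x => 8 * ∑ i, (fej K (g i) x - g i x) ^ 2) +
      (fun x => 12 / M * Q * |fej N u x|) : (Fin d → ℝ) → ℝ) x) ∂(μT d) =
      ∫ x, bt'' M (fej N u x) * ∑ i, fej N (g i) x ^ 2 ∂(μT d) + 10 * gradErr N u +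
      8 * gradErr K u + 12 / M * Q * ∫ x, |fej N u x| ∂(μT d) := by
    rw [integral_add' J2 j3, integral_add' J1 j2, integral_add' ib j1, integral_const_mul,
      integral_const_mul, integral_const_mul, integral_finsetSum _ fun i _ => ie N i,
      integral_finsetSum _ fun i _ => ie K i, hgErr, hgErr]
  have H' := H.trans (le_of_eq e)
  have f : 12 / M * Q * ∫ x, |fej N u x| ∂(μT d) ≤ 12 / M * Q * √(∫ x, u x ^ 2 ∂(μT d)) :=
    mul_le_mul_of_nonneg_left ((integral_abs_le_sqrt ((test_fej N u).memLp 2)).trans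
      (Real.sqrt_le_sqrt (integral_fej_sq_le N hu.1)))
      (mul_nonneg (by positivity) (mul_nonneg (by positivity) (gradE_nonneg u)))
  have f' : 12 / M * fejC d K ^ 2 * √(∫ x, u x ^ 2 ∂(μT d)) * gradE u =
    12 / M * Q * √(∫ x, u x ^ 2 ∂(μT d)) := by rw [hQ]; ring
  linarith

end GradientBound

section Measurability
variable {d : ℕ}

lemma abs_integral_mul_mul_le {u w ψ : (Fin d → ℝ) → ℝ} {C : ℝ} (hu : MemLp u 2 (μT d))
    (hw : MemLp w 2 (μT d)) (hC : ∀ x, |ψ x| ≤ C) :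
    |∫ x, u x * w x * ψ x ∂(μT d)| ≤
      C * (√(∫ x, u x ^ 2 ∂(μT d)) * √(∫ x, w x ^ 2 ∂(μT d))) := by
  refine le_trans ?_ (mul_le_mul_of_nonneg_left (integral_abs_mul_le hu hw)
    ((abs_nonneg _).trans (hC 0)))
  rw [← integral_const_mul]
  refine norm_integral_le_of_norm_le (f := fun x => u x * w x * ψ x)
    ((integrable_mul_two hu hw).abs.const_mul _) (ae_of_all _ fun x => ?_)
  rw [Real.norm_eq_abs, abs_mul, mul_comm]
  exact mul_le_mul_of_nonneg_right (hC x) (abs_nonneg _)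

lemma exists_test_bound {φ : (Fin d → ℝ) → ℝ} (hφ : Test φ) : ∃ C, 0 ≤ C ∧ (∀ x, |φ x| ≤ C) ∧
    (∀ i x, |pd i φ x| ≤ C) ∧ ∀ x, |lap φ x| ≤ C := by
  obtain ⟨C1, h1, H1⟩ := hφ.bound
  obtain ⟨C3, h3, H3⟩ := hφ.lap.bound
  choose C2 h2 H2 using fun i => (hφ.pd i).bound
  have hs : 0 ≤ ∑ i, C2 i := Finset.sum_nonneg fun i _ => (abs_nonneg _).trans (H2 i 0)
  have p1 := (abs_nonneg _).trans (H1 0)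
  have p3 := (abs_nonneg _).trans (H3 0)
  refine ⟨C1 + (∑ i, C2 i) + C3, by linarith, fun x => by linarith [H1 x], fun i x => ?_,
    fun x => by linarith [H3 x]⟩
  have := Finset.single_le_sum (f := C2) (fun i _ => (abs_nonneg _).trans (H2 i 0))
    (Finset.mem_univ i)
  linarith [H2 i x]

lemma abs_gen_le {u D c φ : (Fin d → ℝ) → ℝ} {h : (Fin d → ℝ) → Fin d → ℝ} {C : ℝ}
    (hu : MemLp u 2 (μT d)) (hh : ∀ i, MemLp (fun x => h x i) 2 (μT d)) (hD : MemLp D 2 (μT d))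
    (hc : MemLp c 2 (μT d)) (hφ : Test φ) (h1 : ∀ x, |φ x| ≤ C) (h2 : ∀ i x, |pd i φ x| ≤ C)
    (h3 : ∀ x, |lap φ x| ≤ C) :
    |gen u h D c φ| ≤ C * √(∫ x, u x ^ 2 ∂(μT d)) * (1 + (∑ i, √(∫ x, h x i ^ 2 ∂(μT d))) +
      √(∫ x, c x ^ 2 ∂(μT d)) + √(∫ x, D x ^ 2 ∂(μT d))) := by
  have a1 := abs_integral_mul_mul_le hu (memLp_const (1 : ℝ)) h3
  have a2 := fun i => abs_integral_mul_mul_le hu (hh i) (h2 i)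
  have a3 := abs_integral_mul_mul_le hc hu h1
  have a4 := abs_integral_mul_mul_le hD hu h1
  have ii : ∀ i ∈ Finset.univ, Integrable (fun x => u x * h x i * pd i φ x) (μT d) := fun i _ =>
    integrable_mul_test (integrable_mul_two hu (hh i)) (hφ.pd i)
  have e2 : ∫ x, u x * (∑ i, h x i * pd i φ x) ∂(μT d) =
      ∑ i, ∫ x, u x * h x i * pd i φ x ∂(μT d) := by
    rw [← integral_finsetSum _ ii]
    simp_rw [Finset.mul_sum, mul_assoc]
  have e3 : ∫ x, (c x - D x) * u x * φ x ∂(μT d) =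
      ∫ x, c x * u x * φ x ∂(μT d) - ∫ x, D x * u x * φ x ∂(μT d) := by
    rw [← integral_sub (integrable_mul_test (integrable_mul_two hc hu) hφ)
      (integrable_mul_test (integrable_mul_two hD hu) hφ)]
    congr 1; ext x; ring
  have e1 : pairT u (lap φ) = ∫ x, u x * lap φ x ∂(μT d) := rfl
  unfold gen
  rw [e1, e2, e3]
  have a2' := (Finset.abs_sum_le_sum_abs (fun i => ∫ x, u x * h x i * pd i φ x ∂(μT d))
    Finset.univ).trans (Finset.sum_le_sum fun i _ => a2 i)
  rw [← Finset.mul_sum, ← Finset.mul_sum] at a2'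
  simp only [one_pow, integral_const, probReal_univ, smul_eq_mul, mul_one, Real.sqrt_one] at a1
  rw [abs_le] at *
  constructor <;> nlinarith

variable {F D c : ℝ → (Fin d → ℝ) → ℝ} {h : ℝ → (Fin d → ℝ) → Fin d → ℝ}

lemma measurable_integral_x {G : ℝ → (Fin d → ℝ) → ℝ} (hG : Measurable (Function.uncurry G)) :
    Measurable fun s => ∫ x, G s x ∂(μT d) :=
  (hG.stronglyMeasurable.integral_prod_right).measurable

lemma measurable_snd_comp {φ : (Fin d → ℝ) → ℝ} (hφ : Test φ) :
    Measurable fun p : ℝ × (Fin d → ℝ) => φ p.2 := hφ.continuous.measurable.comp measurable_snd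

lemma measurable_pairT (hF : Measurable (Function.uncurry F)) {φ : (Fin d → ℝ) → ℝ}
    (hφ : Test φ) : Measurable fun s => pairT (F s) φ :=
  measurable_integral_x (G := fun s x => F s x * φ x) (hF.mul (measurable_snd_comp hφ))

lemma measurable_comp_uncurry (hh : Measurable (Function.uncurry h)) (i : Fin d) :
    Measurable (Function.uncurry fun s x => h s x i) := (measurable_pi_apply i).comp hh

lemma measurable_gen (hF : Measurable (Function.uncurry F)) (hh : Measurable (Function.uncurry h))
    (hD : Measurable (Function.uncurry D)) (hc : Measurable (Function.uncurry c))
    {φ : (Fin d → ℝ) → ℝ} (hφ : Test φ) : Measurable fun s => gen (F s) (h s) (D s) (c s) φ := by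
  unfold gen
  refine ((measurable_pairT hF hφ.lap).sub (measurable_integral_x
    (G := fun s x => F s x * ∑ i, h s x i * pd i φ x) ?_)).add
    (measurable_integral_x (G := fun s x => (c s x - D s x) * F s x * φ x) ?_)
  · exact hF.mul (Finset.measurable_fun_sum _ fun i _ =>
      (measurable_comp_uncurry hh i).mul (measurable_snd_comp (hφ.pd i)))
  · exact ((hc.sub hD).mul hF).mul (measurable_snd_comp hφ)

lemma measurable_syn {N : ℕ} {A B : ℝ → (Fin d → ℤ) → ℝ} (hA : ∀ k, Measurable fun s => A s k)
    (hB : ∀ k, Measurable fun s => B s k) :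
    Measurable (Function.uncurry fun s x => syn N (A s) (B s) x) := by
  unfold syn
  refine measurable_const.mul (Finset.measurable_fun_sum _ fun p _ => ?_)
  exact (((hA _).comp measurable_fst).mul (measurable_snd_comp (test_cs _))).add
    (((hB _).comp measurable_fst).mul (measurable_snd_comp (test_sn _)))

lemma measurable_fej {N : ℕ} (hF : Measurable (Function.uncurry F)) :
    Measurable (Function.uncurry fun s x => fej N (F s) x) :=
  measurable_syn (fun k => measurable_pairT hF (test_cs k))
    fun k => measurable_pairT hF (test_sn k)

lemma measurable_pd_fej {N : ℕ} (hF : Measurable (Function.uncurry F)) (i : Fin d) :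
    Measurable (Function.uncurry fun s x => pd i (fej N (F s)) x) := by
  unfold fej
  simp_rw [pd_syn]
  exact measurable_syn (fun k => (measurable_pairT hF (test_sn k)).const_mul _)
    fun k => ((measurable_pairT hF (test_cs k)).const_mul _).neg

lemma measurable_lap_fej {N : ℕ} (hF : Measurable (Function.uncurry F)) :
    Measurable (Function.uncurry fun s x => lap (fej N (F s)) x) := by
  unfold fej
  simp_rw [lap_syn]
  exact measurable_syn (fun k => (measurable_pairT hF (test_cs k)).const_mul _)
    fun k => ((measurable_pairT hF (test_sn k)).const_mul _)

lemma measurable_fejGen {N : ℕ} (hF : Measurable (Function.uncurry F))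
    (hh : Measurable (Function.uncurry h)) (hD : Measurable (Function.uncurry D))
    (hc : Measurable (Function.uncurry c)) :
    Measurable (Function.uncurry fun s x => fejGen N (F s) (h s) (D s) (c s) x) :=
  measurable_syn (fun k => measurable_gen hF hh hD hc (test_cs k))
    fun k => measurable_gen hF hh hD hc (test_sn k)

lemma measurable_resid {N : ℕ} (hF : Measurable (Function.uncurry F))
    (hh : Measurable (Function.uncurry h)) (hD : Measurable (Function.uncurry D))
    (hc : Measurable (Function.uncurry c)) :
    Measurable (Function.uncurry fun s x => resid N (F s) (h s) (D s) (c s) x) := by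
  unfold resid
  refine (((measurable_fejGen hF hh hD hc).sub (measurable_lap_fej hF)).sub ?_).sub
    (hc.mul (measurable_fej hF))
  exact Finset.measurable_fun_sum _ fun i _ =>
      (measurable_comp_uncurry hh i).mul (measurable_pd_fej hF i)

lemma measurable_fc_sq (hF : Measurable (Function.uncurry F)) (k : Fin d → ℤ) :
    Measurable fun s => ‖fc (F s) k‖ ^ 2 := by
  refine (Measurable.norm ?_).pow_const 2
  unfold fc
  refine (StronglyMeasurable.integral_prod_right (f := fun s x => (F s x : ℂ) *
    Complex.exp (-(2 * (Real.pi : ℂ) * Complex.I) * ((∑ i, (k i : ℝ) * x i : ℝ) : ℂ)))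
    (Measurable.stronglyMeasurable ?_)).measurable
  refine (Complex.measurable_ofReal.comp hF).mul (Measurable.comp (g := fun x : Fin d → ℝ =>
    Complex.exp (-(2 * (Real.pi : ℂ) * Complex.I) * ((∑ i, (k i : ℝ) * x i : ℝ) : ℂ)))
    ?_ measurable_snd)
  fun_prop

lemma aestronglyMeasurable_tsum {ι α : Type*} [Countable ι] {m0 : MeasurableSpace α}
    {μ : Measure α} {a : ι → α → ℝ} (ha : ∀ k, Measurable (a k))
    (hs : ∀ᵐ s ∂μ, Summable fun k => a k s) :
    AEStronglyMeasurable (fun s => ∑' k, a k s) μ := by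
  refine aestronglyMeasurable_of_tendsto_ae atTop (f := fun (S : Finset ι) s => ∑ k ∈ S, a k s)
    (fun S => (Finset.measurable_fun_sum _ fun k _ => ha k).aestronglyMeasurable) ?_
  filter_upwards [hs] with s hs using hs.hasSum

lemma syn_integral {N : ℕ} {a b : (Fin d → ℤ) → ℝ → ℝ} {t : ℝ}
    (ha : ∀ k, IntervalIntegrable (a k) volume 0 t) (hb : ∀ k, IntervalIntegrable (b k) volume 0 t)
    (x : Fin d → ℝ) :
    ∫ s in (0:ℝ)..t, syn N (fun k => a k s) (fun k => b k s) x =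
      syn N (fun k => ∫ s in (0:ℝ)..t, a k s) (fun k => ∫ s in (0:ℝ)..t, b k s) x := by
  unfold syn
  rw [intervalIntegral.integral_const_mul, intervalIntegral.integral_finsetSum]
  · congr 1
    refine Finset.sum_congr rfl fun p _ => ?_
    rw [intervalIntegral.integral_add ((ha _).mul_const _) ((hb _).mul_const _),
      intervalIntegral.integral_mul_const, intervalIntegral.integral_mul_const]
  · exact fun p _ => ((ha _).mul_const _).add ((hb _).mul_const _)

lemma intervalIntegrable_syn {N : ℕ} {a b : (Fin d → ℤ) → ℝ → ℝ} {t : ℝ}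
    (ha : ∀ k, IntervalIntegrable (a k) volume 0 t) (hb : ∀ k, IntervalIntegrable (b k) volume 0 t)
    (x : Fin d → ℝ) :
    IntervalIntegrable (fun s => syn N (fun k => a k s) (fun k => b k s) x) volume 0 t := by
  unfold syn
  refine IntervalIntegrable.const_mul ?_ _
  have := IntervalIntegrable.sum (cube d N ×ˢ cube d N)
    (f := fun p s => a (p.1 - p.2) s * cs (p.1 - p.2) x + b (p.1 - p.2) s * sn (p.1 - p.2) x)
    (μ := volume) (a := 0) (b := t) fun p _ => ((ha _).mul_const _).add ((hb _).mul_const _)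
  refine this.congr fun s _ => ?_
  simp

end Measurability

section Evolution
variable {d : ℕ}

/-- A measurable solution of `∂_t F - ΔF = h·∇F + c F` whose time slices are admissible. -/
structure Evol (T : ℝ) (h : ℝ → (Fin d → ℝ) → Fin d → ℝ) (D c F : ℝ → (Fin d → ℝ) → ℝ)
    (f0 : (Fin d → ℝ) → ℝ) (CD Cc : ℝ → ℝ) (B : ℝ) : Prop where
  T_pos : 0 < T
  F_meas : Measurable (Function.uncurry F)
  h_meas : Measurable (Function.uncurry h)
  D_meas : Measurable (Function.uncurry D)
  c_meas : Measurable (Function.uncurry c)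
  f0_mem : MemLp f0 2 (μT d)
  slice : ∀ᵐ s ∂(volume.restrict (Set.Ioc 0 T)), Slice (F s) (h s) (D s) (c s) (CD s) (Cc s)
  CD_nonneg : ∀ s, 0 ≤ CD s
  Cc_nonneg : ∀ s, 0 ≤ Cc s
  CD_int : IntegrableOn CD (Set.Ioc 0 T)
  Cc_int : IntegrableOn Cc (Set.Ioc 0 T)
  F_bdd : ∀ᵐ s ∂(volume.restrict (Set.Ioc 0 T)), ∫ x, F s x ^ 2 ∂(μT d) ≤ B
  grad_int : IntegrableOn (fun s => gradE (F s)) (Set.Ioc 0 T)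
  h_int : ∀ i, IntegrableOn (fun s => ∫ x, h s x i ^ 2 ∂(μT d)) (Set.Ioc 0 T)
  eq : ∀ᵐ t ∂(volume.restrict (Set.Ioc 0 T)), ∀ φ, Test φ →
    pairT (F t) φ = pairT f0 φ + ∫ s in Set.Ioc 0 t, gen (F s) (h s) (D s) (c s) φ

namespace Evol
variable {T B : ℝ} {h : ℝ → (Fin d → ℝ) → Fin d → ℝ} {D c F : ℝ → (Fin d → ℝ) → ℝ}
  {f0 : (Fin d → ℝ) → ℝ} {CD Cc : ℝ → ℝ} (E : Evol T h D c F f0 CD Cc B)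
include E

lemma gen_int {φ : (Fin d → ℝ) → ℝ} (hφ : Test φ) :
    IntegrableOn (fun s => gen (F s) (h s) (D s) (c s) φ) (Set.Ioc 0 T) := by
  obtain ⟨C, hC, h1, h2, h3⟩ := exists_test_bound hφ
  have hi : IntegrableOn (fun s => C * √B * (1 + (∑ i, (1 + ∫ x, h s x i ^ 2 ∂(μT d))) +
      Cc s + CD s)) (Set.Ioc 0 T) := by
    refine Integrable.const_mul ?_ _
    refine (((integrable_const _).add (integrable_finsetSum _ fun i _ =>
      (integrable_const _).add (E.h_int i))).add E.Cc_int).add E.CD_int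
  refine hi.mono' (measurable_gen E.F_meas E.h_meas E.D_meas E.c_meas hφ).aestronglyMeasurable ?_
  filter_upwards [E.slice, E.F_bdd] with s S hB
  refine (abs_gen_le S.u_mem.1 S.h_mem S.D_mem S.c_mem hφ h1 h2 h3).trans ?_
  have hb : ∀ w : (Fin d → ℝ) → ℝ, ∀ K, 0 ≤ K → (∀ᵐ x ∂(μT d), |w x| ≤ K) →
      √(∫ x, w x ^ 2 ∂(μT d)) ≤ K := fun w K hK hw => by
    refine Real.sqrt_le_iff.2 ⟨hK, ?_⟩
    have := integral_mono_of_nonneg (μ := μT d) (f := fun x => w x ^ 2) (g := fun _ => K ^ 2)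
      (ae_of_all _ fun x => sq_nonneg _) (integrable_const _) (by
        filter_upwards [hw] with x hx
        rw [← sq_abs]; exact pow_le_pow_left₀ (abs_nonneg _) hx 2)
    simpa using this
  have hs : ∀ z : ℝ, 0 ≤ z → √z ≤ 1 + z := fun z hz =>
    Real.sqrt_le_iff.2 ⟨by positivity, by nlinarith⟩
  refine mul_le_mul (mul_le_mul_of_nonneg_left (Real.sqrt_le_sqrt hB) hC) ?_ (by positivity)
    (by positivity)
  refine add_le_add (add_le_add (add_le_add le_rfl (Finset.sum_le_sum fun i _ => ?_)) ?_) ?_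
  · exact hs _ (integral_nonneg fun x => sq_nonneg _)
  · exact hb _ _ S.Cc_nonneg S.c_bdd
  · exact hb _ _ S.CD_nonneg S.D_bdd

lemma gen_ii {φ : (Fin d → ℝ) → ℝ} (hφ : Test φ) {t : ℝ} (ht : t ∈ Set.Icc 0 T) :
    IntervalIntegrable (fun s => gen (F s) (h s) (D s) (c s) φ) volume 0 t :=
  (intervalIntegrable_iff_integrableOn_Ioc_of_le ht.1).2
    ((E.gen_int hφ).mono_set (Set.Ioc_subset_Ioc_right ht.2))

lemma fej_eq {t : ℝ} (ht : t ∈ Set.Icc 0 T)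
    (heq : ∀ φ, Test φ →
      pairT (F t) φ = pairT f0 φ + ∫ s in Set.Ioc 0 t, gen (F s) (h s) (D s) (c s) φ) (N : ℕ) (x) :
    fej N (F t) x = fej N f0 x +
      ∫ s in (0:ℝ)..t, fejGen N (F s) (h s) (D s) (c s) x := by
  unfold fejGen
  rw [syn_integral (fun k => E.gen_ii (test_cs k) ht) (fun k => E.gen_ii (test_sn k) ht)]
  unfold fej
  rw [← syn_add]
  simp_rw [heq _ (test_cs _), heq _ (test_sn _), intervalIntegral.integral_of_le ht.1]

lemma fejGen_ii {t : ℝ} (ht : t ∈ Set.Icc 0 T) (N : ℕ) (x) :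
    IntervalIntegrable (fun s => fejGen N (F s) (h s) (D s) (c s) x) volume 0 t :=
  intervalIntegrable_syn (fun k => E.gen_ii (test_cs k) ht) (fun k => E.gen_ii (test_sn k) ht) x

lemma renorm_eq {β β' β'' : ℝ → ℝ} {L : ℝ} (R : Renorm β β' β'' L) {t : ℝ}
    (ht : t ∈ Set.Icc 0 T)
    (heq : ∀ φ, Test φ →
      pairT (F t) φ = pairT f0 φ + ∫ s in Set.Ioc 0 t, gen (F s) (h s) (D s) (c s) φ) (N : ℕ) (x) :
    β (fej N (F t) x) - β (fej N f0 x) =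
      ∫ s in Set.Ioc 0 t, β' (fej N (F s) x) * fejGen N (F s) (h s) (D s) (c s) x := by
  rw [E.fej_eq ht heq, comp_primitive_sub (E.fejGen_ii ht N x) R.deriv1 R.smooth'.continuous,
    intervalIntegral.integral_of_le ht.1]
  refine integral_congr_ae ?_
  have h1 := ae_restrict_of_ae_restrict_of_subset (Set.Ioc_subset_Ioc_right ht.2) E.eq
  filter_upwards [h1, ae_restrict_mem measurableSet_Ioc] with s hs hsm
  rw [← E.fej_eq ⟨hsm.1.le, hsm.2.trans ht.2⟩ hs]

lemma prod_int {β β' β'' : ℝ → ℝ} {L : ℝ} (R : Renorm β β' β'' L) (N : ℕ) {t : ℝ}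
    (ht : t ∈ Set.Icc 0 T) :
    Integrable (Function.uncurry fun s x =>
      β' (fej N (F s) x) * fejGen N (F s) (h s) (D s) (c s) x)
      ((volume.restrict (Set.Ioc 0 t)).prod (μT d)) := by
  have gi : ∀ {φ : (Fin d → ℝ) → ℝ}, Test φ →
      Integrable (fun s => gen (F s) (h s) (D s) (c s) φ) (volume.restrict (Set.Ioc 0 t)) :=
    fun hφ => (E.gen_int hφ).mono_set (Set.Ioc_subset_Ioc_right ht.2)
  have hm : Integrable (fun s => L * (((cube d N).card : ℝ)⁻¹ * ∑ p ∈ cube d N ×ˢ cube d N,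
      (|gen (F s) (h s) (D s) (c s) (cs (p.1 - p.2))| +
        |gen (F s) (h s) (D s) (c s) (sn (p.1 - p.2))|))) (volume.restrict (Set.Ioc 0 t)) :=
    ((integrable_finsetSum _ fun p _ => (gi (test_cs (p.1 - p.2))).abs.add
      (gi (test_sn (p.1 - p.2))).abs).const_mul _).const_mul _
  refine (hm.comp_fst (μT d)).mono' ?_ (ae_of_all _ fun p => ?_)
  · exact ((R.smooth'.continuous.measurable.comp (measurable_fej E.F_meas)).mul
      (measurable_fejGen E.F_meas E.h_meas E.D_meas E.c_meas)).aestronglyMeasurable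
  · rw [Function.uncurry, norm_mul]
    exact mul_le_mul (R.bound _) (abs_syn_le _ _ _ _) (norm_nonneg _)
      ((abs_nonneg _).trans (R.bound 0))

lemma integral_renorm_eq {β β' β'' : ℝ → ℝ} {L : ℝ} (R : Renorm β β' β'' L) {t : ℝ}
    (ht : t ∈ Set.Icc 0 T)
    (heq : ∀ φ, Test φ →
      pairT (F t) φ = pairT f0 φ + ∫ s in Set.Ioc 0 t, gen (F s) (h s) (D s) (c s) φ) (N : ℕ) :
    ∫ x, β (fej N (F t) x) ∂(μT d) = ∫ x, β (fej N f0 x) ∂(μT d) +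
      ∫ s in Set.Ioc 0 t,
        ∫ x, β' (fej N (F s) x) * fejGen N (F s) (h s) (D s) (c s) x ∂(μT d) := by
  rw [← sub_eq_iff_eq_add', ← integral_sub ((test_fej N _).comp R.smooth).integrable
    ((test_fej N _).comp R.smooth).integrable]
  simp_rw [E.renorm_eq R ht heq]
  exact (integral_integral_swap (E.prod_int R N ht)).symm

lemma resid_int (N : ℕ) : IntegrableOn
      (fun s => ∫ x, |resid N (F s) (h s) (D s) (c s) x| ∂(μT d)) (Set.Ioc 0 T) ∧
    ∀ᵐ s ∂(volume.restrict (Set.Ioc 0 T)),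
      ‖∫ x, |resid N (F s) (h s) (D s) (c s) x| ∂(μT d)‖ ≤
      (∑ i, ∫ x, h s x i ^ 2 ∂(μT d)) + gradE (F s) + 2 * Cc s * √B := by
  have hb : ∀ᵐ s ∂(volume.restrict (Set.Ioc 0 T)),
      ‖∫ x, |resid N (F s) (h s) (D s) (c s) x| ∂(μT d)‖ ≤
      (∑ i, ∫ x, h s x i ^ 2 ∂(μT d)) + gradE (F s) + 2 * Cc s * √B := by
    filter_upwards [E.slice, E.F_bdd] with s S hB
    rw [Real.norm_of_nonneg (integral_nonneg fun x => abs_nonneg _)]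
    refine (S.integral_resid_le N).trans (add_le_add_right ?_ _)
    exact mul_le_mul_of_nonneg_left (Real.sqrt_le_sqrt hB) (by linarith [S.Cc_nonneg])
  refine ⟨Integrable.mono' (((integrable_finsetSum _ fun i _ => E.h_int i).add E.grad_int).add
    ((E.Cc_int.const_mul 2).mul_const _)) ?_ hb, hb⟩
  exact (measurable_integral_x (G := fun s x => |resid N (F s) (h s) (D s) (c s) x|)
    (measurable_resid E.F_meas E.h_meas E.D_meas E.c_meas).norm).aestronglyMeasurable

lemma tendsto_resid : Tendsto (fun N => ∫ s in Set.Ioc 0 T,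
    ∫ x, |resid N (F s) (h s) (D s) (c s) x| ∂(μT d)) atTop (nhds 0) := by
  have := tendsto_integral_of_dominated_convergence (f := fun _ => (0:ℝ)) _
    (fun N => (E.resid_int N).1.1)
    (((integrable_finsetSum _ fun i _ => E.h_int i).add E.grad_int).add
    ((E.Cc_int.const_mul 2).mul_const _)) (fun N => (E.resid_int N).2) (by
      filter_upwards [E.slice] with s S using S.tendsto_resid)
  simpa using this

lemma gradErr_int (N : ℕ) : IntegrableOn (fun s => gradErr N (F s)) (Set.Ioc 0 T) := by
  refine E.grad_int.mono' (aestronglyMeasurable_tsum (fun k =>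
    ((measurable_fc_sq E.F_meas k).const_mul _).const_mul _) ?_) ?_
  · filter_upwards [E.slice] with s S
    refine Summable.of_nonneg_of_le (fun k => by positivity) (fun k => ?_) S.u_mem.2
    exact mul_le_of_le_one_left (by positivity) (sq_one_sub_mult_le N k)
  · filter_upwards [E.slice] with s S
    rw [Real.norm_of_nonneg (gradErr_nonneg _ _)]
    exact gradErr_le S.u_mem N

lemma tendsto_gradErr :
    Tendsto (fun N => ∫ s in Set.Ioc 0 T, gradErr N (F s)) atTop (nhds 0) := by
  have := tendsto_integral_of_dominated_convergence (f := fun _ => (0:ℝ)) _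
    (fun N => (E.gradErr_int N).1) E.grad_int (fun N => ?_) ?_
  · simpa using this
  · filter_upwards [E.slice] with s S
    rw [Real.norm_of_nonneg (gradErr_nonneg _ _)]
    exact gradErr_le S.u_mem N
  · filter_upwards [E.slice] with s S using GaleatiLuo.tendsto_gradErr S.u_mem

/-- The renormalised dissipation. -/
lemma diss_int {M : ℝ} (hM : 0 < M) (N : ℕ) : IntegrableOn (fun s =>
    ∫ x, bt'' M (fej N (F s) x) * ∑ i, pd i (fej N (F s)) x ^ 2 ∂(μT d)) (Set.Ioc 0 T) := by
  have R := renorm_bt hM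
  refine (E.grad_int.const_mul 2).mono' ?_ ?_
  · refine (measurable_integral_x (G := fun s x =>
      bt'' M (fej N (F s) x) * ∑ i, pd i (fej N (F s)) x ^ 2) ?_).aestronglyMeasurable
    exact (R.smooth''.continuous.measurable.comp (measurable_fej E.F_meas)).mul
      (Finset.measurable_fun_sum _ fun i _ => (measurable_pd_fej E.F_meas i).pow_const 2)
  · filter_upwards [E.slice] with s S
    obtain ⟨g, hg, hgu, hgE⟩ := exists_grad S.u_mem
    rw [Real.norm_of_nonneg (integral_nonneg fun x => mul_nonneg (R.nonneg'' _)
      (Finset.sum_nonneg fun i _ => sq_nonneg _))]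
    simp_rw [hgu]
    have ii : ∀ i ∈ Finset.univ, Integrable (fun x => fej N (g i) x ^ 2) (μT d) := fun i _ =>
      ((test_fej N (g i)).memLp 2).integrable_sq
    have h1 : ∑ i, ∫ x, fej N (g i) x ^ 2 ∂(μT d) ≤ gradE (F s) := by
      rw [← hgE]; exact Finset.sum_le_sum fun i _ => integral_fej_sq_le N (hg i)
    refine le_trans ?_ (mul_le_mul_of_nonneg_left h1 zero_le_two)
    rw [← integral_finsetSum _ ii, ← integral_const_mul]
    refine integral_mono_of_nonneg (ae_of_all _ fun x => mul_nonneg (R.nonneg'' _)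
      (Finset.sum_nonneg fun i _ => sq_nonneg _)) ((integrable_finsetSum _ ii).const_mul _)
      (ae_of_all _ fun x => ?_)
    exact mul_le_mul_of_nonneg_right (bt''_le hM _) (Finset.sum_nonneg fun i _ => sq_nonneg _)

end Evol
end Evolution

section EnergyBound
variable {d : ℕ}

lemma integrable_bt {u : (Fin d → ℝ) → ℝ} (hu : MemLp u 2 (μT d)) {M : ℝ} (hM : 0 < M) :
    Integrable (fun x => bt M (u x)) (μT d) := by
  refine hu.integrable_sq.mono'
    ((renorm_bt hM).smooth.continuous.comp_aestronglyMeasurable hu.1) (ae_of_all _ fun x => ?_)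
  rw [Real.norm_of_nonneg ((renorm_bt hM).nonneg _)]
  exact bt_le_sq hM _

lemma tendsto_integral_bt_fej {u : (Fin d → ℝ) → ℝ} (hu : MemLp u 2 (μT d)) {M : ℝ} (hM : 0 < M) :
    Tendsto (fun N => ∫ x, bt M (fej N u x) ∂(μT d)) atTop (nhds (∫ x, bt M (u x) ∂(μT d))) := by
  have iu := integrable_of_memLp_two hu
  rw [tendsto_iff_norm_sub_tendsto_zero]
  have h0 := (tendsto_fej_l1 iu).const_mul (2 * M)
  rw [mul_zero] at h0
  refine squeeze_zero (fun _ => norm_nonneg _) (fun N => ?_) h0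
  rw [← integral_sub (integrable_bt ((test_fej N u).memLp 2) hM) (integrable_bt hu hM),
    ← integral_const_mul]
  exact norm_integral_le_of_norm_le ((((test_fej N u).integrable.sub iu).abs).const_mul _)
    (ae_of_all _ fun x => abs_bt_sub_le hM _ _)

lemma tendsto_integral_bt {u : (Fin d → ℝ) → ℝ} (hu : MemLp u 2 (μT d)) :
    Tendsto (fun n : ℕ => ∫ x, bt (n + 1) (u x) ∂(μT d)) atTop
      (nhds (∫ x, u x ^ 2 ∂(μT d))) := by
  have hM : ∀ n : ℕ, (0:ℝ) < n + 1 := fun n => by positivity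
  refine tendsto_integral_of_dominated_convergence (fun x => u x ^ 2)
    (fun n => (integrable_bt hu (hM n)).1) hu.integrable_sq (fun n => ae_of_all _ fun x => ?_)
    (ae_of_all _ fun x => tendsto_bt _)
  rw [Real.norm_of_nonneg ((renorm_bt (hM n)).nonneg _)]
  exact bt_le_sq (hM n) _

namespace Evol
variable {T B : ℝ} {h : ℝ → (Fin d → ℝ) → Fin d → ℝ} {D c F : ℝ → (Fin d → ℝ) → ℝ}
  {f0 : (Fin d → ℝ) → ℝ} {CD Cc : ℝ → ℝ} (E : Evol T h D c F f0 CD Cc B)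
include E

/-- The renormalised energy estimate for the regularised solution. -/
lemma renorm_bound {M : ℝ} (hM : 0 < M) (N : ℕ) {X Λ : ℝ}
    (hX : X = ∫ x, f0 x ^ 2 ∂(μT d) + 2 * M * ∫ s in Set.Ioc 0 T,
      ∫ x, |resid N (F s) (h s) (D s) (c s) x| ∂(μT d))
    (hΛ : Λ = ∫ s in (0:ℝ)..T, CD s + 2 * Cc s) :
    (∀ t ∈ Set.Icc 0 T, (∀ φ, Test φ →
      pairT (F t) φ = pairT f0 φ + ∫ s in Set.Ioc 0 t, gen (F s) (h s) (D s) (c s) φ) →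
      ∫ x, bt M (fej N (F t) x) ∂(μT d) ≤ 2 * X * Real.exp (2 * Λ)) ∧
    ∫ s in Set.Ioc 0 T,
      ∫ x, bt'' M (fej N (F s) x) * ∑ i, pd i (fej N (F s)) x ^ 2 ∂(μT d) ≤
      X + Λ * (2 * X * Real.exp (2 * Λ)) := by
  have hT := E.T_pos.le
  have R := renorm_bt hM
  set J : ℝ → ℝ := fun s =>
    ∫ x, bt' M (fej N (F s) x) * fejGen N (F s) (h s) (D s) (c s) x ∂(μT d) with hJ
  set ρ : ℝ → ℝ := fun s => ∫ x, |resid N (F s) (h s) (D s) (c s) x| ∂(μT d) with hρ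
  set DN : ℝ → ℝ := fun s =>
    ∫ x, bt'' M (fej N (F s) x) * ∑ i, pd i (fej N (F s)) x ^ 2 ∂(μT d) with hDN
  set m : ℝ → ℝ := fun s => CD s + 2 * Cc s with hm
  have hm0 : ∀ s, 0 ≤ m s := fun s => by 
    have := E.CD_nonneg s
    have := E.Cc_nonneg s
    simp only [hm]; positivity
  have hρ0 : ∀ s, 0 ≤ ρ s := fun s => integral_nonneg fun x => abs_nonneg _
  have hDN0 : ∀ s, 0 ≤ DN s := fun s => integral_nonneg fun x => mul_nonneg (R.nonneg'' _)
      (Finset.sum_nonneg fun i _ => sq_nonneg _)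
  have ii : ∀ {g : ℝ → ℝ}, IntegrableOn g (Set.Ioc 0 T) → ∀ t ∈ Set.Icc 0 T,
      IntervalIntegrable g volume 0 t := fun hg t ht =>
    (intervalIntegrable_iff_integrableOn_Ioc_of_le ht.1).2
      (hg.mono_set (Set.Ioc_subset_Ioc_right ht.2))
  have iJ : IntegrableOn J (Set.Ioc 0 T) :=
    (E.prod_int R N ⟨hT, le_rfl⟩).integral_prod_left
  have iρ : IntegrableOn ρ (Set.Ioc 0 T) := (E.resid_int N).1
  have iD : IntegrableOn DN (Set.Ioc 0 T) := E.diss_int hM N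
  have iM : IntegrableOn m (Set.Ioc 0 T) := E.CD_int.add (E.Cc_int.const_mul 2)
  set Y0 : ℝ := ∫ x, bt M (fej N f0 x) ∂(μT d) with hY0
  set y : ℝ → ℝ := fun t => Y0 + ∫ s in (0:ℝ)..t, J s with hy
  have hyt : ∀ t ∈ Set.Icc 0 T, (∀ φ, Test φ →
      pairT (F t) φ = pairT f0 φ + ∫ s in Set.Ioc 0 t, gen (F s) (h s) (D s) (c s) φ) →
      ∫ x, bt M (fej N (F t) x) ∂(μT d) = y t := fun t ht heq => by
    rw [E.integral_renorm_eq R ht heq, ← intervalIntegral.integral_of_le ht.1]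
  have hyae : ∀ᵐ t ∂(volume.restrict (Set.Ioc 0 T)),
      ∫ x, bt M (fej N (F t) x) ∂(μT d) = y t := by
    filter_upwards [E.eq, ae_restrict_mem measurableSet_Ioc] with t h1 h2
    exact hyt t ⟨h2.1.le, h2.2⟩ h1
  have hyc : ContinuousOn y (Set.Icc 0 T) := by
    refine continuousOn_const.add ?_
    have := intervalIntegral.continuousOn_primitive_interval' (ii iJ T ⟨hT, le_rfl⟩)
      (Set.left_mem_uIcc)
    rwa [Set.uIcc_of_le hT] at this
  have hy0 : ∀ t ∈ Set.Icc 0 T, 0 ≤ y t := by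
    have h1 : y =ᵐ[volume.restrict (Set.Icc 0 T)] fun t => max (y t) 0 := by
      rw [← Measure.restrict_congr_set Ioc_ae_eq_Icc]
      filter_upwards [hyae] with t ht
      rw [max_eq_left]
      rw [← ht]; exact integral_nonneg fun x => R.nonneg _
    have := Measure.eqOn_Icc_of_ae_eq volume E.T_pos.ne h1 hyc 
      ((continuous_id.max continuous_const).comp_continuousOn hyc)
    intro t ht
    rw [this ht]; exact le_max_right _ _
  have hX1 : Y0 ≤ ∫ x, f0 x ^ 2 ∂(μT d) := by
    refine le_trans ?_ (integral_fej_sq_le N E.f0_mem)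
    exact integral_mono ((test_fej N _).comp R.smooth).integrable
      ((test_fej N f0).memLp 2).integrable_sq fun x => bt_le_sq hM _
  have hY00 : 0 ≤ Y0 := integral_nonneg fun x => R.nonneg _
  have hR0 : 0 ≤ 2 * M * ∫ s in Set.Ioc 0 T, ρ s :=
    mul_nonneg (by positivity) (integral_nonneg hρ0)
  have hX0 : 0 ≤ X := by rw [hX]; linarith
  have hen : ∀ᵐ s ∂(volume.restrict (Set.Ioc 0 T)), J s + DN s ≤ m s * y s + 2 * M * ρ s := by
    filter_upwards [E.slice, hyae] with s S hs
    rw [← hs]; exact S.energy N R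
  have imy : IntegrableOn (fun s => m s * y s) (Set.Ioc 0 T) := by
    have := (ii iM T ⟨hT, le_rfl⟩).mul_continuousOn (g := y) (by rwa [Set.uIcc_of_le hT])
    exact this.1
  have key : ∀ t ∈ Set.Icc 0 T, y t + ∫ s in (0:ℝ)..t, DN s ≤ X + ∫ s in (0:ℝ)..t, m s * y s := by
    intro t ht
    have h1 : ∫ s in (0:ℝ)..t, (J s + DN s) ≤ ∫ s in (0:ℝ)..t, (m s * y s + 2 * M * ρ s) := by
      refine intervalIntegral.integral_mono_ae_restrict ht.1
        ((ii iJ t ht).add (ii iD t ht)) ((ii imy t ht).add ((ii iρ t ht).const_mul _)) ?_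
      rw [← Measure.restrict_congr_set Ioc_ae_eq_Icc]
      exact ae_restrict_of_ae_restrict_of_subset (Set.Ioc_subset_Ioc_right ht.2) hen
    rw [intervalIntegral.integral_add (ii iJ t ht) (ii iD t ht),
      intervalIntegral.integral_add (ii imy t ht) ((ii iρ t ht).const_mul _),
      intervalIntegral.integral_const_mul] at h1
    have h2 : ∫ s in (0:ℝ)..t, ρ s ≤ ∫ s in Set.Ioc 0 T, ρ s := by
      rw [intervalIntegral.integral_of_le ht.1]
      exact setIntegral_mono_set iρ (ae_of_all _ hρ0)
        (Set.Ioc_subset_Ioc_right ht.2).eventuallyLE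
    have h3 := mul_le_mul_of_nonneg_left h2 (by positivity : 0 ≤ 2 * M)
    simp only [hy]
    rw [hX]; linarith
  obtain ⟨b, hb⟩ := isCompact_Icc.bddAbove_image hyc
  have hD0 : ∀ t ∈ Set.Icc 0 T, 0 ≤ ∫ s in (0:ℝ)..t, DN s := fun t ht =>
    intervalIntegral.integral_nonneg_of_forall ht.1 hDN0
  have G := gronwall_integrable hX0 (ii iM T ⟨hT, le_rfl⟩) hm0 (y := y) (B := b)
    (fun t ht => hb ⟨t, ht, rfl⟩) (ii imy T ⟨hT, le_rfl⟩)
    (fun t ht => by linarith [key t ht, hD0 t ht])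
  have G' : ∀ t ∈ Set.Icc 0 T, y t ≤ 2 * X * Real.exp (2 * Λ) := fun t ht => by
    refine (G t ht).trans (mul_le_mul_of_nonneg_left (Real.exp_le_exp.2 ?_) (by positivity))
    refine mul_le_mul_of_nonneg_left ?_ zero_le_two
    rw [hΛ, intervalIntegral.integral_of_le ht.1, intervalIntegral.integral_of_le hT]
    exact setIntegral_mono_set iM (ae_of_all _ hm0) (Set.Ioc_subset_Ioc_right ht.2).eventuallyLE
  refine ⟨fun t ht heq => (hyt t ht heq).trans_le (G' t ht), ?_⟩
  have hTm : T ∈ Set.Icc 0 T := ⟨hT, le_rfl⟩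
  have h1 := key T hTm
  have h2 := hy0 T hTm
  have h3 : ∫ s in (0:ℝ)..T, m s * y s ≤ ∫ s in (0:ℝ)..T, m s * (2 * X * Real.exp (2 * Λ)) :=
    intervalIntegral.integral_mono_on hT (ii imy T hTm) ((ii iM T hTm).mul_const _)
      fun s hs => mul_le_mul_of_nonneg_left (G' s hs) (hm0 s)
  rw [intervalIntegral.integral_mul_const, ← hΛ] at h3
  rw [← intervalIntegral.integral_of_le hT]
  linarith

lemma tendsto_budget (M : ℝ) : Tendsto (fun N => ∫ x, f0 x ^ 2 ∂(μT d) + 2 * M *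
    ∫ s in Set.Ioc 0 T, ∫ x, |resid N (F s) (h s) (D s) (c s) x| ∂(μT d)) atTop
    (nhds (∫ x, f0 x ^ 2 ∂(μT d))) := by
  simpa using (E.tendsto_resid.const_mul (2 * M)).const_add (∫ x, f0 x ^ 2 ∂(μT d))

/-- The `L²` estimate. -/
theorem l2_bound {t : ℝ} (ht : t ∈ Set.Icc 0 T) (hFt : MemLp (F t) 2 (μT d))
    (heq : ∀ φ, Test φ →
      pairT (F t) φ = pairT f0 φ + ∫ s in Set.Ioc 0 t, gen (F s) (h s) (D s) (c s) φ) :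
    ∫ x, F t x ^ 2 ∂(μT d) ≤ 2 * (∫ x, f0 x ^ 2 ∂(μT d)) *
      Real.exp (2 * ∫ s in (0:ℝ)..T, CD s + 2 * Cc s) := by
  refine le_of_tendsto (tendsto_integral_bt hFt) (Eventually.of_forall fun n => ?_)
  have hM : (0:ℝ) < n + 1 := by positivity
  exact le_of_tendsto_of_tendsto' (tendsto_integral_bt_fej hFt hM)
    (((E.tendsto_budget _).const_mul 2).mul_const _)
    fun N => (E.renorm_bound hM N rfl rfl).1 t ht heq

/-- The dissipation estimate. -/
theorem grad_bound {Λ : ℝ} (hΛ : Λ = ∫ s in (0:ℝ)..T, CD s + 2 * Cc s) :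
    ∫ s in Set.Ioc 0 T, gradE (F s) ≤
      ∫ x, f0 x ^ 2 ∂(μT d) + Λ * (2 * (∫ x, f0 x ^ 2 ∂(μT d)) * Real.exp (2 * Λ)) := by
  set A := ∫ x, f0 x ^ 2 ∂(μT d) with hA
  set G := ∫ s in Set.Ioc 0 T, gradE (F s) with hG
  have h1 : ∀ K : ℕ, ∀ M : ℝ, 0 < M → G ≤ (A + Λ * (2 * A * Real.exp (2 * Λ)) + 10 * 0) +
      8 * (∫ s in Set.Ioc 0 T, gradErr K (F s)) + 12 / M * fejC d K ^ 2 * √B * G := by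
    intro K M hM
    have tb := E.tendsto_budget M
    refine ge_of_tendsto' (((((tb.add (((tb.const_mul 2).mul_const _).const_mul Λ)).add
      (E.tendsto_gradErr.const_mul 10)).add_const _).add_const _)) fun N => ?_
    have h2 := (E.renorm_bound hM N rfl hΛ).2
    have iN := (E.gradErr_int N).const_mul 10
    have iK := (E.gradErr_int K).const_mul 8
    have iG := E.grad_int.const_mul (12 / M * fejC d K ^ 2 * √B)
    have iD := E.diss_int hM N
    have h3 : G ≤ ∫ s in Set.Ioc 0 T,
        (∫ x, bt'' M (fej N (F s) x) * ∑ i, pd i (fej N (F s)) x ^ 2 ∂(μT d) +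
          10 * gradErr N (F s) + 8 * gradErr K (F s) +
          12 / M * fejC d K ^ 2 * √B * gradE (F s)) := by
      refine integral_mono_ae E.grad_int (((iD.add iN).add iK).add iG) ?_
      filter_upwards [E.slice, E.F_bdd] with s S hB
      refine (gradE_le S.u_mem hM N K).trans (add_le_add_right ?_ _)
      refine mul_le_mul_of_nonneg_right ?_ (gradE_nonneg _)
      exact mul_le_mul_of_nonneg_left (Real.sqrt_le_sqrt hB)
        (mul_nonneg (by positivity) (sq_nonneg _))
    have e1 := integral_add ((iD.add iN).add iK) iG
    have e2 := integral_add (iD.add iN) iK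
    simp only [Pi.add_apply] at e1 e2
    rw [e1, e2, integral_add iD iN, integral_const_mul, integral_const_mul,
      integral_const_mul] at h3
    linarith
  have h2 : ∀ K : ℕ, G ≤ (A + Λ * (2 * A * Real.exp (2 * Λ))) +
      8 * (∫ s in Set.Ioc 0 T, gradErr K (F s)) := by
    intro K
    have h3 := (tendsto_one_div_add_atTop_nhds_zero_nat (𝕜 := ℝ)).const_mul
      (12 * fejC d K ^ 2 * √B * G)
    have h4 := h3.const_add ((A + Λ * (2 * A * Real.exp (2 * Λ)) + 10 * 0) +
      8 * (∫ s in Set.Ioc 0 T, gradErr K (F s)))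
    refine (ge_of_tendsto' h4 fun n => ?_).trans (by simp)
    refine (h1 K (n + 1) (by positivity)).trans (le_of_eq ?_)
    ring
  have h5 := (E.tendsto_gradErr.const_mul 8).const_add (A + Λ * (2 * A * Real.exp (2 * Λ)))
  exact (ge_of_tendsto' h5 h2).trans (by simp)

end Evol
end EnergyBound

section SobolevClass
variable {d : ℕ}

lemma hasSum_re_fc {f g : (Fin d → ℝ) → ℝ} (hf : MemLp f 2 (μT d)) (hg : MemLp g 2 (μT d)) :
    HasSum (fun k => (fc f k * star (fc g k)).re) (∫ x, f x * g x ∂(μT d)) := by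
  have h := (((parseval hf).add (parseval hg)).sub (parseval (hf.sub hg))).mul_left (1 / 2)
  have e1 : 1 / 2 * (∫ x, f x ^ 2 ∂(μT d) + ∫ x, g x ^ 2 ∂(μT d) -
      ∫ x, (f - g) x ^ 2 ∂(μT d)) = ∫ x, f x * g x ∂(μT d) := by
    rw [← integral_add hf.integrable_sq hg.integrable_sq,
      ← integral_sub (by exact hf.integrable_sq.add hg.integrable_sq) (hf.sub hg).integrable_sq,
      ← integral_const_mul]
    congr 1; ext x; simp only [Pi.sub_apply]; ring
  rw [e1] at h
  refine h.congr_fun ?_ |> fun h => h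
  intro k
  have := fc_sub (integrable_of_memLp_two hf) (integrable_of_memLp_two hg) k
  change _ = 1 / 2 * (‖fc f k‖ ^ 2 + ‖fc g k‖ ^ 2 - ‖fc (fun x => f x - g x) k‖ ^ 2)
  rw [this, ← Complex.normSq_eq_norm_sq, ← Complex.normSq_eq_norm_sq, ← Complex.normSq_eq_norm_sq,
    Complex.normSq_sub]
  simp

lemma abs_integral_mul_pd_le {f g : (Fin d → ℝ) → ℝ} {i : Fin d}
    (hfg : ∀ φ, Test φ → ∫ x, f x * pd i φ x ∂(μT d) = -∫ x, g x * φ x ∂(μT d))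
    {G : ℝ} (hG0 : 0 ≤ G) (hG : eLpNorm g 2 (μT d) ≤ ENNReal.ofReal G)
    {φ : (Fin d → ℝ) → ℝ} (hφ : Test φ) :
    |∫ x, f x * pd i φ x ∂(μT d)| ≤ G * √(∫ x, φ x ^ 2 ∂(μT d)) := by
  rw [hfg φ hφ, abs_neg]
  by_cases hi : Integrable (fun x => g x * φ x) (μT d)
  · set w : (Fin d → ℝ) → ℝ := fun x => g x * φ x * (φ x)⁻¹ with hw
    have hwm : AEStronglyMeasurable w (μT d) :=
      hi.1.mul hφ.continuous.measurable.inv.aestronglyMeasurable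
    have hwle : eLpNorm w 2 (μT d) ≤ ENNReal.ofReal G := by
      refine (eLpNorm_mono fun x => ?_).trans hG
      by_cases h0 : φ x = 0
      · simp [hw, h0]
      · simp [hw, mul_assoc, h0]
    have hwL : MemLp w 2 (μT d) := ⟨hwm, hwle.trans_lt ENNReal.ofReal_lt_top⟩
    have e : ∀ x, g x * φ x = w x * φ x := fun x => by
      by_cases h0 : φ x = 0
      · simp [h0]
      · simp [hw, mul_assoc, h0]
    simp_rw [e]
    refine (abs_integral_mul_le hwL (hφ.memLp 2)).trans
      (mul_le_mul_of_nonneg_right ?_ (Real.sqrt_nonneg _))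
    refine Real.sqrt_le_iff.2 ⟨hG0, ?_⟩
    have := pow_le_pow_left₀ zero_le hwle 2
    rw [eLpNorm_two_sq hwL, ← ENNReal.ofReal_pow hG0] at this
    exact (ENNReal.ofReal_le_ofReal_iff (sq_nonneg _)).1 this
  · rw [integral_undef hi, abs_zero]; positivity

lemma sum_fq_sq_le {f g : (Fin d → ℝ) → ℝ} {i : Fin d} (hf : MemLp f 2 (μT d))
    (hfg : ∀ φ, Test φ → ∫ x, f x * pd i φ x ∂(μT d) = -∫ x, g x * φ x ∂(μT d))
    {G : ℝ} (hG0 : 0 ≤ G) (hG : eLpNorm g 2 (μT d) ≤ ENNReal.ofReal G)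
    (s : Finset (Fin d → ℤ)) : ∑ k ∈ s, fq i k ^ 2 * ‖fc f k‖ ^ 2 ≤ G ^ 2 := by
  have hfi := integrable_of_memLp_two hf
  have key : ∀ N, ∑ k ∈ s, fq i k ^ 2 * (mult N k * ‖fc f k‖ ^ 2) ≤ G ^ 2 := by
    intro N
    have hT := test_fej N f
    set ψ := pd i (fej N f) with hψ
    have hψT : Test ψ := hT.pd i
    have h1 : HasSum (fun k => fq i k ^ 2 * (mult N k * ‖fc f k‖ ^ 2))
        (-∫ x, f x * pd i ψ x ∂(μT d)) := by
      refine (hasSum_re_fc hf ((hψT.pd i).memLp 2)).neg.congr_fun ?_ |> fun h => h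
      intro k
      rw [fc_pd hψT, fc_pd hT, fc_fej N hfi, Complex.sq_norm, Complex.normSq_apply]
      simp
      ring
    have h2 : HasSum (fun k => fq i k ^ 2 * (mult N k ^ 2 * ‖fc f k‖ ^ 2))
        (∫ x, ψ x ^ 2 ∂(μT d)) := by
      refine (parseval (hψT.memLp 2)).congr_fun ?_ |> fun h => h
      intro k
      rw [fc_pd hT, fc_fej N hfi]
      simp only [norm_mul, Complex.norm_real, Complex.norm_I, mul_pow, Real.norm_eq_abs, sq_abs]
      ring
    set S := -∫ x, f x * pd i ψ x ∂(μT d) with hS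
    have h3 : ∫ x, ψ x ^ 2 ∂(μT d) ≤ S := hasSum_le (fun k => by
      refine mul_le_mul_of_nonneg_left (mul_le_mul_of_nonneg_right ?_ (sq_nonneg _)) (sq_nonneg _)
      exact pow_le_of_le_one (mult_nonneg N k) (mult_le_one N k) two_ne_zero) h2 h1
    have h4 : S ≤ G * √(∫ x, ψ x ^ 2 ∂(μT d)) :=
      (neg_le_abs _).trans (abs_integral_mul_pd_le hfg hG0 hG hψT)
    have hq := Real.sq_sqrt (integral_nonneg (μ := μT d) fun x => sq_nonneg (ψ x))
    set q := √(∫ x, ψ x ^ 2 ∂(μT d)) with hqd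
    have hq0 : 0 ≤ q := Real.sqrt_nonneg _
    have h5 : S ≤ G ^ 2 := by
      have : q * q ≤ G * q := by nlinarith
      rcases hq0.eq_or_lt with h | h
      · rw [← h] at h4; nlinarith
      · have := le_of_mul_le_mul_right this h
        nlinarith
    exact (sum_le_hasSum s (fun k _ => mul_nonneg (sq_nonneg _)
      (mul_nonneg (mult_nonneg N k) (sq_nonneg _))) h1).trans h5
  refine le_of_tendsto' (tendsto_finsetSum s fun k _ =>
    (((tendsto_mult k).mul_const (‖fc f k‖ ^ 2)).const_mul (fq i k ^ 2))) key |> fun h => ?_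
  simpa using h

/-- The Fourier multiplier `1 + |k|²`. -/
def jap (k : Fin d → ℤ) : ℝ := 1 + znorm k ^ 2

lemma znorm_sq (k : Fin d → ℤ) : znorm k ^ 2 = ∑ i, (k i : ℝ) ^ 2 :=
  Real.sq_sqrt (Finset.sum_nonneg fun _ _ => sq_nonneg _)

lemma one_le_jap (k : Fin d → ℤ) : 1 ≤ jap k := by
  unfold jap; nlinarith [sq_nonneg (znorm k)]

lemma jap_pos (k : Fin d → ℤ) : 0 < jap k := zero_lt_one.trans_le (one_le_jap k)

lemma sum_fq_sq (k : Fin d → ℤ) : ∑ i, fq i k ^ 2 = 4 * Real.pi ^ 2 * znorm k ^ 2 := by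
  rw [znorm_sq, Finset.mul_sum]
  exact Finset.sum_congr rfl fun i _ => by unfold fq; ring

lemma znorm_sq_le_fq (k : Fin d → ℤ) : znorm k ^ 2 ≤ ∑ i, fq i k ^ 2 := by
  rw [sum_fq_sq]
  have : 1 ≤ 4 * Real.pi ^ 2 := by nlinarith [Real.pi_gt_three]
  nlinarith [sq_nonneg (znorm k)]

lemma sobNormSq_eq (σ : ℝ) (f : (Fin d → ℝ) → ℝ) :
    sobNormSq σ f = ∑' k, ENNReal.ofReal (jap k ^ σ * ‖fc f k‖ ^ 2) := by
  unfold sobNormSq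
  refine tsum_congr fun k => ?_
  rw [ENNReal.ofReal_mul (Real.rpow_nonneg (jap_pos k).le _), ENNReal.ofReal_pow (norm_nonneg _),
    ofReal_norm]
  rfl

lemma sobNormSq_one_le {f : (Fin d → ℝ) → ℝ} (hf : InH1 f) :
    sobNormSq 1 f ≤ ENNReal.ofReal (∫ x, f x ^ 2 ∂(μT d) + gradE f) := by
  have h := (parseval hf.1).add hf.2.hasSum
  rw [sobNormSq_eq, gradE, ← h.tsum_eq, ENNReal.ofReal_tsum_of_nonneg (fun k => by positivity) h.summable]
  refine ENNReal.tsum_le_tsum fun k => ENNReal.ofReal_le_ofReal ?_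
  rw [Real.rpow_one, jap, add_mul, one_mul]
  exact add_le_add_right (mul_le_mul_of_nonneg_right (znorm_sq_le_fq k) (sq_nonneg _)) _

lemma summable_jap {f : (Fin d → ℝ) → ℝ} (h : sobNormSq 1 f < ∞) :
    Summable (fun k => jap k * ‖fc f k‖ ^ 2) ∧
      sobNormSq 1 f = ENNReal.ofReal (∑' k, jap k * ‖fc f k‖ ^ 2) := by
  rw [sobNormSq_eq] at h ⊢
  simp only [Real.rpow_one] at *
  have h0 : ∀ k : Fin d → ℤ, 0 ≤ jap k * ‖fc f k‖ ^ 2 := fun k =>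
    mul_nonneg (jap_pos k).le (sq_nonneg _)
  have hs : Summable (fun k => jap k * ‖fc f k‖ ^ 2) := by
    have := ENNReal.summable_toReal h.ne
    simpa only [ENNReal.toReal_ofReal (h0 _)] using this
  exact ⟨hs, (ENNReal.ofReal_tsum_of_nonneg h0 hs).symm⟩

lemma inH1_of_sobNormSq {f : (Fin d → ℝ) → ℝ} (hf : MemLp f 2 (μT d)) (h : sobNormSq 1 f < ∞) :
    InH1 f ∧ gradE f ≤ 4 * Real.pi ^ 2 * (sobNormSq 1 f).toReal := by
  obtain ⟨hs, he⟩ := summable_jap h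
  have h0 : ∀ k : Fin d → ℤ, 0 ≤ jap k * ‖fc f k‖ ^ 2 := fun k =>
    mul_nonneg (jap_pos k).le (sq_nonneg _)
  have hle : ∀ k, (∑ i, fq i k ^ 2) * ‖fc f k‖ ^ 2 ≤
      4 * Real.pi ^ 2 * (jap k * ‖fc f k‖ ^ 2) := fun k => by
    rw [sum_fq_sq, ← mul_assoc]
    refine mul_le_mul_of_nonneg_right (mul_le_mul_of_nonneg_left ?_ (by positivity)) (sq_nonneg _)
    unfold jap; linarith
  have hf2 := Summable.of_nonneg_of_le (fun k => mul_nonneg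
    (Finset.sum_nonneg fun i _ => sq_nonneg _) (sq_nonneg _)) hle (hs.mul_left _)
  refine ⟨⟨hf, hf2⟩, ?_⟩
  rw [he, ENNReal.toReal_ofReal (tsum_nonneg h0), ← tsum_mul_left]
  exact hf2.tsum_le_tsum hle (hs.mul_left _)

lemma sobNormSq_one_le_of_weakGrad {f : (Fin d → ℝ) → ℝ} {g : (Fin d → ℝ) → Fin d → ℝ}
    (hf : MemLp f 2 (μT d)) (hg : HasWeakGrad f g) :
    sobNormSq 1 f ≤ (1 + d) * (spLp 2 f ^ 2 + spLpV 2 g ^ 2) := by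
  by_cases ht : spLpV 2 g = ∞
  · rw [ht]
    have : ((1 : ℝ≥0∞) + d) * (spLp 2 f ^ 2 + ∞ ^ 2) = ∞ := by
      rw [ENNReal.top_pow two_ne_zero, add_top, ENNReal.mul_top (by simp)]
    rw [this]; exact le_top
  set G := (spLpV 2 g).toReal with hG
  have hG0 : 0 ≤ G := ENNReal.toReal_nonneg
  have hgi : ∀ i, eLpNorm (fun x => g x i) 2 (μT d) ≤ ENNReal.ofReal G := fun i => by
    rw [hG, ENNReal.ofReal_toReal ht]
    exact eLpNorm_mono fun x => norm_le_pi_norm (g x) i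
  have hb : ∀ (i : Fin d) s, ∑ k ∈ s, fq i k ^ 2 * ‖fc f k‖ ^ 2 ≤ G ^ 2 := fun i s =>
    sum_fq_sq_le hf (fun φ hφ => hg φ hφ i) hG0 (hgi i) s
  have hs : ∀ i : Fin d, Summable fun k => fq i k ^ 2 * ‖fc f k‖ ^ 2 := fun i =>
    summable_of_sum_le (fun k => by positivity) (hb i)
  have hsum := hasSum_sum (s := Finset.univ) fun i _ => (hs i).hasSum
  have hH : InH1 f := ⟨hf, by simpa only [Finset.sum_mul] using hsum.summable⟩
  have hE : gradE f ≤ d * G ^ 2 := by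
    unfold gradE
    simp only [Finset.sum_mul]
    rw [hsum.tsum_eq]
    refine (Finset.sum_le_sum fun i _ => (hs i).tsum_le_of_sum_le (hb i)).trans ?_
    simp
  refine (sobNormSq_one_le hH).trans ?_
  rw [ENNReal.ofReal_add (integral_nonneg fun x => sq_nonneg _) (gradE_nonneg f),
    ← eLpNorm_two_sq hf]
  have h2 : ENNReal.ofReal (gradE f) ≤ d * spLpV 2 g ^ 2 := by
    refine (ENNReal.ofReal_le_ofReal hE).trans ?_
    rw [ENNReal.ofReal_mul (by positivity), ENNReal.ofReal_pow hG0, hG, ENNReal.ofReal_toReal ht,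
      ENNReal.ofReal_natCast]
  calc eLpNorm f 2 (μT d) ^ 2 + ENNReal.ofReal (gradE f)
      ≤ (1 + d) * spLp 2 f ^ 2 + (1 + d) * spLpV 2 g ^ 2 := by
        refine add_le_add (le_mul_of_one_le_left zero_le le_self_add) (h2.trans ?_)
        exact mul_le_mul' le_add_self le_rfl
    _ = _ := by rw [mul_add]

lemma measurable_fc {F : ℝ → (Fin d → ℝ) → ℝ} (hF : Measurable (Function.uncurry F))
    (k : Fin d → ℤ) : Measurable fun s => fc (F s) k := by
  unfold fc
  refine (StronglyMeasurable.integral_prod_right (f := fun s x => (F s x : ℂ) *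
    Complex.exp (-(2 * (Real.pi : ℂ) * Complex.I) * ((∑ i, (k i : ℝ) * x i : ℝ) : ℂ)))
    (Measurable.stronglyMeasurable ?_)).measurable
  refine (Complex.measurable_ofReal.comp hF).mul ?_
  fun_prop

lemma measurable_sobNormSq {F : ℝ → (Fin d → ℝ) → ℝ} (hF : Measurable (Function.uncurry F))
    (σ : ℝ) : Measurable fun s => sobNormSq σ (F s) := by
  simp_rw [sobNormSq_eq]
  exact Measurable.tsum fun k =>
    (((measurable_fc hF k).norm.pow_const 2).const_mul _).ennreal_ofReal

end SobolevClass

section FromHypotheses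
variable {d : ℕ}

lemma measurable_spLp {G : ℝ → (Fin d → ℝ) → ℝ} (hG : Measurable (Function.uncurry G))
    (p : ℝ≥0∞) : Measurable fun s => spLp p (G s) := by
  unfold spLp
  rcases eq_or_ne p 0 with rfl | h0
  · simp
  rcases eq_or_ne p ∞ with rfl | ht
  · simp_rw [eLpNorm_exponent_top]
    refine measurable_of_Iic fun a => ?_
    have : (fun s => eLpNormEssSup (G s) (μT d)) ⁻¹' Set.Iic a =
        {s | μT d {x | a < ‖G s x‖ₑ} = 0} := by
      ext s
      have : μT d {x | a < ‖G s x‖ₑ} = 0 ↔ ∀ᵐ x ∂(μT d), ‖G s x‖ₑ ≤ a := by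
        rw [ae_iff]; simp only [not_le]
      change eLpNormEssSup (G s) (μT d) ≤ a ↔ μT d {x | a < ‖G s x‖ₑ} = 0
      rw [this]
      constructor
      · intro h
        filter_upwards [enorm_ae_le_eLpNormEssSup (G s) (μT d)] with x hx using hx.trans h
      · exact fun h => essSup_le_of_ae_le a h
    rw [this]
    have hm : MeasurableSet {p : ℝ × (Fin d → ℝ) | a < ‖G p.1 p.2‖ₑ} :=
      measurableSet_lt measurable_const hG.enorm
    exact (measurable_measure_prodMk_left (ν := μT d) hm) (measurableSet_singleton 0)
  · simp_rw [eLpNorm_eq_lintegral_rpow_enorm_toReal h0 ht]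
    refine Measurable.pow_const (Measurable.lintegral_prod_right'
      (f := fun z : ℝ × (Fin d → ℝ) => ‖G z.1 z.2‖ₑ ^ p.toReal) ?_) _
    exact hG.enorm.pow_const _

lemma sqrt_lintegral_le {T : ℝ} {K : ℝ≥0∞} {N : ℝ → ℝ≥0∞} :
    (∫⁻ t in Set.Icc 0 T, N t ^ (2 : ℝ≥0∞).toReal) ^ (1 / (2 : ℝ≥0∞).toReal) ≤ K ↔
      ∫⁻ t in Set.Ioc 0 T, N t ^ 2 ≤ K ^ 2 := by
  rw [← Measure.restrict_congr_set Ioc_ae_eq_Icc, one_div, ENNReal.rpow_inv_le_iff (by simp)]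
  simp only [ENNReal.toReal_ofNat, ENNReal.rpow_ofNat]

lemma LqLp_two_le {T : ℝ} {p K : ℝ≥0∞} {u : ℝ → (Fin d → ℝ) → ℝ} :
    LqLp T 2 p u ≤ K ↔ ∫⁻ t in Set.Ioc 0 T, spLp p (u t) ^ 2 ≤ K ^ 2 := by
  rw [LqLp, if_neg (by simp), sqrt_lintegral_le]

lemma LqLpV_two_le {T : ℝ} {p K : ℝ≥0∞} {u : ℝ → (Fin d → ℝ) → Fin d → ℝ} :
    LqLpV T 2 p u ≤ K ↔ ∫⁻ t in Set.Ioc 0 T, spLpV p (u t) ^ 2 ≤ K ^ 2 := by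
  rw [LqLpV, if_neg (by simp), sqrt_lintegral_le]

lemma LqLp_one {T : ℝ} {p : ℝ≥0∞} {u : ℝ → (Fin d → ℝ) → ℝ} :
    LqLp T 1 p u = ∫⁻ t in Set.Ioc 0 T, spLp p (u t) := by
  rw [LqLp, if_neg (by simp), ← Measure.restrict_congr_set Ioc_ae_eq_Icc]
  simp

/-- The measure of space-time. -/
def νT (d : ℕ) (T : ℝ) : Measure (ℝ × (Fin d → ℝ)) :=
  (volume.restrict (Set.Ioc 0 T)).prod (μT d)

lemma lintegral_spLp_two_sq {T : ℝ} {G : ℝ → (Fin d → ℝ) → ℝ}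
    (hG : Measurable (Function.uncurry G)) :
    ∫⁻ t in Set.Ioc 0 T, spLp 2 (G t) ^ 2 = eLpNorm (Function.uncurry G) 2 (νT d T) ^ 2 := by
  have e : ∀ {α : Type} [MeasurableSpace α] (μ : Measure α) (f : α → ℝ),
      eLpNorm f 2 μ ^ 2 = ∫⁻ x, ‖f x‖ₑ ^ 2 ∂μ := fun μ f => by
    rw [eLpNorm_eq_lintegral_rpow_enorm_toReal (by simp) (by simp), ← ENNReal.rpow_natCast,
      ← ENNReal.rpow_mul]
    simp
  simp_rw [spLp, e]
  rw [νT, lintegral_prod _ (hG.enorm.pow_const _).aemeasurable]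
  rfl

lemma memLp_uncurry {T : ℝ} {G : ℝ → (Fin d → ℝ) → ℝ}
    (hG : Measurable (Function.uncurry G)) {K : ℝ≥0∞} (hK : K < ∞)
    (h : ∫⁻ t in Set.Ioc 0 T, spLp 2 (G t) ^ 2 ≤ K ^ 2) :
    MemLp (Function.uncurry G) 2 (νT d T) := by
  rw [lintegral_spLp_two_sq hG] at h
  refine ⟨hG.aestronglyMeasurable, lt_of_le_of_lt ?_ hK⟩
  exact (ENNReal.pow_le_pow_left_iff two_ne_zero).1 h

section Square
variable {T : ℝ} {G : ℝ → (Fin d → ℝ) → ℝ} (hG : Measurable (Function.uncurry G))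
  (h2 : MemLp (Function.uncurry G) 2 (νT d T))
include hG h2

lemma ae_memLp : ∀ᵐ s ∂(volume.restrict (Set.Ioc 0 T)), MemLp (G s) 2 (μT d) := by
  filter_upwards [h2.integrable_sq.prod_right_ae] with s hs
  exact (memLp_two_iff_integrable_sq
    (hG.comp measurable_prodMk_left).aestronglyMeasurable).2 hs

omit hG in
lemma integrableOn_sq : IntegrableOn (fun s => ∫ x, G s x ^ 2 ∂(μT d)) (Set.Ioc 0 T) :=
  h2.integrable_sq.integral_prod_left

omit hG in
lemma integral_sq_eq : ∫ s in Set.Ioc 0 T, ∫ x, G s x ^ 2 ∂(μT d) =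
    ∫ z, Function.uncurry G z ^ 2 ∂(νT d T) :=
  (integral_prod _ h2.integrable_sq).symm

lemma integral_sq_le {K : ℝ≥0∞} (hK : K < ∞)
    (h : ∫⁻ t in Set.Ioc 0 T, spLp 2 (G t) ^ 2 ≤ K ^ 2) :
    ∫ s in Set.Ioc 0 T, ∫ x, G s x ^ 2 ∂(μT d) ≤ K.toReal ^ 2 := by
  rw [lintegral_spLp_two_sq hG, eLpNorm_two_sq h2] at h
  rw [integral_sq_eq h2, ← ENNReal.toReal_pow]
  exact (ENNReal.ofReal_le_iff_le_toReal (ENNReal.pow_lt_top hK).ne).1 h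

end Square

lemma integrableOn_toReal {T : ℝ} {N : ℝ → ℝ≥0∞} (hN : Measurable N) {K : ℝ≥0∞} (hK : K < ∞)
    (h : ∫⁻ t in Set.Ioc 0 T, N t ≤ K) :
    (∀ᵐ s ∂(volume.restrict (Set.Ioc 0 T)), N s < ∞) ∧
    IntegrableOn (fun s => (N s).toReal) (Set.Ioc 0 T) ∧
    ∫ s in Set.Ioc 0 T, (N s).toReal ≤ K.toReal := by
  have h1 : ∫⁻ t in Set.Ioc 0 T, N t ≠ ∞ := (h.trans_lt hK).ne
  have h2 := ae_lt_top hN h1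
  refine ⟨h2, integrable_toReal_of_lintegral_ne_top hN.aemeasurable h1, ?_⟩
  rw [integral_toReal hN.aemeasurable h2]
  exact ENNReal.toReal_mono hK.ne h

lemma abs_le_spLp_top {u : (Fin d → ℝ) → ℝ} (h : spLp ∞ u < ∞) :
    ∀ᵐ x ∂(μT d), |u x| ≤ (spLp ∞ u).toReal := by
  rw [spLp, eLpNorm_exponent_top] at *
  filter_upwards [enorm_ae_le_eLpNormEssSup u (μT d)] with x hx
  have := ENNReal.toReal_mono h.ne hx
  simpa using this

lemma integral_sq_le_of_spLp {u : (Fin d → ℝ) → ℝ} (hu : MemLp u 2 (μT d)) {K : ℝ≥0∞}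
    (hK : K < ∞) (h : spLp 2 u ≤ K) : ∫ x, u x ^ 2 ∂(μT d) ≤ K.toReal ^ 2 := by
  have := pow_le_pow_left₀ zero_le h 2
  rw [spLp, eLpNorm_two_sq hu] at this
  rw [← ENNReal.toReal_pow]
  exact (ENNReal.ofReal_le_iff_le_toReal (ENNReal.pow_lt_top hK).ne).1 this

lemma SolClassL2.memLp {T : ℝ} {f : ℝ → (Fin d → ℝ) → ℝ} (hf : SolClassL2 T f) {t : ℝ}
    (ht : t ∈ Set.Icc 0 T) : MemLp (f t) 2 (μT d) ∧
      ∫ x, f t x ^ 2 ∂(μT d) ≤ (supLp T 2 f).toReal ^ 2 := by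
  obtain ⟨hm, -, hs, -⟩ := hf
  have h1 : spLp 2 (f t) ≤ supLp T 2 f := le_iSup₂ (f := fun t _ => spLp 2 (f t)) t ht
  have h2 : MemLp (f t) 2 (μT d) :=
    ⟨(hm.comp measurable_prodMk_left).aestronglyMeasurable, h1.trans_lt hs⟩
  exact ⟨h2, integral_sq_le_of_spLp h2 hs h1⟩

lemma SolClassL2.lintegral_sob {T : ℝ} {f : ℝ → (Fin d → ℝ) → ℝ} (hf : SolClassL2 T f) :
    ∫⁻ t in Set.Ioc 0 T, sobNormSq 1 (f t) < ∞ := by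
  have hf' := hf
  obtain ⟨hm, -, hs, g, hg, hgi⟩ := hf
  rw [Measure.restrict_congr_set Ioc_ae_eq_Icc]
  have h1 : ∫⁻ t in Set.Icc 0 T, sobNormSq 1 (f t) ≤
      ∫⁻ t in Set.Icc 0 T, (1 + d) * (spLp 2 (f t) ^ 2 + spLpV 2 (g t) ^ 2) := by
    refine lintegral_mono_ae ?_
    filter_upwards [ae_restrict_mem measurableSet_Icc] with t ht
    exact sobNormSq_one_le_of_weakGrad (hf'.memLp ht).1 (hg t ht)
  rw [lintegral_const_mul' _ _ (by finiteness)] at h1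
  exact h1.trans_lt (ENNReal.mul_lt_top (by finiteness) hgi)

lemma gradE_int_of_sob {T : ℝ} {f : ℝ → (Fin d → ℝ) → ℝ} (hm : Measurable (Function.uncurry f))
    (h2 : ∀ᵐ s ∂(volume.restrict (Set.Ioc 0 T)), MemLp (f s) 2 (μT d))
    (h : ∫⁻ t in Set.Ioc 0 T, sobNormSq 1 (f t) < ∞) :
    (∀ᵐ s ∂(volume.restrict (Set.Ioc 0 T)), InH1 (f s)) ∧
      IntegrableOn (fun s => gradE (f s)) (Set.Ioc 0 T) := by
  obtain ⟨h3, h4, -⟩ := integrableOn_toReal (measurable_sobNormSq hm 1) h le_rfl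
  have h5 : ∀ᵐ s ∂(volume.restrict (Set.Ioc 0 T)), InH1 (f s) ∧
      gradE (f s) ≤ 4 * Real.pi ^ 2 * (sobNormSq 1 (f s)).toReal := by
    filter_upwards [h2, h3] with s a b using inH1_of_sobNormSq a b
  refine ⟨h5.mono fun s hs => hs.1, ?_⟩
  refine (h4.const_mul (4 * Real.pi ^ 2)).mono'
    (aestronglyMeasurable_tsum (fun k => (measurable_fc_sq hm k).const_mul _)
      (h5.mono fun s hs => hs.1.2)) (h5.mono fun s hs => ?_)
  rw [Real.norm_of_nonneg (gradE_nonneg _)]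
  exact hs.2

lemma lintegral_comp_le {T : ℝ} {K : ℝ≥0∞} {h : ℝ → (Fin d → ℝ) → Fin d → ℝ}
    (hh : LqLpV T 2 2 h ≤ K) (i : Fin d) :
    ∫⁻ t in Set.Ioc 0 T, spLp 2 (fun x => h t x i) ^ 2 ≤ K ^ 2 := by
  refine le_trans (lintegral_mono fun t => ?_) (LqLpV_two_le.1 hh)
  exact pow_le_pow_left₀ zero_le (eLpNorm_mono fun x => norm_le_pi_norm (h t x) i) 2

lemma Evol.of_hyp {T r : ℝ} (hT : 0 < T) {h : ℝ → (Fin d → ℝ) → Fin d → ℝ}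
    {D c f : ℝ → (Fin d → ℝ) → ℝ} {f0 : (Fin d → ℝ) → ℝ} (hA : AssumptionA T r h D c)
    (hf0 : MemLp f0 2 (μT d)) (hsol : IsWeakSol T h D c f0 f) (hf : SolClassL2 T f) :
    Evol T h D c f f0 (fun s => (spLp ∞ (D s)).toReal) (fun s => (spLp ∞ (c s)).toReal)
      ((supLp T 2 f).toReal ^ 2) := by
  obtain ⟨-, hhm, -, hDm, -, hcm, -, hhL, hdiv, -, hD1, -, hc1⟩ := hA
  have hfm := hf.1
  rw [LqLp_one] at hD1 hc1
  obtain ⟨D1, D2, -⟩ := integrableOn_toReal (measurable_spLp hDm ∞) hD1 le_rfl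
  obtain ⟨c1, c2, -⟩ := integrableOn_toReal (measurable_spLp hcm ∞) hc1 le_rfl
  have hh2 : ∀ i, MemLp (Function.uncurry fun s x => h s x i) 2 (νT d T) := fun i =>
    memLp_uncurry (measurable_comp_uncurry hhm i) hhL (lintegral_comp_le le_rfl i)
  have hmem : ∀ᵐ s ∂(volume.restrict (Set.Ioc 0 T)), MemLp (f s) 2 (μT d) ∧
      ∫ x, f s x ^ 2 ∂(μT d) ≤ (supLp T 2 f).toReal ^ 2 := by
    filter_upwards [ae_restrict_mem measurableSet_Ioc] with s hs
    exact hf.memLp ⟨hs.1.le, hs.2⟩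
  obtain ⟨g1, g2⟩ := gradE_int_of_sob hfm (hmem.mono fun s hs => hs.1) hf.lintegral_sob
  refine ⟨hT, hfm, hhm, hDm, hcm, hf0, ?_, fun s => ENNReal.toReal_nonneg,
    fun s => ENNReal.toReal_nonneg, D2, c2, hmem.mono fun s hs => hs.2, g2,
    fun i => integrableOn_sq (hh2 i), ?_⟩
  · filter_upwards [g1, D1, c1, ae_all_iff.2 fun i =>
      ae_memLp (measurable_comp_uncurry hhm i) (hh2 i), ae_restrict_mem measurableSet_Ioc]
      with s a1 a2 a3 a4 a5
    exact ⟨a1, a4, (hDm.comp measurable_prodMk_left).aestronglyMeasurable,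
      (hcm.comp measurable_prodMk_left).aestronglyMeasurable, abs_le_spLp_top a2,
      abs_le_spLp_top a3, hdiv s ⟨a5.1.le, a5.2⟩⟩
  · filter_upwards [ae_restrict_mem measurableSet_Ioc] with t ht φ hφ
    exact hsol φ hφ t ⟨ht.1.le, ht.2⟩

end FromHypotheses

section Uniqueness
variable {d : ℕ}

lemma integrable_mul_sum {u φ : (Fin d → ℝ) → ℝ} {h : (Fin d → ℝ) → Fin d → ℝ}
    (hφ : Test φ) (hu : MemLp u 2 (μT d)) (hh : ∀ i, MemLp (fun x => h x i) 2 (μT d)) :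
    Integrable (fun x => u x * ∑ i, h x i * pd i φ x) (μT d) := by
  simp_rw [Finset.mul_sum]
  refine integrable_finsetSum _ fun i _ => ?_
  have := hu.integrable_mul ((hφ.pd i).memLp_mul (hh i))
  refine this.congr (ae_of_all _ fun x => ?_)
  simp only [Pi.mul_apply]; ring

lemma integrable_mul_mul_test {u v φ : (Fin d → ℝ) → ℝ} (hφ : Test φ)
    (hv : MemLp v 2 (μT d)) (hu : MemLp u 2 (μT d)) :
    Integrable (fun x => v x * u x * φ x) (μT d) := by
  have := hv.integrable_mul (hφ.memLp_mul hu)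
  refine this.congr (ae_of_all _ fun x => ?_)
  simp only [Pi.mul_apply]; ring

lemma gen_sub {u v D c φ : (Fin d → ℝ) → ℝ} {h : (Fin d → ℝ) → Fin d → ℝ}
    (hu : MemLp u 2 (μT d)) (hv : MemLp v 2 (μT d)) (hh : ∀ i, MemLp (fun x => h x i) 2 (μT d))
    (hD : MemLp D 2 (μT d)) (hc : MemLp c 2 (μT d)) (hφ : Test φ) :
    gen (fun x => u x - v x) h D c φ = gen u h D c φ - gen v h D c φ := by
  unfold gen
  rw [pairT_sub (integrable_of_memLp_two hu) (integrable_of_memLp_two hv) hφ.lap]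
  have e1 := integral_sub (integrable_mul_sum hφ hu hh) (integrable_mul_sum hφ hv hh)
  have e2 := integral_sub (integrable_mul_mul_test hφ (hc.sub hD) hu)
    (integrable_mul_mul_test hφ (hc.sub hD) hv)
  simp only [Pi.sub_apply] at e2
  have e3 : ∫ x, (u x - v x) * ∑ i, h x i * pd i φ x ∂(μT d) = _ :=
    (integral_congr_ae (ae_of_all _ fun x => sub_mul _ _ _)).trans e1
  have e4 : ∫ x, (c x - D x) * (u x - v x) * φ x ∂(μT d) = _ :=
    (integral_congr_ae (ae_of_all _ fun x => by
      show (c x - D x) * (u x - v x) * φ x = (c x - D x) * u x * φ x - (c x - D x) * v x * φ x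
      ring)).trans e2
  rw [e3, e4]; ring

lemma norm_fc_sub_sq_le {u v : (Fin d → ℝ) → ℝ} (hu : Integrable u (μT d))
    (hv : Integrable v (μT d)) (k) :
    ‖fc (fun x => u x - v x) k‖ ^ 2 ≤ 2 * ‖fc u k‖ ^ 2 + 2 * ‖fc v k‖ ^ 2 := by
  rw [fc_sub hu hv]
  nlinarith [norm_sub_le (fc u k) (fc v k), norm_nonneg (fc u k - fc v k),
    sq_nonneg (‖fc u k‖ - ‖fc v k‖), norm_nonneg (fc u k), norm_nonneg (fc v k)]

lemma InH1.sub {u v : (Fin d → ℝ) → ℝ} (hu : InH1 u) (hv : InH1 v) :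
    InH1 (fun x => u x - v x) ∧
      gradE (fun x => u x - v x) ≤ 2 * gradE u + 2 * gradE v := by
  have hs := (hu.2.mul_left 2).add (hv.2.mul_left 2)
  have hle : ∀ k, (∑ i, fq i k ^ 2) * ‖fc (fun x => u x - v x) k‖ ^ 2 ≤
      2 * ((∑ i, fq i k ^ 2) * ‖fc u k‖ ^ 2) + 2 * ((∑ i, fq i k ^ 2) * ‖fc v k‖ ^ 2) := by
    intro k
    have h0 : 0 ≤ ∑ i, fq i k ^ 2 := Finset.sum_nonneg fun i _ => sq_nonneg _
    have := mul_le_mul_of_nonneg_left (norm_fc_sub_sq_le (integrable_of_memLp_two hu.1)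
      (integrable_of_memLp_two hv.1) k) h0
    linarith
  have hs' := Summable.of_nonneg_of_le (fun k => mul_nonneg
    (Finset.sum_nonneg fun i _ => sq_nonneg (fq i k)) (sq_nonneg ‖fc (fun x => u x - v x) k‖))
    hle hs
  refine ⟨⟨hu.1.sub hv.1, hs'⟩, ?_⟩
  refine (hs'.tsum_le_tsum hle hs).trans_eq ?_
  have := (hu.2.mul_left 2).tsum_add (hv.2.mul_left 2)
  rw [this, tsum_mul_left, tsum_mul_left]; rfl

lemma integral_sub_sq_le {α : Type*} {m0 : MeasurableSpace α} {μ : Measure α} {u v : α → ℝ}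
    (hu : MemLp u 2 μ) (hv : MemLp v 2 μ) :
    ∫ x, (u x - v x) ^ 2 ∂μ ≤ 2 * ∫ x, u x ^ 2 ∂μ + 2 * ∫ x, v x ^ 2 ∂μ := by
  rw [← integral_const_mul, ← integral_const_mul,
    ← integral_add (hu.integrable_sq.const_mul 2) (hv.integrable_sq.const_mul 2)]
  refine integral_mono (hu.sub hv).integrable_sq
    ((hu.integrable_sq.const_mul 2).add (hv.integrable_sq.const_mul 2)) fun x => ?_
  show (u x - v x) ^ 2 ≤ 2 * u x ^ 2 + 2 * v x ^ 2
  nlinarith [sq_nonneg (u x + v x)]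

namespace Evol
variable {T B B' : ℝ} {h : ℝ → (Fin d → ℝ) → Fin d → ℝ} {D c F G : ℝ → (Fin d → ℝ) → ℝ}
  {f0 : (Fin d → ℝ) → ℝ} {CD Cc : ℝ → ℝ}

lemma sub (E : Evol T h D c F f0 CD Cc B) (E' : Evol T h D c G f0 CD Cc B') :
    Evol T h D c (fun t x => F t x - G t x) (fun _ => 0) CD Cc (2 * B + 2 * B') where
  T_pos := E.T_pos
  F_meas := E.F_meas.sub E'.F_meas
  h_meas := E.h_meas
  D_meas := E.D_meas
  c_meas := E.c_meas
  f0_mem := memLp_const 0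
  slice := by
    filter_upwards [E.slice, E'.slice] with s S S'
    exact ⟨(S.u_mem.sub S'.u_mem).1, S.h_mem, S.D_meas, S.c_meas, S.D_bdd, S.c_bdd, S.div⟩
  CD_nonneg := E.CD_nonneg
  Cc_nonneg := E.Cc_nonneg
  CD_int := E.CD_int
  Cc_int := E.Cc_int
  F_bdd := by
    filter_upwards [E.slice, E'.slice, E.F_bdd, E'.F_bdd] with s S S' h1 h2
    have := integral_sub_sq_le S.u_mem.1 S'.u_mem.1
    linarith
  grad_int := by
    refine ((E.grad_int.const_mul 2).add (E'.grad_int.const_mul 2)).mono'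
      (aestronglyMeasurable_tsum (fun k =>
        (measurable_fc_sq (E.F_meas.sub E'.F_meas) k).const_mul _) ?_) ?_
    · filter_upwards [E.slice, E'.slice] with s S S' using (S.u_mem.sub S'.u_mem).1.2
    · filter_upwards [E.slice, E'.slice] with s S S'
      rw [Real.norm_of_nonneg (gradE_nonneg _)]
      exact (S.u_mem.sub S'.u_mem).2
  h_int := E.h_int
  eq := by
    filter_upwards [E.eq, E'.eq, E.slice, E'.slice, ae_restrict_mem measurableSet_Ioc]
      with t h1 h2 S S' ht φ hφ
    rw [pairT_sub (integrable_of_memLp_two S.u_mem.1) (integrable_of_memLp_two S'.u_mem.1) hφ,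
      h1 φ hφ, h2 φ hφ]
    have hsub := Set.Ioc_subset_Ioc_right (b := (0:ℝ)) ht.2
    have e := integral_sub ((E.gen_int hφ).mono_set hsub) ((E'.gen_int hφ).mono_set hsub)
    have e' : ∫ s in Set.Ioc 0 t, gen (fun x => F s x - G s x) (h s) (D s) (c s) φ =
        ∫ s in Set.Ioc 0 t, (gen (F s) (h s) (D s) (c s) φ - gen (G s) (h s) (D s) (c s) φ) := by
      refine integral_congr_ae ?_
      filter_upwards [ae_restrict_of_ae_restrict_of_subset hsub E.slice,
        ae_restrict_of_ae_restrict_of_subset hsub E'.slice] with s a b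
      exact gen_sub a.u_mem.1 b.u_mem.1 a.h_mem a.D_mem a.c_mem hφ
    rw [e', e]
    simp [pairT]

theorem ae_eq (E : Evol T h D c F f0 CD Cc B) (E' : Evol T h D c G f0 CD Cc B') :
    ∀ᵐ s ∂(volume.restrict (Set.Ioc 0 T)), F s =ᵐ[μT d] G s := by
  have E2 := E.sub E'
  filter_upwards [E2.slice, E2.eq, ae_restrict_mem measurableSet_Ioc] with s S he hs
  have := E2.l2_bound ⟨hs.1.le, hs.2⟩ S.u_mem.1 he
  simp only [ne_eq, OfNat.ofNat_ne_zero, not_false_eq_true, zero_pow, integral_zero, mul_zero,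
    zero_mul] at this
  have h0 := (integral_eq_zero_iff_of_nonneg (fun x => sq_nonneg _)
    S.u_mem.1.integrable_sq).1 (le_antisymm this (integral_nonneg fun x => sq_nonneg _))
  filter_upwards [h0] with x hx
  have := pow_eq_zero_iff (two_ne_zero) |>.1 hx
  linarith

end Evol
end Uniqueness

section Coefficients
variable {d : ℕ}

lemma le_of_interpolation {r S A R ε : ℝ} (hr : 0 < r) (hS : 0 ≤ S) (hA : 0 ≤ A) (hR : 0 ≤ R)
    (hSA : S ≤ A) (hI : S ^ 2 ≤ A ^ (2 - r) * R ^ r) (hε : 0 < ε) :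
    S ≤ ε * A + (ε ^ (-2 / r) + 1) * R := by
  have hη : 0 < ε ^ (2 / r) := Real.rpow_pos_of_pos hε _
  have hη' : ε ^ (-2 / r) = (ε ^ (2 / r))⁻¹ := by
    rw [← Real.rpow_neg hε.le]; congr 1; ring
  have hpos : 0 ≤ ε ^ (-2 / r) := (Real.rpow_pos_of_pos hε _).le
  rcases hA.eq_or_lt with h0 | h0
  · have : 0 ≤ (ε ^ (-2 / r) + 1) * R := by positivity
    rw [← h0]; linarith
  rcases le_or_gt R (ε ^ (2 / r) * A) with h | h
  · have h1 : R ^ r ≤ ε ^ 2 * A ^ r := by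
      refine (Real.rpow_le_rpow hR h hr.le).trans_eq ?_
      rw [Real.mul_rpow hη.le hA, ← Real.rpow_mul hε.le, div_mul_cancel₀ _ hr.ne']
      norm_cast
    have h2 : S ^ 2 ≤ (ε * A) ^ 2 := by
      calc S ^ 2 ≤ A ^ (2 - r) * R ^ r := hI
        _ ≤ A ^ (2 - r) * (ε ^ 2 * A ^ r) := mul_le_mul_of_nonneg_left h1 (by positivity)
        _ = ε ^ 2 * (A ^ (2 - r) * A ^ r) := by ring
        _ = (ε * A) ^ 2 := by
          rw [← Real.rpow_add h0, sub_add_cancel, mul_pow]; norm_cast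
    have := (pow_le_pow_iff_left₀ hS (by positivity) two_ne_zero).1 h2
    have : 0 ≤ (ε ^ (-2 / r) + 1) * R := by positivity
    linarith
  · have h1 : A ≤ ε ^ (-2 / r) * R := by
      rw [hη', inv_mul_eq_div, le_div_iff₀ hη]; linarith
    nlinarith [mul_pos hε h0]

lemma sqrt_integral_sq_eq {u : (Fin d → ℝ) → ℝ} (hu : MemLp u 2 (μT d)) :
    √(∫ x, u x ^ 2 ∂(μT d)) = (spLp 2 u).toReal := by
  have h := eLpNorm_two_sq hu
  have h0 : 0 ≤ ∫ x, u x ^ 2 ∂(μT d) := integral_nonneg fun x => sq_nonneg _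
  have h1 : (spLp 2 u).toReal ^ 2 = ∫ x, u x ^ 2 ∂(μT d) := by
    rw [spLp, ← ENNReal.toReal_pow, h, ENNReal.toReal_ofReal h0]
  rw [← h1, Real.sqrt_sq ENNReal.toReal_nonneg]

lemma sqrt_le_spLp_top {u : (Fin d → ℝ) → ℝ} (hu : AEStronglyMeasurable u (μT d))
    (hA : spLp ∞ u < ∞) : √(∫ x, u x ^ 2 ∂(μT d)) ≤ (spLp ∞ u).toReal := by
  have h2 : MemLp u 2 (μT d) := MemLp.mono_exponent ⟨hu, hA⟩ le_top
  rw [sqrt_integral_sq_eq h2]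
  exact ENNReal.toReal_mono hA.ne (eLpNorm_le_eLpNorm_of_exponent_le le_top hu)

lemma sqrt_integral_sq_le_interp {u : (Fin d → ℝ) → ℝ} (hu : AEStronglyMeasurable u (μT d))
    (hA : spLp ∞ u < ∞) {r : ℝ} (hr : 0 < r) {ε : ℝ} (hε : 0 < ε) :
    √(∫ x, u x ^ 2 ∂(μT d)) ≤ ε * (spLp ∞ u).toReal +
      (ε ^ (-2 / r) + 1) * (spLp (ENNReal.ofReal r) u).toReal := by
  have h2 : MemLp u 2 (μT d) := MemLp.mono_exponent ⟨hu, hA⟩ le_top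
  have hR : spLp (ENNReal.ofReal r) u < ∞ :=
    (eLpNorm_le_eLpNorm_of_exponent_le le_top hu).trans_lt hA
  have hp : 0 ≤ ε ^ (-2 / r) := (Real.rpow_pos_of_pos hε _).le
  rcases le_or_gt 2 r with h | h
  · rw [sqrt_integral_sq_eq h2]
    have h3 : (spLp 2 u).toReal ≤ (spLp (ENNReal.ofReal r) u).toReal := by
      refine ENNReal.toReal_mono hR.ne (eLpNorm_le_eLpNorm_of_exponent_le ?_ hu)
      rw [show (2 : ℝ≥0∞) = ENNReal.ofReal 2 by simp]
      exact ENNReal.ofReal_le_ofReal h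
    have h4 : 0 ≤ ε * (spLp ∞ u).toReal := by positivity
    have h5 : 0 ≤ ε ^ (-2 / r) * (spLp (ENNReal.ofReal r) u).toReal := by positivity
    linarith
  · refine le_of_interpolation hr (Real.sqrt_nonneg _) ENNReal.toReal_nonneg
      ENNReal.toReal_nonneg (sqrt_le_spLp_top hu hA) ?_ hε
    rw [Real.sq_sqrt (integral_nonneg fun x => sq_nonneg _), ENNReal.toReal_rpow,
      ENNReal.toReal_rpow, ← ENNReal.toReal_mul]
    have h0 : 0 ≤ ∫ x, u x ^ 2 ∂(μT d) := integral_nonneg fun x => sq_nonneg _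
    rw [← ENNReal.ofReal_le_iff_le_toReal
      (ENNReal.mul_ne_top (ENNReal.rpow_ne_top_of_nonneg (by linarith) hA.ne)
        (ENNReal.rpow_ne_top_of_nonneg hr.le hR.ne)), ← eLpNorm_two_sq h2]
    have e : ∀ {p : ℝ}, 0 < p → eLpNorm u (ENNReal.ofReal p) (μT d) ^ p =
        ∫⁻ x, ‖u x‖ₑ ^ p ∂(μT d) := fun {p} hp => by
      rw [eLpNorm_eq_lintegral_rpow_enorm_toReal (by simpa using hp) (by simp),
        ENNReal.toReal_ofReal hp.le, ← ENNReal.rpow_mul, one_div_mul_cancel hp.ne',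
        ENNReal.rpow_one]
    have e2 := e (p := 2) two_pos
    rw [show ENNReal.ofReal 2 = 2 by simp] at e2
    rw [← ENNReal.rpow_natCast, Nat.cast_ofNat, e2, spLp, spLp, e hr,
      ← lintegral_const_mul'' _ (hu.enorm.pow_const _)]
    refine lintegral_mono_ae ?_
    filter_upwards [enorm_ae_le_eLpNormEssSup u (μT d)] with x hx
    rw [eLpNorm_exponent_top]
    calc ‖u x‖ₑ ^ (2:ℝ) = ‖u x‖ₑ ^ (2 - r) * ‖u x‖ₑ ^ r := by
          rw [← ENNReal.rpow_add_of_nonneg _ _ (by linarith) hr.le, sub_add_cancel]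
      _ ≤ _ := by gcongr

variable {T r : ℝ} {K : ℝ≥0∞} {a : ℝ → (Fin d → ℝ) → ℝ}

lemma measurable_sqrt_sq (ha : Measurable (Function.uncurry a)) :
    Measurable fun s => √(∫ x, a s x ^ 2 ∂(μT d)) :=
  (measurable_integral_x (G := fun s x => a s x ^ 2) (ha.pow_const 2)).sqrt

lemma integrableOn_sqrt (hK : K < ∞) (ha : Measurable (Function.uncurry a))
    (h1 : LqLp T 1 ∞ a ≤ K) :
    IntegrableOn (fun s => √(∫ x, a s x ^ 2 ∂(μT d))) (Set.Ioc 0 T) := by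
  rw [LqLp_one] at h1
  obtain ⟨A1, A2, -⟩ := integrableOn_toReal (measurable_spLp ha ∞) hK h1
  refine A2.mono' (measurable_sqrt_sq ha).aestronglyMeasurable ?_
  filter_upwards [A1] with s hs
  rw [Real.norm_of_nonneg (Real.sqrt_nonneg _)]
  exact sqrt_le_spLp_top (ha.comp measurable_prodMk_left).aestronglyMeasurable hs

lemma integral_sqrt_mul_le (hr : 0 < r) (hK : K < ∞) (ha : Measurable (Function.uncurry a))
    (h2 : LqLp T 2 (ENNReal.ofReal r) a ≤ K) (h1 : LqLp T 1 ∞ a ≤ K) {b : ℝ → ℝ}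
    (hb : Measurable b) (hb0 : ∀ s, 0 ≤ b s) (hb1 : ∀ s, b s ≤ 1) {ε : ℝ} (hε : 0 < ε) :
    ∫ s in Set.Ioc 0 T, √(∫ x, a s x ^ 2 ∂(μT d)) * b s ≤
      ε * K.toReal + (ε ^ (-2 / r) + 1) * K.toReal * √(∫ s in Set.Ioc 0 T, b s ^ 2) := by
  have h1' := h1
  rw [LqLp_one] at h1'
  rw [LqLp_two_le] at h2
  have mR := measurable_spLp ha (ENNReal.ofReal r)
  obtain ⟨A1, A2, A3⟩ := integrableOn_toReal (measurable_spLp ha ∞) hK h1'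
  obtain ⟨R1, R2, R3⟩ := integrableOn_toReal (mR.pow_const 2) (ENNReal.pow_lt_top hK) h2
  simp only [ENNReal.toReal_pow] at R2 R3
  have hR : MemLp (fun s => (spLp (ENNReal.ofReal r) (a s)).toReal) 2
      (volume.restrict (Set.Ioc 0 T)) :=
    (memLp_two_iff_integrable_sq mR.ennreal_toReal.aestronglyMeasurable).2 R2
  have hbm : MemLp b 2 (volume.restrict (Set.Ioc 0 T)) :=
    MemLp.of_bound hb.aestronglyMeasurable 1 (ae_of_all _ fun s => by
      rw [Real.norm_of_nonneg (hb0 s)]; exact hb1 s)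
  have hC : 0 ≤ ε ^ (-2 / r) + 1 := by positivity
  have hRb : IntegrableOn (fun s => (spLp (ENNReal.ofReal r) (a s)).toReal * b s) (Set.Ioc 0 T) :=
    hR.integrable_mul hbm
  have hint := (A2.const_mul ε).add (hRb.const_mul (ε ^ (-2 / r) + 1))
  calc ∫ s in Set.Ioc 0 T, √(∫ x, a s x ^ 2 ∂(μT d)) * b s
      ≤ ∫ s in Set.Ioc 0 T, (ε * (spLp ∞ (a s)).toReal +
        (ε ^ (-2 / r) + 1) * ((spLp (ENNReal.ofReal r) (a s)).toReal * b s)) := by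
        refine integral_mono_of_nonneg
          (ae_of_all _ fun s => mul_nonneg (Real.sqrt_nonneg _) (hb0 s)) hint ?_
        filter_upwards [A1] with s hs
        have := sqrt_integral_sq_le_interp
          (ha.comp measurable_prodMk_left).aestronglyMeasurable hs hr hε
        refine (mul_le_mul_of_nonneg_right this (hb0 s)).trans ?_
        have h3 : ε * (spLp ∞ (a s)).toReal * b s ≤ ε * (spLp ∞ (a s)).toReal :=
          mul_le_of_le_one_right (by positivity) (hb1 s)
        rw [add_mul, mul_assoc (ε ^ (-2 / r) + 1)]
        exact add_le_add h3 le_rfl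
    _ = ε * (∫ s in Set.Ioc 0 T, (spLp ∞ (a s)).toReal) + (ε ^ (-2 / r) + 1) *
        ∫ s in Set.Ioc 0 T, (spLp (ENNReal.ofReal r) (a s)).toReal * b s := by
        have e := integral_add (A2.const_mul ε) (hRb.const_mul (ε ^ (-2 / r) + 1))
        rw [integral_const_mul, integral_const_mul] at e
        exact e
    _ ≤ _ := by
        refine add_le_add (mul_le_mul_of_nonneg_left A3 hε.le) ?_
        rw [mul_assoc]
        refine mul_le_mul_of_nonneg_left ?_ hC
        refine (le_abs_self _).trans ((abs_integral_mul_le hR hbm).trans ?_)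
        refine mul_le_mul_of_nonneg_right ?_ (Real.sqrt_nonneg _)
        exact Real.sqrt_le_iff.2 ⟨ENNReal.toReal_nonneg, R3⟩

end Coefficients

section WeakBounded
variable {d : ℕ}

lemma exists_periodic_rep {u : (Fin d → ℝ) → ℝ} (hu : AEStronglyMeasurable u (μT d)) :
    ∃ g : (Fin d → ℝ) → ℝ, Measurable g ∧ ZPeriodic g ∧ g =ᵐ[μT d] u := by
  refine ⟨fun x => hu.mk u fun i => Int.fract (x i),
    hu.stronglyMeasurable_mk.measurable.comp (measurable_pi_iff.2 fun i =>
      measurable_fract.comp (measurable_pi_apply i)), fun x k => ?_, ?_⟩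
  · simp only [Pi.add_apply, Int.fract_add_intCast]
  · have hb : ∀ᵐ x ∂(μT d), x ∈ box d :=
      ae_restrict_mem (MeasurableSet.univ_pi fun i => measurableSet_Ico)
    filter_upwards [hb, hu.ae_eq_mk] with x hx h
    rw [h]
    congr 1
    funext i
    exact Int.fract_eq_self.2 (hx i trivial)

lemma exists_bound_of_weak_tendsto {f : ℕ → (Fin d → ℝ) → ℝ} (hf : ∀ n, MemLp (f n) 2 (μT d))
    {L : ((Fin d → ℝ) → ℝ) → ℝ}
    (hc : ∀ g : (Fin d → ℝ) → ℝ, Measurable g → ZPeriodic g → spLp 2 g < ∞ →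
      Tendsto (fun n => ∫ x, f n x * g x ∂(μT d)) atTop (nhds (L g))) :
    ∃ A, 0 ≤ A ∧ ∀ n, ∫ x, f n x ^ 2 ∂(μT d) ≤ A := by
  obtain ⟨C, hC⟩ := banach_steinhaus (g := fun n => innerSL ℝ ((hf n).toLp)) (fun v => by
    obtain ⟨g, gm, gp, hg⟩ := exists_periodic_rep (Lp.memLp v).1
    have hg2 : spLp 2 g < ∞ := by
      rw [spLp, eLpNorm_congr_ae hg]; exact (Lp.memLp v).2
    obtain ⟨C, hC⟩ := (hc g gm gp hg2).norm.bddAbove_range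
    refine ⟨C, fun n => ?_⟩
    refine le_of_eq_of_le ?_ (hC ⟨n, rfl⟩)
    rw [innerSL_apply_apply, L2.inner_def]
    congr 1
    refine integral_congr_ae ?_
    filter_upwards [hg, (hf n).coeFn_toLp] with x h1 h2
    rw [h2, h1]
    simp [mul_comm])
  refine ⟨C ^ 2, sq_nonneg _, fun n => ?_⟩
  have h1 := hC n
  rw [innerSL_apply_norm] at h1
  have h2 := pow_le_pow_left₀ (norm_nonneg _) h1 2
  refine le_of_eq_of_le ?_ h2
  rw [Lp.norm_toLp, ← ENNReal.toReal_pow, eLpNorm_two_sq (hf n), ENNReal.toReal_ofReal]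
  exact integral_nonneg fun x => sq_nonneg _

end WeakBounded

section LowFrequencies
variable {d : ℕ}

/-- The frequencies of sup-norm at most `N`. -/
def lowFreq (d N : ℕ) : Finset (Fin d → ℤ) := Fintype.piFinset fun _ => Finset.Icc (-(N : ℤ)) N

lemma sq_le_of_notMem_lowFreq {N : ℕ} {k : Fin d → ℤ} (hk : k ∉ lowFreq d N) :
    ((N : ℝ) + 1) ^ 2 ≤ znorm k ^ 2 := by
  simp only [lowFreq, Fintype.mem_piFinset, Finset.mem_Icc, not_forall] at hk
  obtain ⟨i, hi⟩ := hk
  have h1 : (N : ℤ) + 1 ≤ |k i| := by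
    by_contra! h
    exact hi ⟨by have := neg_abs_le (k i); omega, by have := le_abs_self (k i); omega⟩
  have h2 : (N : ℝ) + 1 ≤ |(k i : ℝ)| := by exact_mod_cast h1
  rw [znorm_sq]
  calc ((N : ℝ) + 1) ^ 2 ≤ |(k i : ℝ)| ^ 2 := pow_le_pow_left₀ (by positivity) h2 2
    _ = (k i : ℝ) ^ 2 := sq_abs _
    _ ≤ _ := Finset.single_le_sum (f := fun i => (k i : ℝ) ^ 2) (fun i _ => sq_nonneg _)
      (Finset.mem_univ i)

lemma hasSum_le_low {a b : (Fin d → ℤ) → ℝ} {A B q : ℝ} {N : ℕ} (ha : HasSum a A) (hb : HasSum b B)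
    (hb0 : ∀ k, 0 ≤ b k) (hq : 0 ≤ q) (h : ∀ k, k ∉ lowFreq d N → a k ≤ q * b k) :
    A ≤ ∑ k ∈ lowFreq d N, a k + q * B := by
  classical
  have h1 : HasSum (fun k => if k ∈ lowFreq d N then a k else 0) (∑ k ∈ lowFreq d N, a k) := by
    have := hasSum_sum_of_ne_finset_zero (L := .unconditional _) (f := fun k => if k ∈ lowFreq d N then a k else 0)
      (s := lowFreq d N) (fun k hk => if_neg hk)
    rwa [Finset.sum_congr rfl fun k hk => if_pos hk] at this
  refine hasSum_le (fun k => ?_) ha (h1.add (hb.mul_left q))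
  by_cases hk : k ∈ lowFreq d N
  · simp only [hk, if_true]
    have := mul_nonneg hq (hb0 k)
    linarith
  · simpa only [hk, if_false, zero_add] using h k hk

lemma integral_sq_le_low {w : (Fin d → ℝ) → ℝ} (hw : InH1 w) (N : ℕ) :
    ∫ x, w x ^ 2 ∂(μT d) ≤
      ∑ k ∈ lowFreq d N, ‖fc w k‖ ^ 2 + (((N : ℝ) + 1) ^ 2)⁻¹ * gradE w := by
  refine hasSum_le_low (parseval hw.1) hw.2.hasSum (fun k => by positivity) (by positivity)
    fun k hk => ?_
  rw [← mul_assoc]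
  refine le_mul_of_one_le_left (sq_nonneg _) ?_
  rw [inv_mul_eq_div, one_le_div (by positivity)]
  exact (sq_le_of_notMem_lowFreq hk).trans (znorm_sq_le_fq k)

/-- Uniform regularity of a space-time function. -/
structure Reg (T : ℝ) (F : ℝ → (Fin d → ℝ) → ℝ) (B G : ℝ) : Prop where
  meas : Measurable (Function.uncurry F)
  mem : ∀ t ∈ Set.Icc 0 T, MemLp (F t) 2 (μT d)
  bdd : ∀ t ∈ Set.Icc 0 T, ∫ x, F t x ^ 2 ∂(μT d) ≤ B
  inH1 : ∀ᵐ s ∂(volume.restrict (Set.Ioc 0 T)), InH1 (F s)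
  grad_int : IntegrableOn (fun s => gradE (F s)) (Set.Ioc 0 T)
  grad_le : ∫ s in Set.Ioc 0 T, gradE (F s) ≤ G

lemma memLp_uncurry_of_bdd {T B : ℝ} {F : ℝ → (Fin d → ℝ) → ℝ}
    (hF : Measurable (Function.uncurry F))
    (h1 : ∀ᵐ s ∂(volume.restrict (Set.Ioc 0 T)), MemLp (F s) 2 (μT d))
    (h2 : ∀ᵐ s ∂(volume.restrict (Set.Ioc 0 T)), ∫ x, F s x ^ 2 ∂(μT d) ≤ B) :
    MemLp (Function.uncurry F) 2 (νT d T) := by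
  rw [memLp_two_iff_integrable_sq hF.aestronglyMeasurable, νT,
    integrable_prod_iff (hF.pow_const 2).aestronglyMeasurable]
  refine ⟨h1.mono fun s hs => hs.integrable_sq, ?_⟩
  refine Integrable.mono' (integrable_const B)
    (measurable_integral_x (G := fun s x => ‖F s x ^ 2‖) (hF.pow_const 2).norm).aestronglyMeasurable
    (h2.mono fun s hs => ?_)
  simp only [Function.uncurry_apply_pair, norm_pow, Real.norm_eq_abs, sq_abs]
  rwa [abs_of_nonneg (integral_nonneg fun x => sq_nonneg _)]

namespace Reg
variable {T B G B' G' : ℝ} {F F' : ℝ → (Fin d → ℝ) → ℝ} (R : Reg T F B G) (R' : Reg T F' B' G')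
include R

omit R in
lemma ae_mem {T : ℝ} : ∀ᵐ s ∂(volume.restrict (Set.Ioc 0 T)), s ∈ Set.Icc 0 T := by
  filter_upwards [ae_restrict_mem measurableSet_Ioc] with s hs using ⟨hs.1.le, hs.2⟩

lemma memLp : MemLp (Function.uncurry F) 2 (νT d T) :=
  memLp_uncurry_of_bdd R.meas (ae_mem.mono R.mem) (ae_mem.mono R.bdd)

include R' in
lemma l2_diff (hT : 0 ≤ T) {N : ℕ} {η : ℝ}
    (hη : ∀ t ∈ Set.Icc 0 T, ∀ k ∈ lowFreq d N, ‖fc (F t) k - fc (F' t) k‖ ≤ η) :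
    ∫ s in Set.Ioc 0 T, ∫ x, (F s x - F' s x) ^ 2 ∂(μT d) ≤
      T * ((lowFreq d N).card * η ^ 2) + (((N : ℝ) + 1) ^ 2)⁻¹ * (2 * G + 2 * G') := by
  set q := (((N : ℝ) + 1) ^ 2)⁻¹
  have hq : 0 ≤ q := by positivity
  have hint := ((R.grad_int.const_mul 2).add (R'.grad_int.const_mul 2)).const_mul q
  have hconst : IntegrableOn (fun _ : ℝ => (lowFreq d N).card * η ^ 2) (Set.Ioc 0 T) :=
    integrable_const _
  calc ∫ s in Set.Ioc 0 T, ∫ x, (F s x - F' s x) ^ 2 ∂(μT d)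
      ≤ ∫ s in Set.Ioc 0 T, ((lowFreq d N).card * η ^ 2 +
          q * (2 * gradE (F s) + 2 * gradE (F' s))) := by
        refine integral_mono_of_nonneg
          (ae_of_all _ fun s => integral_nonneg fun x => sq_nonneg _) (hconst.add hint) ?_
        filter_upwards [R.inH1, R'.inH1, ae_mem] with s h1 h2 hs
        refine (integral_sq_le_low (h1.sub h2).1 N).trans (add_le_add ?_
          (mul_le_mul_of_nonneg_left (h1.sub h2).2 hq))
        rw [← nsmul_eq_mul]
        refine Finset.sum_le_card_nsmul _ _ _ fun k hk => ?_
        rw [fc_sub (integrable_of_memLp_two h1.1) (integrable_of_memLp_two h2.1)]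
        exact pow_le_pow_left₀ (norm_nonneg _) (hη s hs k hk) 2
    _ = T * ((lowFreq d N).card * η ^ 2) + q * (2 * (∫ s in Set.Ioc 0 T, gradE (F s)) +
          2 * ∫ s in Set.Ioc 0 T, gradE (F' s)) := by
        have e := integral_add hconst hint
        have e2 := integral_add (R.grad_int.const_mul 2) (R'.grad_int.const_mul 2)
        rw [integral_const_mul, integral_const_mul] at e2
        refine e.trans ?_
        refine congrArg₂ (· + ·) ?_ ((integral_const_mul q _).trans (congrArg (q * ·) e2))
        simp [hT]
    _ ≤ _ := by
        refine add_le_add le_rfl (mul_le_mul_of_nonneg_left ?_ hq)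
        have := R.grad_le
        have := R'.grad_le
        linarith

end Reg
end LowFrequencies

section Compactness
variable {d : ℕ}

lemma exists_subseq_tendsto {ι : Type*} [Countable ι] {a : ℕ → ι → ℝ}
    (hb : ∀ i, ∃ C, ∀ n, |a n i| ≤ C) :
    ∃ σ : ℕ → ℕ, StrictMono σ ∧ ∃ l : ι → ℝ, ∀ i, Tendsto (fun n => a (σ n) i) atTop (nhds (l i)) := by
  choose C hC using hb
  obtain ⟨l, -, σ, hσ, h⟩ := (isCompact_univ_pi fun i => isCompact_Icc (a := -C i) (b := C i)).tendsto_subseq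
    (x := a) fun n i _ => abs_le.1 (hC i n)
  exact ⟨σ, hσ, l, fun i => (tendsto_pi_nhds.1 h) i⟩

/-- The points of the uniform grid of `[0,T]` with `m + 1` cells. -/
def grid (T : ℝ) (m j : ℕ) : ℝ := min (T * j / (m + 1)) T

lemma grid_mem {T : ℝ} (hT : 0 < T) (m j : ℕ) : grid T m j ∈ Set.Icc 0 T :=
  ⟨le_min (by positivity) hT.le, min_le_right _ _⟩

lemma exists_grid_near {T : ℝ} (hT : 0 < T) (m : ℕ) {t : ℝ} (ht : t ∈ Set.Icc 0 T) :
    ∃ j ∈ Finset.range (m + 2), |t - grid T m j| ≤ T / (m + 1) := by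
  have hm : (0:ℝ) < m + 1 := by positivity
  have h0 : 0 ≤ t * (m + 1) / T := div_nonneg (mul_nonneg ht.1 hm.le) hT.le
  set j := ⌊t * (m + 1) / T⌋₊
  have h1 : (j : ℝ) ≤ t * (m + 1) / T := Nat.floor_le h0
  have h2 : t * (m + 1) / T < j + 1 := Nat.lt_floor_add_one _
  rw [le_div_iff₀ hT] at h1
  rw [div_lt_iff₀ hT] at h2
  have h3 : T * j / (m + 1) ≤ t := by rw [div_le_iff₀ hm]; linarith
  refine ⟨j, ?_, ?_⟩
  · rw [Finset.mem_range]
    have : (j : ℝ) ≤ m + 1 := by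
      by_contra! h
      nlinarith [mul_lt_mul_of_pos_right h hT, mul_le_mul_of_nonneg_right ht.2 hm.le]
    have : j ≤ m + 1 := by exact_mod_cast this
    omega
  · rw [grid, min_eq_left (h3.trans ht.2), abs_of_nonneg (by linarith), sub_le_iff_le_add,
      ← add_div, le_div_iff₀ hm]
    linarith

lemma equicontinuous_cauchy {T : ℝ} (hT : 0 < T) {p : ℕ → ℝ → ℝ}
    (hE : ∀ ε > 0, ∃ δ > 0, ∀ n, ∀ s ∈ Set.Icc 0 T, ∀ t ∈ Set.Icc 0 T, |s - t| < δ →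
      |p n s - p n t| ≤ ε)
    (hc : ∀ m j, CauchySeq fun n => p n (grid T m j)) {ε : ℝ} (hε : 0 < ε) :
    ∀ᶠ q : ℕ × ℕ in atTop, ∀ t ∈ Set.Icc 0 T, |p q.1 t - p q.2 t| ≤ ε := by
  obtain ⟨δ, hδ, hE⟩ := hE (ε / 3) (by positivity)
  obtain ⟨m, hm⟩ := exists_nat_gt (T / δ)
  have hm' : T / (m + 1) < δ := by
    rw [div_lt_iff₀ hδ] at hm
    rw [div_lt_iff₀ (by positivity)]
    nlinarith
  have h1 : ∀ j ∈ Finset.range (m + 2), ∀ᶠ q : ℕ × ℕ in atTop,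
      |p q.1 (grid T m j) - p q.2 (grid T m j)| ≤ ε / 3 := fun j _ => by
    obtain ⟨N, hN⟩ := Metric.cauchySeq_iff.1 (hc m j) (ε / 3) (by positivity)
    filter_upwards [eventually_ge_atTop (N, N)] with q hq
    exact (hN q.1 hq.1 q.2 hq.2).le
  filter_upwards [(Filter.eventually_all_finset _).2 h1] with q hq t ht
  obtain ⟨j, hj, hjt⟩ := exists_grid_near hT m ht
  have a1 := hE q.1 t ht _ (grid_mem hT m j) (hjt.trans_lt hm')
  have a2 := hE q.2 t ht _ (grid_mem hT m j) (hjt.trans_lt hm')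
  have a3 := hq j hj
  rw [abs_le] at *
  constructor <;> linarith [a1.1, a1.2, a2.1, a2.2, a3.1, a3.2]

lemma norm_fc_sub_le {f g : (Fin d → ℝ) → ℝ} (hf : Integrable f (μT d)) (hg : Integrable g (μT d))
    (k : Fin d → ℤ) : ‖fc f k - fc g k‖ ≤
      |pairT f (cs k) - pairT g (cs k)| + |pairT f (sn k) - pairT g (sn k)| := by
  have : fc f k - fc g k = ((pairT f (cs k) - pairT g (cs k) : ℝ) : ℂ) -
      ((pairT f (sn k) - pairT g (sn k) : ℝ) : ℂ) * Complex.I := by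
    rw [fc_eq_pairT hf, fc_eq_pairT hg]; push_cast; ring
  rw [this]
  refine (norm_sub_le _ _).trans_eq ?_
  rw [norm_mul, Complex.norm_I, mul_one, Complex.norm_real, Complex.norm_real]; rfl

lemma exists_small (d : ℕ) {T : ℝ} (hT : 0 ≤ T) (X : ℝ) {ε : ℝ} (hε : 0 < ε) :
    ∃ (N : ℕ) (η : ℝ), 0 < η ∧
      T * ((lowFreq d N).card * η ^ 2) + (((N : ℝ) + 1) ^ 2)⁻¹ * X < ε := by
  obtain ⟨N, hN⟩ := exists_nat_gt (2 * |X| / ε)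
  have hN0 : (0:ℝ) < N + 1 := by positivity
  refine ⟨N, √(ε / (2 * (T * (lowFreq d N).card + 1))), by positivity, ?_⟩
  rw [Real.sq_sqrt (by positivity)]
  set Z := T * (lowFreq d N).card
  have hZ : 0 ≤ Z := by positivity
  have h1 : T * ((lowFreq d N).card * (ε / (2 * (Z + 1)))) ≤ ε / 2 := by
    rw [← mul_assoc, ← mul_div_assoc, div_le_div_iff₀ (by positivity) two_pos]
    change Z * ε * 2 ≤ _
    nlinarith
  have h2 : (((N : ℝ) + 1) ^ 2)⁻¹ * X < ε / 2 := by
    rw [inv_mul_eq_div, div_lt_iff₀ (by positivity)]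
    rw [div_lt_iff₀ hε] at hN
    have := le_abs_self X
    nlinarith [mul_pos hε hN0, mul_nonneg hε.le (Nat.cast_nonneg (α := ℝ) N),
      mul_nonneg (mul_nonneg hε.le (Nat.cast_nonneg (α := ℝ) N)) (Nat.cast_nonneg (α := ℝ) N)]
  linarith

lemma exists_subseq_tendsto_ae_of_integral {T : ℝ} {e : ℕ → ℝ → ℝ} (h0 : ∀ n s, 0 ≤ e n s)
    (hi : ∀ n, IntegrableOn (e n) (Set.Ioc 0 T))
    (h : Tendsto (fun n => ∫ s in Set.Ioc 0 T, e n s) atTop (nhds 0)) :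
    ∃ σ : ℕ → ℕ, StrictMono σ ∧ ∀ᵐ s ∂(volume.restrict (Set.Ioc 0 T)),
      Tendsto (fun n => e (σ n) s) atTop (nhds 0) := by
  refine (tendstoInMeasure_of_tendsto_eLpNorm (p := 1) (g := fun _ => (0 : ℝ)) one_ne_zero
    (fun n => (hi n).1) aestronglyMeasurable_const ?_).exists_seq_tendsto_ae
  have : ∀ n, eLpNorm (e n - fun _ => (0:ℝ)) 1 (volume.restrict (Set.Ioc 0 T)) =
      ENNReal.ofReal (∫ s in Set.Ioc 0 T, e n s) := fun n => by
    rw [eLpNorm_one_eq_lintegral_enorm]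
    simp only [Pi.sub_apply, sub_zero]
    rw [← ofReal_integral_norm_eq_lintegral_enorm (hi n)]
    congr 2
    funext s
    exact Real.norm_of_nonneg (h0 n s)
  simp_rw [this]
  have := (ENNReal.continuous_ofReal.tendsto 0).comp h
  rwa [ENNReal.ofReal_zero] at this

lemma abs_pairT_test_le {f φ : (Fin d → ℝ) → ℝ} {B : ℝ} (hf : MemLp f 2 (μT d)) (hφ : Test φ)
    (hB : ∫ x, f x ^ 2 ∂(μT d) ≤ B) : |pairT f φ| ≤ √B * √(∫ x, φ x ^ 2 ∂(μT d)) :=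
  (abs_integral_mul_le hf (hφ.memLp 2)).trans
    (mul_le_mul_of_nonneg_right (Real.sqrt_le_sqrt hB) (Real.sqrt_nonneg _))

/-- Equicontinuity in time, tested against smooth functions. -/
def WeakEquicont (T : ℝ) (f : ℕ → ℝ → (Fin d → ℝ) → ℝ) : Prop :=
  ∀ φ : (Fin d → ℝ) → ℝ, Test φ → ∀ ε > 0, ∃ δ > 0, ∀ n, ∀ s ∈ Set.Icc 0 T, ∀ t ∈ Set.Icc 0 T,
    |s - t| < δ → |pairT (f n s) φ - pairT (f n t) φ| ≤ ε

theorem exists_subseq_l2 {T B G : ℝ} (hT : 0 < T) {f : ℕ → ℝ → (Fin d → ℝ) → ℝ}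
    (hR : ∀ n, Reg T (f n) B G) (hE : WeakEquicont T f) :
    ∃ σ : ℕ → ℕ, StrictMono σ ∧ ∃ F : ℝ → (Fin d → ℝ) → ℝ, Measurable (Function.uncurry F) ∧
      MemLp (Function.uncurry F) 2 (νT d T) ∧
      Tendsto (fun n => ∫ s in Set.Ioc 0 T, ∫ x, (f (σ n) s x - F s x) ^ 2 ∂(μT d)) atTop (nhds 0) ∧
      ∀ᵐ s ∂(volume.restrict (Set.Ioc 0 T)),
        Tendsto (fun n => ∫ x, (f (σ n) s x - F s x) ^ 2 ∂(μT d)) atTop (nhds 0) := by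
  obtain ⟨σ, hσ, l, hl⟩ := exists_subseq_tendsto
    (ι := (Fin d → ℤ) × Bool × ℕ × ℕ)
    (a := fun n i => pairT (f n (grid T i.2.2.1 i.2.2.2)) (if i.2.1 then cs i.1 else sn i.1))
    (fun i => ⟨_, fun n => abs_pairT_test_le ((hR n).mem _ (grid_mem hT _ _))
      (by split_ifs; exacts [test_cs _, test_sn _]) ((hR n).bdd _ (grid_mem hT _ _))⟩)
  have hcs : ∀ k, ∀ ε > 0, ∀ᶠ q : ℕ × ℕ in atTop, ∀ t ∈ Set.Icc 0 T,
      |pairT (f (σ q.1) t) (cs k) - pairT (f (σ q.2) t) (cs k)| ≤ ε := fun k ε hε =>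
    equicontinuous_cauchy hT (p := fun n t => pairT (f (σ n) t) (cs k)) (fun ε hε => by
      obtain ⟨δ, hδ, h⟩ := hE _ (test_cs k) ε hε
      exact ⟨δ, hδ, fun n => h (σ n)⟩)
      (fun m j => by simpa using (hl (k, true, m, j)).cauchySeq) hε
  have hsn : ∀ k, ∀ ε > 0, ∀ᶠ q : ℕ × ℕ in atTop, ∀ t ∈ Set.Icc 0 T,
      |pairT (f (σ q.1) t) (sn k) - pairT (f (σ q.2) t) (sn k)| ≤ ε := fun k ε hε =>
    equicontinuous_cauchy hT (p := fun n t => pairT (f (σ n) t) (sn k)) (fun ε hε => by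
      obtain ⟨δ, hδ, h⟩ := hE _ (test_sn k) ε hε
      exact ⟨δ, hδ, fun n => h (σ n)⟩)
      (fun m j => by simpa using (hl (k, false, m, j)).cauchySeq) hε
  obtain ⟨g, gm, gL, gt⟩ := exists_l2_limit (μ := νT d T)
    (ψ := fun n => Function.uncurry (f (σ n))) (fun n => (hR (σ n)).memLp) (fun ε hε => by
      obtain ⟨N, η, hη, hs⟩ := exists_small d hT.le (2 * G + 2 * G) hε
      have hev : ∀ᶠ q : ℕ × ℕ in atTop, ∀ k ∈ lowFreq d N, ∀ t ∈ Set.Icc 0 T,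
          ‖fc (f (σ q.1) t) k - fc (f (σ q.2) t) k‖ ≤ η := by
        rw [Filter.eventually_all_finset]
        intro k _
        filter_upwards [hcs k (η / 2) (by positivity), hsn k (η / 2) (by positivity)]
          with q h1 h2 t ht
        refine (norm_fc_sub_le (integrable_of_memLp_two ((hR _).mem t ht))
          (integrable_of_memLp_two ((hR _).mem t ht)) k).trans ?_
        linarith [h1 t ht, h2 t ht]
      obtain ⟨⟨n0, m0⟩, h⟩ := eventually_atTop.1 hev
      refine ⟨max n0 m0, fun n hn m hm => ?_⟩
      have h3 := (hR (σ n)).l2_diff (hR (σ m)) hT.le (N := N) (η := η)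
        fun t ht k hk => h (n, m) ⟨(le_max_left _ _).trans hn, (le_max_right _ _).trans hm⟩ k hk t ht
      have h4 := integral_sq_eq (G := fun s x => f (σ n) s x - f (σ m) s x)
        ((hR (σ n)).memLp.sub (hR (σ m)).memLp)
      rw [h4] at h3
      exact h3.trans_lt hs)
  have hd : ∀ n, MemLp (Function.uncurry fun s x => f (σ n) s x - g (s, x)) 2 (νT d T) :=
    fun n => (hR (σ n)).memLp.sub gL
  have gt' : Tendsto (fun n => ∫ s in Set.Ioc 0 T, ∫ x, (f (σ n) s x - g (s, x)) ^ 2 ∂(μT d))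
      atTop (nhds 0) := by
    refine gt.congr fun n => ?_
    exact (integral_sq_eq (G := fun s x => f (σ n) s x - g (s, x)) (hd n)).symm
  obtain ⟨τ, hτ, hae⟩ := exists_subseq_tendsto_ae_of_integral
    (fun n s => integral_nonneg fun x => sq_nonneg (f (σ n) s x - g (s, x)))
    (fun n => integrableOn_sq (hd n)) gt'
  exact ⟨σ ∘ τ, hσ.comp hτ, fun s x => g (s, x), gm, gL, gt'.comp hτ.tendsto_atTop, hae⟩

end Compactness

section UniformIntegrability
variable {d : ℕ}

/-- Quantitative version of the assumptions on the coefficients. -/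
structure Coef (T r : ℝ) (K : ℝ≥0∞) (h : ℝ → (Fin d → ℝ) → Fin d → ℝ)
    (D c : ℝ → (Fin d → ℝ) → ℝ) : Prop where
  r_pos : 0 < r
  K_lt : K < ∞
  h_meas : Measurable (Function.uncurry h)
  D_meas : Measurable (Function.uncurry D)
  c_meas : Measurable (Function.uncurry c)
  h_le : LqLpV T 2 2 h ≤ K
  D_le : LqLp T 2 (ENNReal.ofReal r) D ≤ K
  D_le_one : LqLp T 1 ∞ D ≤ K
  c_le : LqLp T 2 (ENNReal.ofReal r) c ≤ K
  c_le_one : LqLp T 1 ∞ c ≤ K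

lemma ae_memLp_of_one_top {T : ℝ} {K : ℝ≥0∞} (hK : K < ∞) {a : ℝ → (Fin d → ℝ) → ℝ}
    (ha : Measurable (Function.uncurry a)) (h1 : LqLp T 1 ∞ a ≤ K) :
    ∀ᵐ s ∂(volume.restrict (Set.Ioc 0 T)), MemLp (a s) 2 (μT d) := by
  rw [LqLp_one] at h1
  filter_upwards [(integrableOn_toReal (measurable_spLp ha ∞) hK h1).1] with s hs
  exact MemLp.mono_exponent ⟨(ha.comp measurable_prodMk_left).aestronglyMeasurable, hs⟩ le_top

namespace Coef
variable {T r : ℝ} {K : ℝ≥0∞} {h : ℝ → (Fin d → ℝ) → Fin d → ℝ} {D c : ℝ → (Fin d → ℝ) → ℝ}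
  (H : Coef T r K h D c)
include H

lemma h_memLp (i : Fin d) : MemLp (Function.uncurry fun s x => h s x i) 2 (νT d T) :=
  memLp_uncurry (measurable_comp_uncurry H.h_meas i) H.K_lt (lintegral_comp_le H.h_le i)

lemma ae_slices : ∀ᵐ s ∂(volume.restrict (Set.Ioc 0 T)),
    (∀ i, MemLp (fun x => h s x i) 2 (μT d)) ∧ MemLp (D s) 2 (μT d) ∧ MemLp (c s) 2 (μT d) := by
  filter_upwards [ae_all_iff.2 fun i => ae_memLp (measurable_comp_uncurry H.h_meas i)
    (H.h_memLp i), ae_memLp_of_one_top H.K_lt H.D_meas H.D_le_one,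
    ae_memLp_of_one_top H.K_lt H.c_meas H.c_le_one] with s h1 h2 h3 using ⟨h1, h2, h3⟩

lemma integral_rate_mul_le (hT : 0 ≤ T) {b : ℝ → ℝ} (hb : Measurable b) (hb0 : ∀ s, 0 ≤ b s)
    (hb1 : ∀ s, b s ≤ 1) {ε : ℝ} (hε : 0 < ε) :
    IntegrableOn (fun s => (1 + (∑ i, √(∫ x, h s x i ^ 2 ∂(μT d))) + √(∫ x, c s x ^ 2 ∂(μT d)) +
      √(∫ x, D s x ^ 2 ∂(μT d))) * b s) (Set.Ioc 0 T) ∧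
    ∫ s in Set.Ioc 0 T, (1 + (∑ i, √(∫ x, h s x i ^ 2 ∂(μT d))) + √(∫ x, c s x ^ 2 ∂(μT d)) +
      √(∫ x, D s x ^ 2 ∂(μT d))) * b s ≤ 2 * ε * K.toReal +
      (√T + d * K.toReal + 2 * (ε ^ (-2 / r) + 1) * K.toReal) *
        √(∫ s in Set.Ioc 0 T, b s ^ 2) := by
  have hbd : ∀ {g : ℝ → ℝ}, IntegrableOn g (Set.Ioc 0 T) →
      IntegrableOn (fun s => g s * b s) (Set.Ioc 0 T) := fun hg =>
    hg.mul_bdd (c := 1) hb.aestronglyMeasurable (ae_of_all _ fun s => by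
      rw [Real.norm_of_nonneg (hb0 s)]; exact hb1 s)
  have hbm : MemLp b 2 (volume.restrict (Set.Ioc 0 T)) :=
    MemLp.of_bound hb.aestronglyMeasurable 1 (ae_of_all _ fun s => by
      rw [Real.norm_of_nonneg (hb0 s)]; exact hb1 s)
  have hhm : ∀ i, MemLp (fun s => √(∫ x, h s x i ^ 2 ∂(μT d))) 2
      (volume.restrict (Set.Ioc 0 T)) := fun i => by
    rw [memLp_two_iff_integrable_sq
      (measurable_sqrt_sq (measurable_comp_uncurry H.h_meas i)).aestronglyMeasurable]
    refine (integrableOn_sq (H.h_memLp i)).congr (ae_of_all _ fun s => ?_)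
    exact (Real.sq_sqrt (integral_nonneg fun x => sq_nonneg _)).symm
  have i1 : IntegrableOn (fun s => (1:ℝ) * b s) (Set.Ioc 0 T) := hbd (integrable_const _)
  have i2 : ∀ i, IntegrableOn (fun s => √(∫ x, h s x i ^ 2 ∂(μT d)) * b s) (Set.Ioc 0 T) :=
    fun i => (hhm i).integrable_mul hbm
  have i3 := hbd (integrableOn_sqrt H.K_lt H.c_meas H.c_le_one)
  have i4 := hbd (integrableOn_sqrt H.K_lt H.D_meas H.D_le_one)
  have i2' : IntegrableOn (fun s => ∑ i, √(∫ x, h s x i ^ 2 ∂(μT d)) * b s) (Set.Ioc 0 T) :=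
    integrable_finsetSum _ fun i _ => i2 i
  have b1 : ∫ s in Set.Ioc 0 T, 1 * b s ≤ √T * √(∫ s in Set.Ioc 0 T, b s ^ 2) := by
    refine (le_abs_self _).trans ((abs_integral_mul_le (memLp_const 1) hbm).trans_eq ?_)
    simp [hT]
  have b2 : ∀ i, ∫ s in Set.Ioc 0 T, √(∫ x, h s x i ^ 2 ∂(μT d)) * b s ≤
      K.toReal * √(∫ s in Set.Ioc 0 T, b s ^ 2) := fun i => by
    refine (le_abs_self _).trans ((abs_integral_mul_le (hhm i) hbm).trans ?_)
    refine mul_le_mul_of_nonneg_right ?_ (Real.sqrt_nonneg _)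
    refine Real.sqrt_le_iff.2 ⟨ENNReal.toReal_nonneg, ?_⟩
    refine le_of_eq_of_le (integral_congr_ae (ae_of_all _ fun s => ?_))
      (integral_sq_le (measurable_comp_uncurry H.h_meas i) (H.h_memLp i) H.K_lt
        (lintegral_comp_le H.h_le i))
    exact Real.sq_sqrt (integral_nonneg fun x => sq_nonneg _)
  have b3 := integral_sqrt_mul_le H.r_pos H.K_lt H.c_meas H.c_le H.c_le_one hb hb0 hb1 hε
  have b4 := integral_sqrt_mul_le H.r_pos H.K_lt H.D_meas H.D_le H.D_le_one hb hb0 hb1 hε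
  have e : ∀ s, (1 + (∑ i, √(∫ x, h s x i ^ 2 ∂(μT d))) + √(∫ x, c s x ^ 2 ∂(μT d)) +
      √(∫ x, D s x ^ 2 ∂(μT d))) * b s = ((1 * b s + ∑ i, √(∫ x, h s x i ^ 2 ∂(μT d)) * b s) +
      √(∫ x, c s x ^ 2 ∂(μT d)) * b s) + √(∫ x, D s x ^ 2 ∂(μT d)) * b s := fun s => by
    rw [← Finset.sum_mul]; ring
  have j1 : IntegrableOn (fun s => 1 * b s + ∑ i, √(∫ x, h s x i ^ 2 ∂(μT d)) * b s)
    (Set.Ioc 0 T) := i1.add i2'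
  have j2 : IntegrableOn (fun s => (1 * b s + ∑ i, √(∫ x, h s x i ^ 2 ∂(μT d)) * b s) +
      √(∫ x, c s x ^ 2 ∂(μT d)) * b s) (Set.Ioc 0 T) := j1.add i3
  simp_rw [e]
  refine ⟨j2.add i4, ?_⟩
  rw [integral_add j2 i4, integral_add j1 i3, integral_add i1 i2',
    integral_finsetSum _ fun i _ => i2 i]
  have b2' := Finset.sum_le_card_nsmul Finset.univ _ _ fun i _ => b2 i
  rw [Finset.card_univ, Fintype.card_fin, nsmul_eq_mul] at b2'
  linarith

end Coef

lemma exists_gen_small {T r L : ℝ} (hT : 0 ≤ T) (hL : 0 < L) (K : ℝ≥0∞) {φ : (Fin d → ℝ) → ℝ}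
    (hφ : Test φ) {ε : ℝ} (hε : 0 < ε) :
    ∃ δ > 0, ∀ (h : ℝ → (Fin d → ℝ) → Fin d → ℝ) (D c : ℝ → (Fin d → ℝ) → ℝ),
      Coef T r K h D c → ∀ w : ℝ → (Fin d → ℝ) → ℝ, Measurable (Function.uncurry w) →
      (∀ᵐ s ∂(volume.restrict (Set.Ioc 0 T)), MemLp (w s) 2 (μT d)) →
      (∀ᵐ s ∂(volume.restrict (Set.Ioc 0 T)), ∫ x, w s x ^ 2 ∂(μT d) ≤ L ^ 2) →
      ∫ s in Set.Ioc 0 T, ∫ x, w s x ^ 2 ∂(μT d) ≤ δ →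
      IntegrableOn (fun s => gen (w s) (h s) (D s) (c s) φ) (Set.Ioc 0 T) ∧
        ∫ s in Set.Ioc 0 T, |gen (w s) (h s) (D s) (c s) φ| ≤ ε := by
  obtain ⟨C, hC, h1, h2, h3⟩ := exists_test_bound hφ
  set κ := K.toReal
  have hκ : 0 ≤ κ := ENNReal.toReal_nonneg
  set ε₁ := ε / (4 * (C * L * κ + 1))
  have hε₁ : 0 < ε₁ := by positivity
  set M := √T + d * κ + 2 * (ε₁ ^ (-2 / r) + 1) * κ
  have hM : 0 ≤ M := by
    have : 0 ≤ ε₁ ^ (-2 / r) := (Real.rpow_pos_of_pos hε₁ _).le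
    positivity
  refine ⟨(ε / (2 * (C * M + 1))) ^ 2, by positivity, fun h D c H w hw w1 w2 w3 => ?_⟩
  have hms := measurable_sqrt_sq hw
  set b : ℝ → ℝ := fun s => min 1 (√(∫ x, w s x ^ 2 ∂(μT d)) / L)
  have hb : Measurable b := measurable_const.min (hms.div_const L)
  have hb0 : ∀ s, 0 ≤ b s := fun s => le_min zero_le_one (by positivity)
  have hb1 : ∀ s, b s ≤ 1 := fun s => min_le_left _ _
  obtain ⟨m1, m2⟩ := H.integral_rate_mul_le hT hb hb0 hb1 hε₁
  set m : ℝ → ℝ := fun s => 1 + (∑ i, √(∫ x, h s x i ^ 2 ∂(μT d))) + √(∫ x, c s x ^ 2 ∂(μT d)) +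
      √(∫ x, D s x ^ 2 ∂(μT d))
  have hbd : ∀ᵐ s ∂(volume.restrict (Set.Ioc 0 T)),
      |gen (w s) (h s) (D s) (c s) φ| ≤ C * L * (m s * b s) := by
    filter_upwards [w1, w2, H.ae_slices] with s a1 a2 a3
    refine (abs_gen_le a1 a3.1 a3.2.1 a3.2.2 hφ h1 h2 h3).trans_eq ?_
    have : √(∫ x, w s x ^ 2 ∂(μT d)) = L * b s := by
      have h4 : √(∫ x, w s x ^ 2 ∂(μT d)) / L ≤ 1 := by
        rw [div_le_one hL]; exact Real.sqrt_le_iff.2 ⟨hL.le, a2⟩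
      simp only [b]
      rw [min_eq_right h4, mul_div_cancel₀ _ hL.ne']
    rw [this]
    simp only [m]; ring
  have hint : IntegrableOn (fun s => gen (w s) (h s) (D s) (c s) φ) (Set.Ioc 0 T) :=
    (m1.const_mul (C * L)).mono'
      (measurable_gen hw H.h_meas H.D_meas H.c_meas hφ).aestronglyMeasurable hbd
  refine ⟨hint, ?_⟩
  have hbq : √(∫ s in Set.Ioc 0 T, b s ^ 2) ≤ ε / (2 * (C * M + 1)) / L := by
    refine Real.sqrt_le_iff.2 ⟨by positivity, ?_⟩
    have hi : IntegrableOn (fun s => ∫ x, w s x ^ 2 ∂(μT d)) (Set.Ioc 0 T) :=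
      integrableOn_sq (memLp_uncurry_of_bdd hw w1 w2)
    rw [div_pow, div_eq_mul_inv _ (L ^ 2)]
    refine le_trans ?_ (mul_le_mul_of_nonneg_right w3 (by positivity))
    rw [← integral_mul_const]
    refine integral_mono_of_nonneg (ae_of_all _ fun s => sq_nonneg _) (hi.mul_const _)
      (ae_of_all _ fun s => ?_)
    refine (pow_le_pow_left₀ (hb0 s) (min_le_right _ _) 2).trans_eq ?_
    rw [div_pow, Real.sq_sqrt (integral_nonneg fun x => sq_nonneg _), div_eq_mul_inv]
  have hCL : C * L * (2 * ε₁ * κ) ≤ ε / 2 := by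
    have e : ε₁ * (4 * (C * L * κ + 1)) = ε := div_mul_cancel₀ _ (by positivity)
    nlinarith
  have hCM : C * L * (M * (ε / (2 * (C * M + 1)) / L)) ≤ ε / 2 := by
    have e : ε / (2 * (C * M + 1)) * (2 * (C * M + 1)) = ε := div_mul_cancel₀ _ (by positivity)
    have e2 : C * L * (M * (ε / (2 * (C * M + 1)) / L)) = C * M * (ε / (2 * (C * M + 1))) := by
      field_simp
    have : 0 < ε / (2 * (C * M + 1)) := by positivity
    rw [e2]; nlinarith
  calc ∫ s in Set.Ioc 0 T, |gen (w s) (h s) (D s) (c s) φ|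
      ≤ ∫ s in Set.Ioc 0 T, C * L * (m s * b s) :=
        integral_mono_of_nonneg (ae_of_all _ fun s => abs_nonneg _) (m1.const_mul _) hbd
    _ = C * L * ∫ s in Set.Ioc 0 T, m s * b s := integral_const_mul _ _
    _ ≤ C * L * (2 * ε₁ * κ + M * (ε / (2 * (C * M + 1)) / L)) :=
        mul_le_mul_of_nonneg_left (m2.trans (add_le_add le_rfl
          (mul_le_mul_of_nonneg_left hbq hM))) (by positivity)
    _ ≤ ε := by rw [mul_add]; linarith

end UniformIntegrability

section LimitRegularity
variable {d : ℕ}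

lemma sobNormSq_le_liminf (σ : ℝ) {ψ : ℕ → (Fin d → ℝ) → ℝ} {g : (Fin d → ℝ) → ℝ}
    (hψ : ∀ n, MemLp (ψ n) 2 (μT d)) (hg : MemLp g 2 (μT d))
    (h : Tendsto (fun n => ∫ x, (ψ n x - g x) ^ 2 ∂(μT d)) atTop (nhds 0)) :
    sobNormSq σ g ≤ liminf (fun n => sobNormSq σ (ψ n)) atTop := by
  simp only [sobNormSq_eq, ← lintegral_count]
  refine le_trans (lintegral_mono fun k => ?_)
    (lintegral_liminf_le fun n => measurable_of_countable _)
  refine le_of_eq (Tendsto.liminf_eq ?_).symm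
  exact ENNReal.tendsto_ofReal ((((fc_of_tendsto_l2 hψ hg h k).norm).pow 2).const_mul _)

lemma Reg.lintegral_sob_le {T B G : ℝ} (hT : 0 ≤ T) {F : ℝ → (Fin d → ℝ) → ℝ} (R : Reg T F B G) :
    ∫⁻ s in Set.Ioc 0 T, sobNormSq 1 (F s) ≤ ENNReal.ofReal (T * B + G) := by
  have hi : IntegrableOn (fun s => ∫ x, F s x ^ 2 ∂(μT d)) (Set.Ioc 0 T) := integrableOn_sq R.memLp
  calc ∫⁻ s in Set.Ioc 0 T, sobNormSq 1 (F s)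
      ≤ ∫⁻ s in Set.Ioc 0 T, ENNReal.ofReal ((∫ x, F s x ^ 2 ∂(μT d)) + gradE (F s)) :=
        lintegral_mono_ae (R.inH1.mono fun s hs => sobNormSq_one_le hs)
    _ = ENNReal.ofReal (∫ s in Set.Ioc 0 T, ((∫ x, F s x ^ 2 ∂(μT d)) + gradE (F s))) :=
        (ofReal_integral_eq_lintegral_ofReal (hi.add R.grad_int) (ae_of_all _ fun s =>
          add_nonneg (integral_nonneg fun x => sq_nonneg _) (gradE_nonneg _))).symm
    _ ≤ _ := by
        refine ENNReal.ofReal_le_ofReal ?_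
        rw [integral_add hi R.grad_int]
        refine add_le_add ?_ R.grad_le
        calc ∫ s in Set.Ioc 0 T, ∫ x, F s x ^ 2 ∂(μT d) ≤ ∫ s in Set.Ioc 0 T, B :=
              integral_mono_ae hi (integrable_const _) (Reg.ae_mem.mono R.bdd)
          _ = T * B := by simp [hT]

lemma limit_regular {T B G : ℝ} (hT : 0 ≤ T) {f : ℕ → ℝ → (Fin d → ℝ) → ℝ}
    (hR : ∀ n, Reg T (f n) B G) {F : ℝ → (Fin d → ℝ) → ℝ} (hF : Measurable (Function.uncurry F))
    (hF2 : MemLp (Function.uncurry F) 2 (νT d T))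
    (hc : ∀ᵐ s ∂(volume.restrict (Set.Ioc 0 T)),
      Tendsto (fun n => ∫ x, (f n s x - F s x) ^ 2 ∂(μT d)) atTop (nhds 0)) :
    (∀ᵐ s ∂(volume.restrict (Set.Ioc 0 T)), ∫ x, F s x ^ 2 ∂(μT d) ≤ 2 * B) ∧
    (∀ᵐ s ∂(volume.restrict (Set.Ioc 0 T)), InH1 (F s)) ∧
      IntegrableOn (fun s => gradE (F s)) (Set.Ioc 0 T) := by
  refine ⟨?_, gradE_int_of_sob hF (ae_memLp hF hF2) ?_⟩
  · filter_upwards [ae_memLp hF hF2, hc, Reg.ae_mem] with s h1 h2 hs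
    refine le_of_tendsto_of_tendsto' tendsto_const_nhds
      ((h2.const_mul 2).const_add (2 * B)) (fun n => ?_) |>.trans_eq (by ring)
    have h3 := integral_sub_sq_le ((hR n).mem s hs) (((hR n).mem s hs).sub h1)
    simp only [Pi.sub_apply, sub_sub_cancel] at h3
    linarith [(hR n).bdd s hs]
  · refine lt_of_le_of_lt ?_ (ENNReal.ofReal_lt_top (r := T * B + G))
    calc ∫⁻ s in Set.Ioc 0 T, sobNormSq 1 (F s)
        ≤ ∫⁻ s in Set.Ioc 0 T, liminf (fun n => sobNormSq 1 (f n s)) atTop := by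
          refine lintegral_mono_ae ?_
          filter_upwards [ae_memLp hF hF2, hc, Reg.ae_mem] with s h1 h2 hs
          exact sobNormSq_le_liminf 1 (fun n => (hR n).mem s hs) h1 h2
      _ ≤ liminf (fun n => ∫⁻ s in Set.Ioc 0 T, sobNormSq 1 (f n s)) atTop :=
          lintegral_liminf_le fun n => measurable_sobNormSq (hR n).meas 1
      _ ≤ liminf (fun _ : ℕ => ENNReal.ofReal (T * B + G)) atTop :=
          liminf_le_liminf (Eventually.of_forall fun n => (hR n).lintegral_sob_le hT)
      _ = _ := by simp

end LimitRegularity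

section Equicontinuity
variable {d : ℕ}

lemma Coef.gen_integrable {T r L : ℝ} {K : ℝ≥0∞} {h : ℝ → (Fin d → ℝ) → Fin d → ℝ}
    {D c : ℝ → (Fin d → ℝ) → ℝ} (H : Coef T r K h D c) (hT : 0 ≤ T) {w : ℝ → (Fin d → ℝ) → ℝ}
    (hw : Measurable (Function.uncurry w))
    (w1 : ∀ᵐ s ∂(volume.restrict (Set.Ioc 0 T)), MemLp (w s) 2 (μT d))
    (w2 : ∀ᵐ s ∂(volume.restrict (Set.Ioc 0 T)), ∫ x, w s x ^ 2 ∂(μT d) ≤ L)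
    {φ : (Fin d → ℝ) → ℝ} (hφ : Test φ) :
    IntegrableOn (fun s => gen (w s) (h s) (D s) (c s) φ) (Set.Ioc 0 T) := by
  obtain ⟨C, hC, h1, h2, h3⟩ := exists_test_bound hφ
  obtain ⟨m1, -⟩ := H.integral_rate_mul_le hT (b := fun _ => 1) measurable_const
    (fun _ => zero_le_one) (fun _ => le_rfl) zero_lt_one
  refine (m1.const_mul (C * √L)).mono'
    (measurable_gen hw H.h_meas H.D_meas H.c_meas hφ).aestronglyMeasurable ?_
  filter_upwards [w1, w2, H.ae_slices] with s a1 a2 a3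
  refine (abs_gen_le a1 a3.1 a3.2.1 a3.2.2 hφ h1 h2 h3).trans ?_
  rw [mul_one]
  exact mul_le_mul_of_nonneg_right (mul_le_mul_of_nonneg_left (Real.sqrt_le_sqrt a2) hC)
    (by positivity)

lemma gen_zero (h : (Fin d → ℝ) → Fin d → ℝ) (D c φ : (Fin d → ℝ) → ℝ) :
    gen (fun _ => 0) h D c φ = 0 := by
  simp [gen, pairT]

/-- Restriction of a space-time function to a time interval. -/
def cutTime (s t : ℝ) (F : ℝ → (Fin d → ℝ) → ℝ) : ℝ → (Fin d → ℝ) → ℝ :=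
  (Set.Ioc s t).indicator F

lemma measurable_cutTime {F : ℝ → (Fin d → ℝ) → ℝ} (hF : Measurable (Function.uncurry F))
    (s t : ℝ) : Measurable (Function.uncurry (cutTime s t F)) := by
  have : Function.uncurry (cutTime s t F) =
      (Set.Ioc s t ×ˢ Set.univ).indicator (Function.uncurry F) := by
    ext ⟨τ, x⟩
    by_cases h : τ ∈ Set.Ioc s t
    · simp [cutTime, h]
    · simp [cutTime, h]
  rw [this]
  exact hF.indicator (measurableSet_Ioc.prod MeasurableSet.univ)

lemma cutTime_of_mem {s t τ : ℝ} {F : ℝ → (Fin d → ℝ) → ℝ} (h : τ ∈ Set.Ioc s t) :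
    cutTime s t F τ = F τ := Set.indicator_of_mem h F

lemma cutTime_of_notMem {s t τ : ℝ} {F : ℝ → (Fin d → ℝ) → ℝ} (h : τ ∉ Set.Ioc s t) :
    cutTime s t F τ = fun _ => 0 := Set.indicator_of_notMem h F

lemma integral_gen_cutTime {s t T : ℝ} (F : ℝ → (Fin d → ℝ) → ℝ) (h : ℝ → (Fin d → ℝ) → Fin d → ℝ)
    (D c : ℝ → (Fin d → ℝ) → ℝ) (φ : (Fin d → ℝ) → ℝ) (hsub : Set.Ioc s t ⊆ Set.Ioc 0 T) :
    ∫ τ in Set.Ioc 0 T, gen (cutTime s t F τ) (h τ) (D τ) (c τ) φ =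
      ∫ τ in Set.Ioc s t, gen (F τ) (h τ) (D τ) (c τ) φ := by
  rw [← Set.inter_eq_right.2 hsub, ← setIntegral_indicator measurableSet_Ioc]
  refine integral_congr_ae (ae_of_all _ fun τ => ?_)
  by_cases hm : τ ∈ Set.Ioc s t
  · simp only [cutTime_of_mem hm, Set.indicator_of_mem hm]
  · simp only [cutTime_of_notMem hm, Set.indicator_of_notMem hm, gen_zero]

lemma weakEquicont_of_sol {T r B G : ℝ} (hT : 0 ≤ T) {K : ℝ≥0∞}
    {h : ℕ → ℝ → (Fin d → ℝ) → Fin d → ℝ} {D c : ℕ → ℝ → (Fin d → ℝ) → ℝ}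
    (hC : ∀ n, Coef T r K (h n) (D n) (c n)) {f0 : ℕ → (Fin d → ℝ) → ℝ}
    {f : ℕ → ℝ → (Fin d → ℝ) → ℝ} (hsol : ∀ n, IsWeakSol T (h n) (D n) (c n) (f0 n) (f n))
    (hR : ∀ n, Reg T (f n) B G) : WeakEquicont T f := by
  intro φ hφ ε hε
  have hB : B ≤ (|B| + 1) ^ 2 := by nlinarith [le_abs_self B, abs_nonneg B]
  obtain ⟨δ, hδ, H⟩ := exists_gen_small (d := d) (T := T) (r := r) hT
    (by positivity : (0:ℝ) < |B| + 1) K hφ hε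
  have key : ∀ n, ∀ s ∈ Set.Icc 0 T, ∀ t ∈ Set.Icc 0 T, s ≤ t → t - s < δ / (|B| + 1) →
      |pairT (f n s) φ - pairT (f n t) φ| ≤ ε := by
    intro n s hs t ht hst hlt
    have hmB : ∀ᵐ τ ∂(volume.restrict (Set.Ioc 0 T)),
        ∫ x, cutTime s t (f n) τ x ^ 2 ∂(μT d) ≤ (Set.Ioc s t).indicator (fun _ => |B|) τ := by
      filter_upwards [Reg.ae_mem] with τ hτ
      by_cases hm : τ ∈ Set.Ioc s t
      · rw [cutTime_of_mem hm, Set.indicator_of_mem hm]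
        exact ((hR n).bdd τ hτ).trans (le_abs_self _)
      · rw [cutTime_of_notMem hm, Set.indicator_of_notMem hm]; simp
    have hsub : Set.Ioc s t ⊆ Set.Ioc 0 T := Set.Ioc_subset_Ioc hs.1 ht.2
    have hgi := (hC n).gen_integrable hT (hR n).meas (Reg.ae_mem.mono (hR n).mem)
      (Reg.ae_mem.mono (hR n).bdd) hφ
    obtain ⟨h1, h2⟩ := H _ _ _ (hC n) (cutTime s t (f n)) (measurable_cutTime (hR n).meas s t)
      (by
        filter_upwards [Reg.ae_mem] with τ hτ
        by_cases hm : τ ∈ Set.Ioc s t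
        · rw [cutTime_of_mem hm]; exact (hR n).mem τ hτ
        · rw [cutTime_of_notMem hm]; exact memLp_const 0)
      (hmB.mono fun τ hτ => hτ.trans <| by
        refine (Set.indicator_le_self' (fun _ _ => abs_nonneg _) τ).trans ?_
        nlinarith [abs_nonneg B])
      (by
        calc ∫ τ in Set.Ioc 0 T, ∫ x, cutTime s t (f n) τ x ^ 2 ∂(μT d)
            ≤ ∫ τ in Set.Ioc 0 T, (Set.Ioc s t).indicator (fun _ => |B|) τ :=
              integral_mono_of_nonneg (ae_of_all _ fun τ => integral_nonneg fun x => sq_nonneg _)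
                ((integrable_const _).indicator measurableSet_Ioc) hmB
          _ = |B| * (t - s) := by
              rw [setIntegral_indicator measurableSet_Ioc, Set.inter_eq_right.2 hsub]
              simp [hst, mul_comm]
          _ ≤ δ := by
              rw [lt_div_iff₀ (by positivity)] at hlt
              nlinarith)
    have e := integral_gen_cutTime (f n) (h n) (D n) (c n) φ hsub
    have e2 : pairT (f n s) φ - pairT (f n t) φ =
        -∫ τ in Set.Ioc s t, gen (f n τ) (h n τ) (D n τ) (c n τ) φ := by
      rw [hsol n φ hφ s hs, hsol n φ hφ t ht]
      have hu : Set.Ioc 0 t = Set.Ioc 0 s ∪ Set.Ioc s t :=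
        (Set.Ioc_union_Ioc_eq_Ioc hs.1 hst).symm
      have := setIntegral_union (Set.Ioc_disjoint_Ioc_of_le le_rfl) measurableSet_Ioc
        (hgi.mono_set (Set.Ioc_subset_Ioc_right hs.2)) (hgi.mono_set hsub)
      rw [← hu] at this
      simp only [gen] at this ⊢
      rw [this]; ring
    rw [e2, abs_neg, ← e]
    exact (abs_integral_le_integral_abs).trans h2
  refine ⟨δ / (|B| + 1), by positivity, fun n s hs t ht hst => ?_⟩
  rw [abs_lt] at hst
  rcases le_total s t with hle | hle
  · exact key n s hs t ht hle (by linarith)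
  · rw [abs_sub_comm]; exact key n t ht s hs hle (by linarith)

end Equicontinuity

section BoundedMultiplier
variable {d : ℕ}

/-- Weak convergence of the coefficients. -/
structure CoefConv (T r : ℝ) (h : ℕ → ℝ → (Fin d → ℝ) → Fin d → ℝ)
    (D c : ℕ → ℝ → (Fin d → ℝ) → ℝ) (hl : ℝ → (Fin d → ℝ) → Fin d → ℝ)
    (Dl cl : ℝ → (Fin d → ℝ) → ℝ) : Prop where
  h_conv : ∀ Φ : ℝ → (Fin d → ℝ) → Fin d → ℝ, Measurable (Function.uncurry Φ) →
    LqLpV T 2 2 Φ < ∞ →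
    Tendsto (fun n => ∫ t in Set.Icc (0:ℝ) T, ∫ x, (∑ i, h n t x i * Φ t x i) ∂(μT d))
      atTop (nhds (∫ t in Set.Icc (0:ℝ) T, ∫ x, (∑ i, hl t x i * Φ t x i) ∂(μT d)))
  D_conv : ∀ Φ : ℝ → (Fin d → ℝ) → ℝ, Measurable (Function.uncurry Φ) →
    LqLp T 2 (ENNReal.ofReal (conjExp r)) Φ < ∞ →
    Tendsto (fun n => ∫ t in Set.Icc (0:ℝ) T, ∫ x, D n t x * Φ t x ∂(μT d))
      atTop (nhds (∫ t in Set.Icc (0:ℝ) T, ∫ x, Dl t x * Φ t x ∂(μT d)))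
  c_conv : ∀ Φ : ℝ → (Fin d → ℝ) → ℝ, Measurable (Function.uncurry Φ) →
    LqLp T 2 (ENNReal.ofReal (conjExp r)) Φ < ∞ →
    Tendsto (fun n => ∫ t in Set.Icc (0:ℝ) T, ∫ x, c n t x * Φ t x ∂(μT d))
      atTop (nhds (∫ t in Set.Icc (0:ℝ) T, ∫ x, cl t x * Φ t x ∂(μT d)))

lemma CoefConv.comp {T r : ℝ} {h : ℕ → ℝ → (Fin d → ℝ) → Fin d → ℝ}
    {D c : ℕ → ℝ → (Fin d → ℝ) → ℝ} {hl : ℝ → (Fin d → ℝ) → Fin d → ℝ}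
    {Dl cl : ℝ → (Fin d → ℝ) → ℝ} (H : CoefConv T r h D c hl Dl cl) {σ : ℕ → ℕ}
    (hσ : Tendsto σ atTop atTop) :
    CoefConv T r (fun n => h (σ n)) (fun n => D (σ n)) (fun n => c (σ n)) hl Dl cl :=
  ⟨fun Φ h1 h2 => (H.h_conv Φ h1 h2).comp hσ, fun Φ h1 h2 => (H.D_conv Φ h1 h2).comp hσ,
    fun Φ h1 h2 => (H.c_conv Φ h1 h2).comp hσ⟩

lemma eLpNorm_le_of_bound {E : Type*} [NormedAddCommGroup E] (p : ℝ≥0∞) {u : (Fin d → ℝ) → E}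
    {M : ℝ} (h : ∀ x, ‖u x‖ ≤ M) : eLpNorm u p (μT d) ≤ ENNReal.ofReal M := by
  simpa using eLpNorm_le_of_ae_bound (p := p) (μ := μT d) (ae_of_all _ h)

lemma lintegral_sq_lt_top {T M : ℝ} {N : ℝ → ℝ≥0∞} (h : ∀ s, N s ≤ ENNReal.ofReal M) :
    ∫⁻ s in Set.Ioc 0 T, N s ^ 2 < ∞ := by
  refine (lintegral_mono fun s => pow_le_pow_left₀ zero_le (h s) 2).trans_lt ?_
  rw [lintegral_const, Measure.restrict_apply_univ, Real.volume_Ioc]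
  finiteness

lemma le_sqrt_sq (z : ℝ≥0∞) : z ≤ (z ^ (1 / 2 : ℝ)) ^ 2 := by
  rw [← ENNReal.rpow_natCast, ← ENNReal.rpow_mul]; norm_num

lemma LqLp_lt_top_of_bound {T M : ℝ} (p : ℝ≥0∞) {u : ℝ → (Fin d → ℝ) → ℝ}
    (h : ∀ s x, |u s x| ≤ M) : LqLp T 2 p u < ∞ :=
  (LqLp_two_le.2 (le_sqrt_sq _)).trans_lt (ENNReal.rpow_lt_top_of_nonneg (by norm_num)
    (lintegral_sq_lt_top fun s => eLpNorm_le_of_bound p (h s)).ne)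

lemma LqLpV_lt_top_of_bound {T M : ℝ} (p : ℝ≥0∞) {u : ℝ → (Fin d → ℝ) → Fin d → ℝ}
    (h : ∀ s x, ‖u s x‖ ≤ M) : LqLpV T 2 p u < ∞ :=
  (LqLpV_two_le.2 (le_sqrt_sq _)).trans_lt (ENNReal.rpow_lt_top_of_nonneg (by norm_num)
    (lintegral_sq_lt_top fun s => eLpNorm_le_of_bound p (h s)).ne)

lemma Coef.zero_h {T r : ℝ} {K : ℝ≥0∞} {h : ℝ → (Fin d → ℝ) → Fin d → ℝ}
    {D c : ℝ → (Fin d → ℝ) → ℝ} (H : Coef T r K h D c) :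
    Coef T r K (fun _ _ _ => 0) D c where
  r_pos := H.r_pos
  K_lt := H.K_lt
  h_meas := measurable_const
  D_meas := H.D_meas
  c_meas := H.c_meas
  h_le := LqLpV_two_le.2 (by
    have : spLpV 2 (fun (_ : Fin d → ℝ) (_ : Fin d) => (0:ℝ)) = 0 := eLpNorm_zero
    rw [this]; simp)
  D_le := H.D_le
  D_le_one := H.D_le_one
  c_le := H.c_le
  c_le_one := H.c_le_one

lemma Coef.zero_D {T r : ℝ} {K : ℝ≥0∞} {h : ℝ → (Fin d → ℝ) → Fin d → ℝ}
    {D c : ℝ → (Fin d → ℝ) → ℝ} (H : Coef T r K h D c) :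
    Coef T r K h (fun _ _ => 0) c where
  r_pos := H.r_pos
  K_lt := H.K_lt
  h_meas := H.h_meas
  D_meas := measurable_const
  c_meas := H.c_meas
  h_le := H.h_le
  D_le := LqLp_two_le.2 (by
    have : spLp (ENNReal.ofReal r) (fun (_ : Fin d → ℝ) => (0:ℝ)) = 0 := eLpNorm_zero
    simp [this])
  D_le_one := by
    have : spLp ∞ (fun (_ : Fin d → ℝ) => (0:ℝ)) = 0 := eLpNorm_zero
    simp [LqLp_one, this]
  c_le := H.c_le
  c_le_one := H.c_le_one

lemma Coef.zero_c {T r : ℝ} {K : ℝ≥0∞} {h : ℝ → (Fin d → ℝ) → Fin d → ℝ}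
    {D c : ℝ → (Fin d → ℝ) → ℝ} (H : Coef T r K h D c) :
    Coef T r K h D (fun _ _ => 0) where
  r_pos := H.r_pos
  K_lt := H.K_lt
  h_meas := H.h_meas
  D_meas := H.D_meas
  c_meas := measurable_const
  h_le := H.h_le
  D_le := H.D_le
  D_le_one := H.D_le_one
  c_le := LqLp_two_le.2 (by
    have : spLp (ENNReal.ofReal r) (fun (_ : Fin d → ℝ) => (0:ℝ)) = 0 := eLpNorm_zero
    simp [this])
  c_le_one := by
    have : spLp ∞ (fun (_ : Fin d → ℝ) => (0:ℝ)) = 0 := eLpNorm_zero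
    simp [LqLp_one, this]

lemma Coef.integral_gen_of_bdd {T r M : ℝ} {K : ℝ≥0∞} {h : ℝ → (Fin d → ℝ) → Fin d → ℝ}
    {D c : ℝ → (Fin d → ℝ) → ℝ} (H : Coef T r K h D c) (hT : 0 ≤ T) {w : ℝ → (Fin d → ℝ) → ℝ}
    (hw : Measurable (Function.uncurry w)) (hM : ∀ s x, |w s x| ≤ M)
    {φ : (Fin d → ℝ) → ℝ} (hφ : Test φ) :
    ∫ s in Set.Ioc 0 T, gen (w s) (h s) (D s) (c s) φ =
      (∫ s in Set.Ioc 0 T, pairT (w s) (lap φ)) -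
      (∫ t in Set.Icc 0 T, ∫ x, (∑ i, h t x i * (w t x * pd i φ x)) ∂(μT d)) +
      (∫ t in Set.Icc 0 T, ∫ x, c t x * (w t x * φ x) ∂(μT d)) -
      (∫ t in Set.Icc 0 T, ∫ x, D t x * (w t x * φ x) ∂(μT d)) := by
  have w1 : ∀ s, MemLp (w s) 2 (μT d) := fun s =>
    MemLp.of_bound (hw.comp measurable_prodMk_left).aestronglyMeasurable M (ae_of_all _ (hM s))
  have w2 : ∀ s, ∫ x, w s x ^ 2 ∂(μT d) ≤ M ^ 2 := fun s => by
    refine (integral_mono (w1 s).integrable_sq (integrable_const (M ^ 2)) fun x => ?_).trans_eq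
      (by simp)
    exact sq_le_sq' (by linarith [(abs_le.1 (hM s x)).1]) (abs_le.1 (hM s x)).2
  have gi := fun {h'} {D' c' : ℝ → (Fin d → ℝ) → ℝ} (H' : Coef T r K h' D' c') =>
    H'.gen_integrable hT hw (ae_of_all _ w1) (ae_of_all _ w2) hφ
  have g0 := gi H.zero_h.zero_D.zero_c
  have gh := gi H.zero_D.zero_c
  have gc := gi H.zero_h.zero_D
  have gD := gi H.zero_h.zero_c
  simp only [gen, zero_mul, mul_zero, Finset.sum_const_zero, integral_zero,
    sub_zero, add_zero, zero_sub] at g0 gh gc gD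
  have ih := g0.sub gh
  have ic := gc.sub g0
  have iD := g0.sub gD
  simp only [Pi.sub_def, sub_sub_cancel, add_sub_cancel_left, neg_mul, integral_neg, sub_add_cancel_left,
    neg_neg] at ih ic iD
  have e : ∀ᵐ s ∂(volume.restrict (Set.Ioc 0 T)), gen (w s) (h s) (D s) (c s) φ =
      pairT (w s) (lap φ) - (∫ x, w s x * (∑ i, h s x i * pd i φ x) ∂(μT d)) +
      (∫ x, c s x * w s x * φ x ∂(μT d)) - ∫ x, D s x * w s x * φ x ∂(μT d) := by
    filter_upwards [H.ae_slices] with s hs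
    have : ∫ x, (c s x - D s x) * w s x * φ x ∂(μT d) = (∫ x, c s x * w s x * φ x ∂(μT d)) -
        ∫ x, D s x * w s x * φ x ∂(μT d) := by
      rw [← integral_sub (integrable_mul_test (integrable_mul_two hs.2.2 (w1 s)) hφ)
        (integrable_mul_test (integrable_mul_two hs.2.1 (w1 s)) hφ)]
      exact integral_congr_ae (ae_of_all _ fun x => by ring)
    rw [gen, this]; ring
  rw [integral_congr_ae e, integral_Icc_eq_integral_Ioc, integral_Icc_eq_integral_Ioc,
    integral_Icc_eq_integral_Ioc]
  have e1 := integral_sub ((g0.sub ih).add ic) iD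
  have e2 := integral_add (g0.sub ih) ic
  have e3 := integral_sub g0 ih
  simp only [Pi.add_apply, Pi.sub_apply] at e1 e2
  rw [e1, e2, e3]
  simp only [mul_assoc, Finset.mul_sum, mul_left_comm]

lemma CoefConv.tendsto_of_bdd {T r M : ℝ} {K : ℝ≥0∞} (hT : 0 ≤ T)
    {h : ℕ → ℝ → (Fin d → ℝ) → Fin d → ℝ}
    {D c : ℕ → ℝ → (Fin d → ℝ) → ℝ} {hl : ℝ → (Fin d → ℝ) → Fin d → ℝ}
    {Dl cl : ℝ → (Fin d → ℝ) → ℝ} (H : CoefConv T r h D c hl Dl cl)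
    (hC : ∀ n, Coef T r K (h n) (D n) (c n)) (hCl : Coef T r K hl Dl cl)
    {w : ℝ → (Fin d → ℝ) → ℝ} (hw : Measurable (Function.uncurry w)) (hM : ∀ s x, |w s x| ≤ M)
    {φ : (Fin d → ℝ) → ℝ} (hφ : Test φ) :
    Tendsto (fun n => ∫ s in Set.Ioc 0 T, gen (w s) (h n s) (D n s) (c n s) φ) atTop
      (nhds (∫ s in Set.Ioc 0 T, gen (w s) (hl s) (Dl s) (cl s) φ)) := by
  obtain ⟨C, hC0, h1, h2, -⟩ := exists_test_bound hφ
  have hM0 : 0 ≤ M := (abs_nonneg _).trans (hM 0 0)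
  simp_rw [fun n => (hC n).integral_gen_of_bdd hT hw hM hφ, hCl.integral_gen_of_bdd hT hw hM hφ]
  have m1 : Measurable (Function.uncurry fun t x => w t x * φ x) :=
    hw.mul (measurable_snd_comp hφ)
  have b1 : LqLp T 2 (ENNReal.ofReal (conjExp r)) (fun t x => w t x * φ x) < ∞ :=
    LqLp_lt_top_of_bound (M := M * C) _ fun s x => by
      rw [abs_mul]; exact mul_le_mul (hM s x) (h1 x) (abs_nonneg _) hM0
  refine ((tendsto_const_nhds.sub (H.h_conv (fun t x i => w t x * pd i φ x) ?_ ?_)).add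
    (H.c_conv _ m1 b1)).sub (H.D_conv _ m1 b1)
  · exact measurable_pi_lambda _ fun i => hw.mul (measurable_snd_comp (hφ.pd i))
  · refine LqLpV_lt_top_of_bound (M := M * C) _ fun s x =>
      (pi_norm_le_iff_of_nonneg (by positivity)).2 fun i => ?_
    rw [Real.norm_eq_abs, abs_mul]
    exact mul_le_mul (hM s x) (h2 i x) (abs_nonneg _) hM0

end BoundedMultiplier

section LimitPassage
variable {d : ℕ}

lemma tendsto_of_approx {a : ℕ → ℝ} {a' : ℝ}
    (h : ∀ ε > 0, ∃ (b : ℕ → ℝ) (b' : ℝ), Tendsto b atTop (nhds b') ∧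
      (∀ᶠ n in atTop, |a n - b n| ≤ ε) ∧ |a' - b'| ≤ ε) : Tendsto a atTop (nhds a') := by
  refine Metric.tendsto_nhds.2 fun ε hε => ?_
  obtain ⟨b, b', h1, h2, h3⟩ := h (ε / 4) (by positivity)
  filter_upwards [h2, Metric.tendsto_nhds.1 h1 (ε / 4) (by positivity)] with n h4 h5
  rw [Real.dist_eq] at *
  rw [abs_lt] at *
  rw [abs_le] at *
  constructor <;> linarith [h4.1, h4.2, h5.1, h5.2, h3.1, h3.2]

/-- Truncation at height `M`. -/
def clamp (M z : ℝ) : ℝ := max (-M) (min M z)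

lemma continuous_clamp (M : ℝ) : Continuous (clamp M) :=
  continuous_const.max (continuous_const.min continuous_id)

lemma abs_clamp_le {M : ℝ} (hM : 0 ≤ M) (z : ℝ) : |clamp M z| ≤ M :=
  abs_le.2 ⟨le_max_left _ _, max_le (by linarith) (min_le_left _ _)⟩

lemma clamp_of_le {M z : ℝ} (h : |z| ≤ M) : clamp M z = z := by
  rw [clamp, min_eq_right (abs_le.1 h).2, max_eq_right (abs_le.1 h).1]

lemma abs_sub_clamp_le {M : ℝ} (hM : 0 ≤ M) (z : ℝ) : |z - clamp M z| ≤ |z| := by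
  rcases le_total |z| M with h | h
  · rw [clamp_of_le h]; simp
  · rcases le_total 0 z with hz | hz
    · rw [abs_of_nonneg hz] at h
      rw [clamp, min_eq_left h, max_eq_right (by linarith), abs_of_nonneg hz,
        abs_of_nonneg (by linarith)]
      linarith
    · rw [abs_of_nonpos hz] at h
      rw [clamp, min_eq_right (by linarith), max_eq_left (by linarith), abs_of_nonpos hz,
        abs_of_nonpos (by linarith)]
      linarith

lemma tendsto_sub_clamp {α : Type*} {m0 : MeasurableSpace α} {μ : Measure α} {F : α → ℝ}
    (hF : MemLp F 2 μ) :
    Tendsto (fun M : ℕ => ∫ a, (F a - clamp M (F a)) ^ 2 ∂μ) atTop (nhds 0) := by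
  have : Tendsto (fun M : ℕ => ∫ a, (F a - clamp M (F a)) ^ 2 ∂μ) atTop
      (nhds (∫ _, (0:ℝ) ∂μ)) := by
    refine tendsto_integral_of_dominated_convergence (fun a => F a ^ 2) (fun M => ?_)
      hF.integrable_sq (fun M => ae_of_all _ fun a => ?_) (ae_of_all _ fun a => ?_)
    · exact (hF.1.sub ((continuous_clamp M).comp_aestronglyMeasurable hF.1)).pow 2
    · rw [Real.norm_of_nonneg (sq_nonneg _)]
      exact sq_le_sq.2 (abs_sub_clamp_le M.cast_nonneg _)
    · obtain ⟨N, hN⟩ := exists_nat_ge |F a|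
      refine tendsto_const_nhds.congr' ?_
      filter_upwards [eventually_ge_atTop N] with M hM
      rw [clamp_of_le (hN.trans (by exact_mod_cast hM))]; simp
  simpa using this

/-- A space-time function bounded in `L^∞_t L²_x`. -/
structure BddL2 (T L : ℝ) (u : ℝ → (Fin d → ℝ) → ℝ) : Prop where
  meas : Measurable (Function.uncurry u)
  mem : ∀ᵐ s ∂(volume.restrict (Set.Ioc 0 T)), MemLp (u s) 2 (μT d)
  bdd : ∀ᵐ s ∂(volume.restrict (Set.Ioc 0 T)), ∫ x, u s x ^ 2 ∂(μT d) ≤ L ^ 2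

lemma BddL2.memLp {T L : ℝ} {u : ℝ → (Fin d → ℝ) → ℝ} (hu : BddL2 T L u) :
    MemLp (Function.uncurry u) 2 (νT d T) := memLp_uncurry_of_bdd hu.meas hu.mem hu.bdd

lemma BddL2.cutTime {T L s t : ℝ} {u : ℝ → (Fin d → ℝ) → ℝ} (hu : BddL2 T L u) :
    BddL2 T L (cutTime s t u) where
  meas := measurable_cutTime hu.meas s t
  mem := by
    filter_upwards [hu.mem] with τ hτ
    by_cases hm : τ ∈ Set.Ioc s t
    · rwa [cutTime_of_mem hm]
    · rw [cutTime_of_notMem hm]; exact memLp_const 0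
  bdd := by
    filter_upwards [hu.bdd] with τ hτ
    by_cases hm : τ ∈ Set.Ioc s t
    · rwa [cutTime_of_mem hm]
    · rw [cutTime_of_notMem hm]; simpa using sq_nonneg L

lemma BddL2.clamp {T L M : ℝ} (hM : 0 ≤ M) {u : ℝ → (Fin d → ℝ) → ℝ} (hu : BddL2 T L u) :
    BddL2 T L (fun s x => clamp M (u s x)) where
  meas := (continuous_clamp M).measurable.comp hu.meas
  mem := ae_of_all _ fun s => MemLp.of_bound ((continuous_clamp M).measurable.comp
    (hu.meas.comp measurable_prodMk_left)).aestronglyMeasurable M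
      (ae_of_all _ fun x => abs_clamp_le hM _)
  bdd := by
    filter_upwards [hu.mem, hu.bdd] with s h1 h2
    refine (integral_mono_of_nonneg (ae_of_all _ fun x => sq_nonneg _) h1.integrable_sq
      (ae_of_all _ fun x => ?_)).trans h2
    refine sq_le_sq.2 ?_
    rcases le_total |u s x| M with h | h
    · rw [clamp_of_le h]
    · exact (abs_clamp_le hM _).trans h

lemma exists_gen_sub_small {T r L : ℝ} (hT : 0 ≤ T) (hL : 0 < L) (K : ℝ≥0∞)
    {φ : (Fin d → ℝ) → ℝ} (hφ : Test φ) {ε : ℝ} (hε : 0 < ε) :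
    ∃ δ > 0, ∀ (h : ℝ → (Fin d → ℝ) → Fin d → ℝ) (D c : ℝ → (Fin d → ℝ) → ℝ),
      Coef T r K h D c → ∀ u v : ℝ → (Fin d → ℝ) → ℝ, BddL2 T L u → BddL2 T L v →
      ∫ s in Set.Ioc 0 T, ∫ x, (u s x - v s x) ^ 2 ∂(μT d) ≤ δ →
      |(∫ s in Set.Ioc 0 T, gen (u s) (h s) (D s) (c s) φ) -
        ∫ s in Set.Ioc 0 T, gen (v s) (h s) (D s) (c s) φ| ≤ ε := by
  obtain ⟨δ, hδ, H⟩ := exists_gen_small (d := d) (T := T) (r := r) (L := 2 * L) hT (by positivity)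
    K hφ hε
  refine ⟨δ, hδ, fun h D c hC u v hu hv huv => ?_⟩
  obtain ⟨-, h1⟩ := H h D c hC (fun s x => u s x - v s x) (hu.meas.sub hv.meas)
    (by filter_upwards [hu.mem, hv.mem] with s a b using a.sub b)
    (by
      filter_upwards [hu.mem, hv.mem, hu.bdd, hv.bdd] with s a b a' b'
      refine (integral_sub_sq_le a b).trans ?_
      nlinarith) huv
  rw [← integral_sub (hC.gen_integrable hT hu.meas hu.mem hu.bdd hφ)
    (hC.gen_integrable hT hv.meas hv.mem hv.bdd hφ)]
  refine le_trans (le_of_eq ?_) (abs_integral_le_integral_abs.trans h1)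
  congr 1
  refine integral_congr_ae ?_
  filter_upwards [hu.mem, hv.mem, hC.ae_slices] with s a b hs
  exact (gen_sub a b hs.1 hs.2.1 hs.2.2 hφ).symm

lemma CoefConv.tendsto_gen {T r L : ℝ} {K : ℝ≥0∞} (hT : 0 ≤ T) (hL : 0 < L)
    {h : ℕ → ℝ → (Fin d → ℝ) → Fin d → ℝ}
    {D c : ℕ → ℝ → (Fin d → ℝ) → ℝ} {hl : ℝ → (Fin d → ℝ) → Fin d → ℝ}
    {Dl cl : ℝ → (Fin d → ℝ) → ℝ} (H : CoefConv T r h D c hl Dl cl)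
    (hC : ∀ n, Coef T r K (h n) (D n) (c n)) (hCl : Coef T r K hl Dl cl)
    {f : ℕ → ℝ → (Fin d → ℝ) → ℝ} {F : ℝ → (Fin d → ℝ) → ℝ} (hf : ∀ n, BddL2 T L (f n))
    (hF : BddL2 T L F)
    (hfF : Tendsto (fun n => ∫ s in Set.Ioc 0 T, ∫ x, (f n s x - F s x) ^ 2 ∂(μT d)) atTop (nhds 0))
    {φ : (Fin d → ℝ) → ℝ} (hφ : Test φ) :
    Tendsto (fun n => ∫ s in Set.Ioc 0 T, gen (f n s) (h n s) (D n s) (c n s) φ) atTop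
      (nhds (∫ s in Set.Ioc 0 T, gen (F s) (hl s) (Dl s) (cl s) φ)) := by
  refine tendsto_of_approx fun ε hε => ?_
  obtain ⟨δ, hδ, hs⟩ := exists_gen_sub_small (d := d) (T := T) (r := r) (L := L) hT hL K hφ
    (half_pos hε)
  have hcl := tendsto_sub_clamp hF.memLp
  obtain ⟨M, hM⟩ := ((tendsto_order.1 hcl).2 δ hδ).exists
  have hFM := hF.clamp (M := M) M.cast_nonneg
  have hd : ∫ s in Set.Ioc 0 T, ∫ x, (F s x - clamp M (F s x)) ^ 2 ∂(μT d) ≤ δ := by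
    have := integral_sq_eq (G := fun s x => F s x - clamp M (F s x)) (hF.memLp.sub hFM.memLp)
    rw [this]; exact hM.le
  refine ⟨_, _, H.tendsto_of_bdd hT hC hCl hFM.meas (fun s x => abs_clamp_le M.cast_nonneg _) hφ,
    ?_, ?_⟩
  · filter_upwards [(tendsto_order.1 hfF).2 δ hδ] with n hn
    have h1 := hs _ _ _ (hC n) _ _ (hf n) hF hn.le
    have h2 := hs _ _ _ (hC n) _ _ hF hFM hd
    rw [abs_le] at *
    constructor <;> linarith [h1.1, h1.2, h2.1, h2.2]
  · exact (hs _ _ _ hCl _ _ hF hFM hd).trans (by linarith)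

lemma CoefConv.tendsto_gen_Ioc {T r L t : ℝ} {K : ℝ≥0∞} (ht : t ∈ Set.Icc 0 T) (hL : 0 < L)
    {h : ℕ → ℝ → (Fin d → ℝ) → Fin d → ℝ}
    {D c : ℕ → ℝ → (Fin d → ℝ) → ℝ} {hl : ℝ → (Fin d → ℝ) → Fin d → ℝ}
    {Dl cl : ℝ → (Fin d → ℝ) → ℝ} (H : CoefConv T r h D c hl Dl cl)
    (hC : ∀ n, Coef T r K (h n) (D n) (c n)) (hCl : Coef T r K hl Dl cl)
    {f : ℕ → ℝ → (Fin d → ℝ) → ℝ} {F : ℝ → (Fin d → ℝ) → ℝ} (hf : ∀ n, BddL2 T L (f n))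
    (hF : BddL2 T L F)
    (hfF : Tendsto (fun n => ∫ s in Set.Ioc 0 T, ∫ x, (f n s x - F s x) ^ 2 ∂(μT d)) atTop (nhds 0))
    {φ : (Fin d → ℝ) → ℝ} (hφ : Test φ) :
    Tendsto (fun n => ∫ s in Set.Ioc 0 t, gen (f n s) (h n s) (D n s) (c n s) φ) atTop
      (nhds (∫ s in Set.Ioc 0 t, gen (F s) (hl s) (Dl s) (cl s) φ)) := by
  have hsub : Set.Ioc 0 t ⊆ Set.Ioc 0 T := Set.Ioc_subset_Ioc_right ht.2
  simp_rw [← integral_gen_cutTime _ _ _ _ _ hsub]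
  refine H.tendsto_gen (ht.1.trans ht.2) hL hC hCl (fun n => (hf n).cutTime) hF.cutTime ?_ hφ
  refine squeeze_zero (fun n => integral_nonneg fun s => integral_nonneg fun x => sq_nonneg _)
    (fun n => ?_) hfF
  refine integral_mono_of_nonneg (ae_of_all _ fun s => integral_nonneg fun x => sq_nonneg _)
    (integrableOn_sq (G := fun s x => f n s x - F s x) ((hf n).memLp.sub hF.memLp))
    (ae_of_all _ fun s => ?_)
  by_cases hm : s ∈ Set.Ioc 0 t
  · simp only [cutTime_of_mem hm, le_refl]
  · simp only [cutTime_of_notMem hm, sub_zero]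
    simpa using integral_nonneg (μ := μT d) fun x => sq_nonneg (f n s x - F s x)

end LimitPassage

section Identification
variable {d : ℕ}

lemma Coef.of_assumption {T r : ℝ} {K : ℝ≥0∞} (hK : K < ∞) {h : ℝ → (Fin d → ℝ) → Fin d → ℝ}
    {D c : ℝ → (Fin d → ℝ) → ℝ} (hA : AssumptionA T r h D c) (h1 : LqLpV T 2 2 h ≤ K)
    (h2 : LqLp T 2 (ENNReal.ofReal r) D ≤ K) (h3 : LqLp T 1 ∞ D ≤ K)
    (h4 : LqLp T 2 (ENNReal.ofReal r) c ≤ K) (h5 : LqLp T 1 ∞ c ≤ K) : Coef T r K h D c := by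
  obtain ⟨hr, hh, -, hD, -, hc, -⟩ := hA
  exact ⟨lt_of_le_of_lt (by positivity) hr, hK, hh, hD, hc, h1, h2, h3, h4, h5⟩

lemma Reg.of_sol {T r A : ℝ} (hT : 0 < T) {K : ℝ≥0∞} {h : ℝ → (Fin d → ℝ) → Fin d → ℝ}
    {D c f : ℝ → (Fin d → ℝ) → ℝ} {f0 : (Fin d → ℝ) → ℝ} (hA : AssumptionA T r h D c)
    (hC : Coef T r K h D c) (hf0 : MemLp f0 2 (μT d)) (hf0A : ∫ x, f0 x ^ 2 ∂(μT d) ≤ A)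
    (hsol : IsWeakSol T h D c f0 f) (hf : SolClassL2 T f) :
    Reg T f (2 * A * Real.exp (2 * (3 * K.toReal)))
      (A + 3 * K.toReal * (2 * A * Real.exp (2 * (3 * K.toReal)))) := by
  have E := Evol.of_hyp hT hA hf0 hsol hf
  have hA0 : 0 ≤ A := (integral_nonneg fun x => sq_nonneg _).trans hf0A
  set Λ := ∫ s in (0:ℝ)..T, (spLp ∞ (D s)).toReal + 2 * (spLp ∞ (c s)).toReal with hΛ
  have hΛ0 : 0 ≤ Λ := intervalIntegral.integral_nonneg hT.le fun s _ => by positivity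
  have hΛK : Λ ≤ 3 * K.toReal := by
    obtain ⟨-, -, b1⟩ := integrableOn_toReal (measurable_spLp hC.D_meas ∞) hC.K_lt
      (by have := hC.D_le_one; rwa [LqLp_one] at this)
    obtain ⟨-, -, b2⟩ := integrableOn_toReal (measurable_spLp hC.c_meas ∞) hC.K_lt
      (by have := hC.c_le_one; rwa [LqLp_one] at this)
    have e := integral_add E.CD_int (E.Cc_int.const_mul 2)
    rw [integral_const_mul] at e
    rw [hΛ, intervalIntegral.integral_of_le hT.le]
    refine e.trans_le ?_
    linarith
  have hexp : 2 * (∫ x, f0 x ^ 2 ∂(μT d)) * Real.exp (2 * Λ) ≤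
      2 * A * Real.exp (2 * (3 * K.toReal)) := by gcongr
  refine ⟨hf.1, fun t ht => (hf.memLp ht).1, fun t ht => ?_, E.slice.mono fun s S => S.u_mem,
    E.grad_int, ?_⟩
  · exact (E.l2_bound ht (hf.memLp ht).1 fun φ hφ => hsol φ hφ t ht).trans hexp
  · refine (E.grad_bound hΛ).trans (add_le_add hf0A ?_)
    exact mul_le_mul hΛK hexp (by positivity) (by positivity)

lemma gen_congr {u v : (Fin d → ℝ) → ℝ} (huv : u =ᵐ[μT d] v) (h : (Fin d → ℝ) → Fin d → ℝ)
    (D c φ : (Fin d → ℝ) → ℝ) : gen u h D c φ = gen v h D c φ := by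
  have h1 : pairT u (lap φ) = pairT v (lap φ) :=
    integral_congr_ae (huv.mono fun x hx => by simp only [hx])
  have h2 : ∫ x, u x * (∑ i, h x i * pd i φ x) ∂(μT d) =
      ∫ x, v x * (∑ i, h x i * pd i φ x) ∂(μT d) :=
    integral_congr_ae (huv.mono fun x hx => by simp only [hx])
  have h3 : ∫ x, (c x - D x) * u x * φ x ∂(μT d) = ∫ x, (c x - D x) * v x * φ x ∂(μT d) :=
    integral_congr_ae (huv.mono fun x hx => by simp only [hx])
  rw [gen, gen, h1, h2, h3]

lemma tendsto_pairT_of_l2 {ψ : ℕ → (Fin d → ℝ) → ℝ} {g φ : (Fin d → ℝ) → ℝ} (hφ : Test φ)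
    (hψ : ∀ n, MemLp (ψ n) 2 (μT d)) (hg : MemLp g 2 (μT d))
    (h : Tendsto (fun n => ∫ x, (ψ n x - g x) ^ 2 ∂(μT d)) atTop (nhds 0)) :
    Tendsto (fun n => pairT (ψ n) φ) atTop (nhds (pairT g φ)) := by
  rw [tendsto_iff_norm_sub_tendsto_zero]
  have h1 : Tendsto (fun n => √(∫ x, (ψ n x - g x) ^ 2 ∂(μT d)) * √(∫ x, φ x ^ 2 ∂(μT d))) atTop
      (nhds 0) := by
    simpa using ((Real.continuous_sqrt.tendsto 0).comp h).mul_const √(∫ x, φ x ^ 2 ∂(μT d))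
  refine squeeze_zero (fun n => norm_nonneg _) (fun n => ?_) h1
  rw [← pairT_sub (integrable_of_memLp_two (hψ n)) (integrable_of_memLp_two hg) hφ]
  exact abs_pairT_test_le ((hψ n).sub hg) hφ le_rfl

theorem tendsto_pairT {T r B G : ℝ} (hT : 0 < T) {K : ℝ≥0∞}
    {h : ℕ → ℝ → (Fin d → ℝ) → Fin d → ℝ} {D c : ℕ → ℝ → (Fin d → ℝ) → ℝ}
    {hl : ℝ → (Fin d → ℝ) → Fin d → ℝ} {Dl cl : ℝ → (Fin d → ℝ) → ℝ}
    (H : CoefConv T r h D c hl Dl cl) (hC : ∀ n, Coef T r K (h n) (D n) (c n))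
    (hCl : Coef T r K hl Dl cl) (hAl : AssumptionA T r hl Dl cl)
    {f0 : ℕ → (Fin d → ℝ) → ℝ} {f0l : (Fin d → ℝ) → ℝ} (hf0l : MemLp f0l 2 (μT d))
    (hf0 : ∀ φ, Test φ → Tendsto (fun n => pairT (f0 n) φ) atTop (nhds (pairT f0l φ)))
    {f : ℕ → ℝ → (Fin d → ℝ) → ℝ} {fl : ℝ → (Fin d → ℝ) → ℝ}
    (hsol : ∀ n, IsWeakSol T (h n) (D n) (c n) (f0 n) (f n)) (hR : ∀ n, Reg T (f n) B G)
    (hE : WeakEquicont T f) (hsoll : IsWeakSol T hl Dl cl f0l fl) (hfl : SolClassL2 T fl)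
    {φ : (Fin d → ℝ) → ℝ} (hφ : Test φ) {t : ℝ} (ht : t ∈ Set.Icc 0 T) :
    Tendsto (fun n => pairT (f n t) φ) atTop (nhds (pairT (fl t) φ)) := by
  refine tendsto_of_subseq_tendsto fun ns hns => ?_
  obtain ⟨σ, hσ, F, hFm, hF2, hint, hae⟩ := exists_subseq_l2 hT (fun n => hR (ns n))
    (fun φ hφ ε hε => by
      obtain ⟨δ, hδ, h⟩ := hE φ hφ ε hε
      exact ⟨δ, hδ, fun n => h (ns n)⟩)
  have hms : Tendsto (fun n => ns (σ n)) atTop atTop := hns.comp hσ.tendsto_atTop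
  obtain ⟨F1, F2, F3⟩ := limit_regular hT.le (fun n => hR (ns (σ n))) hFm hF2 hae
  have hFs := ae_memLp hFm hF2
  set L := 2 * |B| + 1
  have hL : 0 < L := by positivity
  have hBL : B ≤ L ^ 2 ∧ 2 * B ≤ L ^ 2 := by
    constructor <;> nlinarith [le_abs_self B, abs_nonneg B]
  have hFL : BddL2 T L F := ⟨hFm, hFs, F1.mono fun s hs => hs.trans hBL.2⟩
  have hfL : ∀ n, BddL2 T L (f (ns (σ n))) := fun n => ⟨(hR _).meas, Reg.ae_mem.mono (hR _).mem,
    Reg.ae_mem.mono fun s hs => ((hR _).bdd s hs).trans hBL.1⟩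
  have key : ∀ ψ, Test ψ → ∀ s ∈ Set.Icc 0 T, Tendsto (fun n => pairT (f (ns (σ n)) s) ψ) atTop
      (nhds (pairT f0l ψ + ∫ τ in Set.Ioc 0 s, gen (F τ) (hl τ) (Dl τ) (cl τ) ψ)) := by
    intro ψ hψ s hs
    have h1 := ((hf0 ψ hψ).comp hms).add ((H.comp hms).tendsto_gen_Ioc hs hL (fun n => hC _) hCl
      hfL hFL hint hψ)
    refine h1.congr fun n => ?_
    exact (hsol _ ψ hψ s hs).symm
  have El := Evol.of_hyp hT hAl hf0l hsoll hfl
  have EF : Evol T hl Dl cl F f0l (fun s => (spLp ∞ (Dl s)).toReal)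
      (fun s => (spLp ∞ (cl s)).toReal) (2 * B) :=
    { T_pos := hT
      F_meas := hFm
      h_meas := El.h_meas
      D_meas := El.D_meas
      c_meas := El.c_meas
      f0_mem := hf0l
      slice := by
        filter_upwards [El.slice, F2] with s S hs
        exact { S with u_mem := hs }
      CD_nonneg := El.CD_nonneg
      Cc_nonneg := El.Cc_nonneg
      CD_int := El.CD_int
      Cc_int := El.Cc_int
      F_bdd := F1
      grad_int := F3
      h_int := El.h_int
      eq := by
        filter_upwards [hFs, hae, Reg.ae_mem] with s h1 h2 hs ψ hψ
        exact tendsto_nhds_unique (tendsto_pairT_of_l2 hψ (fun n => (hR _).mem s hs) h1 h2)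
          (key ψ hψ s hs) }
  have hEq := EF.ae_eq El
  refine ⟨σ, ?_⟩
  have hgen : ∫ τ in Set.Ioc 0 t, gen (F τ) (hl τ) (Dl τ) (cl τ) φ =
      ∫ τ in Set.Ioc 0 t, gen (fl τ) (hl τ) (Dl τ) (cl τ) φ := by
    refine integral_congr_ae ?_
    filter_upwards [ae_restrict_of_ae_restrict_of_subset (Set.Ioc_subset_Ioc_right ht.2) hEq]
      with τ hτ using gen_congr hτ _ _ _ _
  have := key φ hφ t ht
  rw [hgen] at this
  rwa [hsoll φ hφ t ht]

lemma uniform_fc {T B G : ℝ} (hT : 0 < T) {f : ℕ → ℝ → (Fin d → ℝ) → ℝ}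
    {fl : ℝ → (Fin d → ℝ) → ℝ} (hR : ∀ n, Reg T (f n) B G) (hE : WeakEquicont T f)
    (hfl : ∀ t ∈ Set.Icc 0 T, MemLp (fl t) 2 (μT d))
    (hc : ∀ φ, Test φ → ∀ t ∈ Set.Icc 0 T,
      Tendsto (fun n => pairT (f n t) φ) atTop (nhds (pairT (fl t) φ)))
    (k : Fin d → ℤ) {ε : ℝ} (hε : 0 < ε) :
    ∀ᶠ n in atTop, ∀ t ∈ Set.Icc 0 T, ‖fc (f n t) k - fc (fl t) k‖ ≤ ε := by
  have key : ∀ φ, Test φ → ∀ᶠ n in atTop, ∀ t ∈ Set.Icc 0 T,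
      |pairT (f n t) φ - pairT (fl t) φ| ≤ ε / 2 := by
    intro φ hφ
    obtain ⟨⟨n0, m0⟩, hq⟩ := eventually_atTop.1 (equicontinuous_cauchy hT
      (p := fun n t => pairT (f n t) φ) (hE φ hφ)
      (fun m j => (hc φ hφ _ (grid_mem hT m j)).cauchySeq) (half_pos hε))
    filter_upwards [eventually_ge_atTop n0] with n hn t ht
    refine le_of_tendsto ((tendsto_const_nhds.sub (hc φ hφ t ht)).abs) ?_
    filter_upwards [eventually_ge_atTop m0] with m hm
    exact hq (n, m) ⟨hn, hm⟩ t ht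
  filter_upwards [key _ (test_cs k), key _ (test_sn k)] with n h1 h2 t ht
  refine (norm_fc_sub_le (integrable_of_memLp_two ((hR n).mem t ht))
    (integrable_of_memLp_two (hfl t ht)) k).trans ?_
  linarith [h1 t ht, h2 t ht]

end Identification

section Convergence
variable {d : ℕ}

lemma tendsto_lowFreq (d : ℕ) : Tendsto (lowFreq d) atTop atTop := by
  refine tendsto_atTop_finset_of_monotone (fun M N h => ?_) fun k => ?_
  · refine Fintype.piFinset_subset _ _ fun _ => Finset.Icc_subset_Icc ?_ ?_ <;> simpa using h
  · refine ⟨∑ i, (k i).natAbs, Fintype.mem_piFinset.2 fun i => ?_⟩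
    have := Finset.single_le_sum (f := fun i => (k i).natAbs) (fun _ _ => Nat.zero_le _)
      (Finset.mem_univ i)
    rw [Finset.mem_Icc]
    omega

/-- The real value of `‖f‖_{H¹}²`. -/
def sobR (f : (Fin d → ℝ) → ℝ) : ℝ := (sobNormSq 1 f).toReal

lemma hasSum_sobR {f : (Fin d → ℝ) → ℝ} (hf : sobNormSq 1 f < ∞) :
    HasSum (fun k => jap k * ‖fc f k‖ ^ 2) (sobR f) := by
  obtain ⟨h1, h2⟩ := summable_jap hf
  rw [sobR, h2, ENNReal.toReal_ofReal
    (tsum_nonneg fun k => mul_nonneg (jap_pos k).le (sq_nonneg _))]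
  exact h1.hasSum

lemma hasSum_sobPair {f g : (Fin d → ℝ) → ℝ} (hf : sobNormSq 1 f < ∞) (hg : sobNormSq 1 g < ∞) :
    HasSum (fun k => jap k * (fc f k * star (fc g k)).re) (sobPair 1 f g).re := by
  have hs : Summable fun k : Fin d → ℤ =>
      (((1 + znorm k ^ 2) ^ (1 : ℝ) : ℝ) : ℂ) * (fc f k * star (fc g k)) := by
    refine Summable.of_norm_bounded ((hasSum_sobR hf).summable.add (hasSum_sobR hg).summable)
      fun k => ?_
    rw [Real.rpow_one, norm_mul, norm_mul, norm_star, Complex.norm_real, Real.norm_eq_abs]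
    change |jap k| * _ ≤ _
    rw [abs_of_pos (jap_pos k), ← mul_add]
    refine mul_le_mul_of_nonneg_left ?_ (jap_pos k).le
    nlinarith [sq_nonneg (‖fc f k‖ - ‖fc g k‖), sq_nonneg (‖fc f k‖), sq_nonneg (‖fc g k‖)]
  refine (Complex.hasSum_re hs.hasSum).congr_fun ?_ |> fun h => h
  intro k
  rw [Real.rpow_one, Complex.re_ofReal_mul]
  rfl

lemma abs_sobPair_sub_le {f g u : (Fin d → ℝ) → ℝ} (hf : sobNormSq 1 f < ∞)
    (hg : sobNormSq 1 g < ∞) (hu : sobNormSq 1 u < ∞) {N : ℕ} {η θ : ℝ} (hη : 0 ≤ η) (hθ : 0 < θ)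
    (h : ∀ k ∈ lowFreq d N, ‖fc f k - fc g k‖ ≤ η) :
    |(sobPair 1 f u).re - (sobPair 1 g u).re| ≤
      η * (∑ k ∈ lowFreq d N, jap k + sobR u) + θ * (sobR f + sobR g) +
        θ⁻¹ * (sobR u - ∑ k ∈ lowFreq d N, jap k * ‖fc u k‖ ^ 2) := by
  classical
  have hd := (hasSum_sobPair hf hu).sub (hasSum_sobPair hg hu)
  have hlow := hasSum_sum_of_ne_finset_zero (L := .unconditional _)
    (f := fun k => if k ∈ lowFreq d N then η * jap k - θ⁻¹ * (jap k * ‖fc u k‖ ^ 2) else 0)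
    (s := lowFreq d N) (fun k hk => if_neg hk)
  rw [Finset.sum_congr rfl fun k hk => if_pos hk] at hlow
  have hb := ((hlow.add ((hasSum_sobR hu).mul_left η)).add
    (((hasSum_sobR hf).add (hasSum_sobR hg)).mul_left θ)).add ((hasSum_sobR hu).mul_left θ⁻¹)
  rw [← hd.tsum_eq, ← Real.norm_eq_abs]
  refine (tsum_of_norm_bounded hb fun k => ?_).trans (le_of_eq ?_)
  · have e : jap k * (fc f k * star (fc u k)).re - jap k * (fc g k * star (fc u k)).re =
        jap k * ((fc f k - fc g k) * star (fc u k)).re := by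
      rw [sub_mul, Complex.sub_re]; ring
    have h1 : |((fc f k - fc g k) * star (fc u k)).re| ≤ ‖fc f k - fc g k‖ * ‖fc u k‖ := by
      refine (Complex.abs_re_le_norm _).trans ?_
      rw [norm_mul, norm_star]
    rw [e, Real.norm_eq_abs, abs_mul, abs_of_pos (jap_pos k)]
    have hj := jap_pos k
    have hθi : 0 < θ⁻¹ := inv_pos.2 hθ
    set a := ‖fc f k‖
    set b := ‖fc g k‖
    set w := ‖fc u k‖
    set D := ‖fc f k - fc g k‖
    have hw : 0 ≤ w := norm_nonneg _
    by_cases hk : k ∈ lowFreq d N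
    · simp only [hk, if_true]
      have h2 : D * w ≤ η * (1 + w ^ 2) := by
        refine mul_le_mul (h k hk) ?_ hw hη
        nlinarith [sq_nonneg (w - 1)]
      have h3 := mul_le_mul_of_nonneg_left (h1.trans h2) hj.le
      have h4 : 0 ≤ θ * (jap k * a ^ 2 + jap k * b ^ 2) := by positivity
      nlinarith
    · simp only [hk, if_false]
      have hD : D ≤ a + b := norm_sub_le _ _
      have h2 : (a + b) * w ≤ θ * (a ^ 2 + b ^ 2) + θ⁻¹ * w ^ 2 := by
        have h5 : θ * θ⁻¹ = 1 := mul_inv_cancel₀ hθ.ne'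
        have h6 : 0 ≤ θ⁻¹ * ((θ * a - w / 2) ^ 2 + (θ * b - w / 2) ^ 2) := by positivity
        have h7 : θ⁻¹ * ((θ * a - w / 2) ^ 2 + (θ * b - w / 2) ^ 2) =
            θ * (a ^ 2 + b ^ 2) + θ⁻¹ * w ^ 2 / 2 - (a + b) * w := by
          field_simp; ring
        have : 0 ≤ θ⁻¹ * w ^ 2 := by positivity
        linarith
      have h3 := mul_le_mul_of_nonneg_left
        ((h1.trans (mul_le_mul_of_nonneg_right hD hw)).trans h2) hj.le
      have h4 : 0 ≤ η * (jap k * w ^ 2) := by positivity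
      nlinarith
  · rw [Finset.sum_sub_distrib, ← Finset.mul_sum, ← Finset.mul_sum]
    ring

lemma tendsto_tail_sobR {T : ℝ} {G : ℝ → (Fin d → ℝ) → ℝ} (hG : Measurable (Function.uncurry G))
    (h : ∫⁻ t in Set.Ioc 0 T, sobNormSq 1 (G t) < ∞) :
    (∀ N, IntegrableOn (fun t => sobR (G t) - ∑ k ∈ lowFreq d N, jap k * ‖fc (G t) k‖ ^ 2)
      (Set.Ioc 0 T)) ∧
    Tendsto (fun N => ∫ t in Set.Ioc 0 T,
      (sobR (G t) - ∑ k ∈ lowFreq d N, jap k * ‖fc (G t) k‖ ^ 2)) atTop (nhds 0) := by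
  obtain ⟨h1, h2, -⟩ := integrableOn_toReal (measurable_sobNormSq hG 1) h le_rfl
  have hm : ∀ N, AEStronglyMeasurable
      (fun t => sobR (G t) - ∑ k ∈ lowFreq d N, jap k * ‖fc (G t) k‖ ^ 2)
      (volume.restrict (Set.Ioc 0 T)) := fun N =>
    (((measurable_sobNormSq hG 1).ennreal_toReal).sub (Finset.measurable_sum _ fun k _ =>
      ((measurable_fc hG k).norm.pow_const 2).const_mul _)).aestronglyMeasurable
  have hb : ∀ N, ∀ᵐ t ∂(volume.restrict (Set.Ioc 0 T)),
      ‖sobR (G t) - ∑ k ∈ lowFreq d N, jap k * ‖fc (G t) k‖ ^ 2‖ ≤ sobR (G t) := fun N => by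
    filter_upwards [h1] with t ht
    have h0 : ∀ k : Fin d → ℤ, 0 ≤ jap k * ‖fc (G t) k‖ ^ 2 := fun k =>
      mul_nonneg (jap_pos k).le (sq_nonneg _)
    have := sum_le_hasSum (lowFreq d N) (fun k _ => h0 k) (hasSum_sobR ht)
    rw [Real.norm_of_nonneg (by linarith)]
    linarith [Finset.sum_nonneg fun k (_ : k ∈ lowFreq d N) => h0 k]
  refine ⟨fun N => Integrable.mono' h2 (hm N) (hb N), ?_⟩
  have := tendsto_integral_of_dominated_convergence (f := fun _ => (0 : ℝ)) _ hm h2 hb ?_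
  · simpa using this
  · filter_upwards [h1] with t ht
    have := ((hasSum_sobR ht).comp (tendsto_lowFreq d)).const_sub (sobR (G t))
    simpa using this

lemma integrableOn_sobPair {T : ℝ} {F G : ℝ → (Fin d → ℝ) → ℝ}
    (hF : Measurable (Function.uncurry F)) (hG : Measurable (Function.uncurry G))
    (h1 : ∫⁻ t in Set.Ioc 0 T, sobNormSq 1 (F t) < ∞)
    (h2 : ∫⁻ t in Set.Ioc 0 T, sobNormSq 1 (G t) < ∞) :
    IntegrableOn (fun t => (sobPair 1 (F t) (G t)).re) (Set.Ioc 0 T) := by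
  obtain ⟨a1, a2, -⟩ := integrableOn_toReal (measurable_sobNormSq hF 1) h1 le_rfl
  obtain ⟨b1, b2, -⟩ := integrableOn_toReal (measurable_sobNormSq hG 1) h2 le_rfl
  have hm : AEStronglyMeasurable (fun t => (sobPair 1 (F t) (G t)).re)
      (volume.restrict (Set.Ioc 0 T)) := by
    refine aestronglyMeasurable_of_tendsto_ae atTop
      (f := fun N t => ∑ k ∈ lowFreq d N, jap k * (fc (F t) k * star (fc (G t) k)).re)
      (fun N => (Finset.measurable_sum _ fun k _ => Measurable.const_mul ?_ _).aestronglyMeasurable) ?_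
    · exact Complex.measurable_re.comp
        ((measurable_fc hF k).mul (Complex.continuous_conj.measurable.comp (measurable_fc hG k)))
    · filter_upwards [a1, b1] with t h1 h2 using (hasSum_sobPair h1 h2).comp (tendsto_lowFreq d)
  refine Integrable.mono' (a2.add b2) hm ?_
  filter_upwards [a1, b1] with t h1 h2
  rw [← (hasSum_sobPair h1 h2).tsum_eq]
  refine tsum_of_norm_bounded ((hasSum_sobR h1).add (hasSum_sobR h2)) fun k => ?_
  rw [norm_mul, Real.norm_of_nonneg (jap_pos k).le, ← mul_add]
  refine mul_le_mul_of_nonneg_left ((Complex.abs_re_le_norm _).trans ?_) (jap_pos k).le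
  rw [norm_mul, norm_star]
  nlinarith [sq_nonneg (‖fc (F t) k‖ - ‖fc (G t) k‖), sq_nonneg (‖fc (F t) k‖),
    sq_nonneg (‖fc (G t) k‖)]

variable {T B G B' G' : ℝ} {f : ℕ → ℝ → (Fin d → ℝ) → ℝ} {fl : ℝ → (Fin d → ℝ) → ℝ}

lemma eventually_lowFreq
    (hu : ∀ k, ∀ ε > 0, ∀ᶠ n in atTop, ∀ t ∈ Set.Icc 0 T, ‖fc (f n t) k - fc (fl t) k‖ ≤ ε)
    (N : ℕ) {η : ℝ} (hη : 0 < η) :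
    ∀ᶠ n in atTop, ∀ t ∈ Set.Icc 0 T, ∀ k ∈ lowFreq d N, ‖fc (f n t) k - fc (fl t) k‖ ≤ η := by
  have : ∀ᶠ n in atTop, ∀ k ∈ lowFreq d N, ∀ t ∈ Set.Icc 0 T,
      ‖fc (f n t) k - fc (fl t) k‖ ≤ η := by
    rw [Filter.eventually_all_finset]
    exact fun k _ => hu k η hη
  exact this.mono fun n h t ht k hk => h k hk t ht

lemma tendsto_integral_sobPair (hT : 0 < T) (hR : ∀ n, Reg T (f n) B G) (hRl : Reg T fl B' G')
    (hu : ∀ k, ∀ ε > 0, ∀ᶠ n in atTop, ∀ t ∈ Set.Icc 0 T, ‖fc (f n t) k - fc (fl t) k‖ ≤ ε)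
    {g : ℝ → (Fin d → ℝ) → ℝ} (hg : Measurable (Function.uncurry g))
    (hgs : ∫⁻ t in Set.Ioc 0 T, sobNormSq 1 (g t) < ∞) :
    Tendsto (fun n => ∫ t in Set.Ioc 0 T, (sobPair 1 (f n t) (g t)).re) atTop
      (nhds (∫ t in Set.Ioc 0 T, (sobPair 1 (fl t) (g t)).re)) := by
  have hfs := fun n => (hR n).lintegral_sob_le hT.le
  have hls := hRl.lintegral_sob_le hT.le
  obtain ⟨hτi, hτ⟩ := tendsto_tail_sobR hg hgs
  obtain ⟨g1, g2, -⟩ := integrableOn_toReal (measurable_sobNormSq hg 1) hgs le_rfl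
  obtain ⟨l1, l2, l3⟩ := integrableOn_toReal (measurable_sobNormSq hRl.meas 1)
    ENNReal.ofReal_lt_top hls
  set Cf := (ENNReal.ofReal (T * B + G)).toReal
  set Cl := (ENNReal.ofReal (T * B' + G')).toReal
  have hCf : 0 ≤ Cf := ENNReal.toReal_nonneg
  have hCl : 0 ≤ Cl := ENNReal.toReal_nonneg
  refine Metric.tendsto_nhds.2 fun ε hε => ?_
  set θ := ε / (4 * (Cf + Cl + 1)) with hθd
  have hθ : 0 < θ := by positivity
  have hθ2 : θ * (Cf + Cl) ≤ ε / 4 := by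
    rw [hθd, div_mul_eq_mul_div, div_le_div_iff₀ (by positivity) (by positivity)]
    nlinarith
  obtain ⟨N, hN⟩ := ((hτ.const_mul θ⁻¹).eventually_lt_const
    (show θ⁻¹ * 0 < ε / 4 by rw [mul_zero]; positivity)).exists
  set M := ∫ t in Set.Ioc 0 T, sobR (g t) with hM
  have hM0 : 0 ≤ M := integral_nonneg fun t => ENNReal.toReal_nonneg
  set J := ∑ k ∈ lowFreq d N, jap k
  have hJ : 0 ≤ J := Finset.sum_nonneg fun k _ => (jap_pos k).le
  set η := ε / (4 * (T * J + M + 1)) with hηd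
  have hη : 0 < η := by positivity
  have hη2 : η * (T * J + M) ≤ ε / 4 := by
    rw [hηd, div_mul_eq_mul_div, div_le_div_iff₀ (by positivity) (by positivity)]
    nlinarith
  filter_upwards [eventually_lowFreq hu N hη] with n hn
  obtain ⟨f1, f2, f3⟩ := integrableOn_toReal (measurable_sobNormSq (hR n).meas 1)
    ENNReal.ofReal_lt_top (hfs n)
  have pf := integrableOn_sobPair (hR n).meas hg ((hfs n).trans_lt ENNReal.ofReal_lt_top) hgs
  have pl := integrableOn_sobPair hRl.meas hg (hls.trans_lt ENNReal.ofReal_lt_top) hgs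
  have i1 : IntegrableOn (fun t => η * (J + sobR (g t))) (Set.Ioc 0 T) :=
    (((integrable_const J).add g2).const_mul η)
  have i2 : IntegrableOn (fun t => θ * (sobR (f n t) + sobR (fl t))) (Set.Ioc 0 T) :=
    ((f2.add l2).const_mul θ)
  have i3 : IntegrableOn (fun t => θ⁻¹ * (sobR (g t) -
      ∑ k ∈ lowFreq d N, jap k * ‖fc (g t) k‖ ^ 2)) (Set.Ioc 0 T) := (hτi N).const_mul θ⁻¹
  have e1 : ∫ t in Set.Ioc 0 T, η * (J + sobR (g t)) = η * (T * J + M) := by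
    have : ∫ t in Set.Ioc 0 T, (J + sobR (g t)) = T * J + M := by
      refine (integral_add (integrable_const J) g2).trans ?_
      rw [hM]
      simp [hT.le, sobR]
    rw [integral_const_mul, this]
  have e2 : ∫ t in Set.Ioc 0 T, θ * (sobR (f n t) + sobR (fl t)) ≤ θ * (Cf + Cl) := by
    rw [integral_const_mul]
    refine mul_le_mul_of_nonneg_left ?_ hθ.le
    exact (integral_add f2 l2).trans_le (add_le_add f3 l3)
  rw [← integral_const_mul] at hN
  rw [Real.dist_eq, ← integral_sub pf pl]
  refine (abs_integral_le_integral_abs).trans_lt ?_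
  calc ∫ t in Set.Ioc 0 T, |(sobPair 1 (f n t) (g t)).re - (sobPair 1 (fl t) (g t)).re|
      ≤ ∫ t in Set.Ioc 0 T, (η * (J + sobR (g t)) + θ * (sobR (f n t) + sobR (fl t)) +
          θ⁻¹ * (sobR (g t) - ∑ k ∈ lowFreq d N, jap k * ‖fc (g t) k‖ ^ 2)) := by
        refine integral_mono_ae (pf.sub pl).abs ((i1.add i2).add i3) ?_
        filter_upwards [f1, l1, g1, Reg.ae_mem] with t a1 a2 a3 ht
        exact abs_sobPair_sub_le a1 a2 a3 hη.le hθ (hn t ht)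
    _ = η * (T * J + M) + (∫ t in Set.Ioc 0 T, θ * (sobR (f n t) + sobR (fl t))) +
          ∫ t in Set.Ioc 0 T, θ⁻¹ * (sobR (g t) -
            ∑ k ∈ lowFreq d N, jap k * ‖fc (g t) k‖ ^ 2) := by
        rw [← e1]
        refine (integral_add (i1.add i2) i3).trans ?_
        exact congrArg (· + _) (integral_add i1 i2)
    _ < ε := by linarith

lemma tendsto_LqLp_sub (hT : 0 < T) (hR : ∀ n, Reg T (f n) B G) (hRl : Reg T fl B' G')
    (hu : ∀ k, ∀ ε > 0, ∀ᶠ n in atTop, ∀ t ∈ Set.Icc 0 T, ‖fc (f n t) k - fc (fl t) k‖ ≤ ε) :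
    Tendsto (fun n => LqLp T 2 2 (fun t x => f n t x - fl t x)) atTop (nhds 0) := by
  refine ENNReal.tendsto_nhds_zero.2 fun K hK => ?_
  rcases eq_or_ne K ∞ with rfl | hKt
  · exact Eventually.of_forall fun n => le_top
  have hε : 0 < K.toReal ^ 2 := pow_pos (ENNReal.toReal_pos hK.ne' hKt) 2
  obtain ⟨N, η, hη, hs⟩ := exists_small d hT.le (2 * G + 2 * G') hε
  filter_upwards [eventually_lowFreq hu N hη] with n hn
  have hm := (hR n).meas.sub hRl.meas
  have hL : MemLp (Function.uncurry fun t x => f n t x - fl t x) 2 (νT d T) :=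
    (hR n).memLp.sub hRl.memLp
  rw [LqLp_two_le, lintegral_spLp_two_sq hm, eLpNorm_two_sq hL, ← integral_sq_eq hL,
    ← ENNReal.ofReal_toReal hKt, ← ENNReal.ofReal_pow ENNReal.toReal_nonneg]
  exact ENNReal.ofReal_le_ofReal (((hR n).l2_diff hRl hT.le hn).trans hs.le)

lemma sobNormSq_neg_le {w : (Fin d → ℝ) → ℝ} (hw : MemLp w 2 (μT d)) {δ : ℝ} (hδ : 0 < δ) (N : ℕ)
    {η X : ℝ} (h : ∀ k ∈ lowFreq d N, ‖fc w k‖ ≤ η) (hX : ∫ x, w x ^ 2 ∂(μT d) ≤ X) :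
    sobNormSq (-δ) w ≤ ENNReal.ofReal ((lowFreq d N).card * η ^ 2 + ((N : ℝ) + 1) ^ (-δ) * X) := by
  have hp := parseval hw
  have hpos : ∀ k : Fin d → ℤ, 0 ≤ jap k ^ (-δ) * ‖fc w k‖ ^ 2 := fun k =>
    mul_nonneg (Real.rpow_nonneg (jap_pos k).le _) (sq_nonneg _)
  have hle : ∀ k : Fin d → ℤ, jap k ^ (-δ) * ‖fc w k‖ ^ 2 ≤ ‖fc w k‖ ^ 2 := fun k =>
    mul_le_of_le_one_left (sq_nonneg _)
      (Real.rpow_le_one_of_one_le_of_nonpos (one_le_jap k) (by linarith))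
  have hs := Summable.of_nonneg_of_le hpos hle hp.summable
  have hq : (0 : ℝ) ≤ ((N : ℝ) + 1) ^ (-δ) := Real.rpow_nonneg (by positivity) _
  rw [sobNormSq_eq, ← ENNReal.ofReal_tsum_of_nonneg hpos hs]
  refine ENNReal.ofReal_le_ofReal ?_
  refine (hasSum_le_low hs.hasSum hp (fun k => sq_nonneg _) hq (N := N) fun k hk => ?_).trans
    (add_le_add ?_ (mul_le_mul_of_nonneg_left hX hq))
  · refine mul_le_mul_of_nonneg_right ?_ (sq_nonneg _)
    refine Real.rpow_le_rpow_of_nonpos (by positivity) ?_ (by linarith)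
    have h1 := sq_le_of_notMem_lowFreq hk
    have h2 : (0 : ℝ) ≤ N := N.cast_nonneg
    unfold jap
    nlinarith
  · rw [← nsmul_eq_mul]
    exact Finset.sum_le_card_nsmul _ _ _ fun k hk =>
      (hle k).trans (pow_le_pow_left₀ (norm_nonneg _) (h k hk) 2)

lemma tendsto_supSob_sub (hR : ∀ n, Reg T (f n) B G) (hRl : Reg T fl B' G')
    (hu : ∀ k, ∀ ε > 0, ∀ᶠ n in atTop, ∀ t ∈ Set.Icc 0 T, ‖fc (f n t) k - fc (fl t) k‖ ≤ ε)
    {δ : ℝ} (hδ : 0 < δ) :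
    Tendsto (fun n => supSob T (-δ) (fun t x => f n t x - fl t x)) atTop (nhds 0) := by
  refine ENNReal.tendsto_nhds_zero.2 fun K hK => ?_
  rcases eq_or_ne K ∞ with rfl | hKt
  · exact Eventually.of_forall fun n => le_top
  have hε : 0 < K.toReal ^ 2 := pow_pos (ENNReal.toReal_pos hK.ne' hKt) 2
  set X := 2 * B + 2 * B'
  have ht : Tendsto (fun N : ℕ => ((N : ℝ) + 1) ^ (-δ) * X) atTop (nhds 0) := by
    have := ((tendsto_rpow_neg_atTop hδ).comp
      (tendsto_atTop_add_const_right _ 1 tendsto_natCast_atTop_atTop)).mul_const X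
    simpa using this
  obtain ⟨N, hN⟩ := (ht.eventually_lt_const (half_pos hε)).exists
  set m : ℝ := ((lowFreq d N).card : ℝ)
  have hm : 0 ≤ m := Nat.cast_nonneg _
  set η := √(K.toReal ^ 2 / (2 * (m + 1))) with hηd
  have hη : 0 < η := by positivity
  have hη2 : m * η ^ 2 ≤ K.toReal ^ 2 / 2 := by
    rw [hηd, Real.sq_sqrt (by positivity), mul_div_assoc', div_le_div_iff₀ (by positivity) two_pos]
    nlinarith
  filter_upwards [eventually_lowFreq hu N hη] with n hn
  refine iSup₂_le fun t htm => ?_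
  have h1 := (hR n).mem t htm
  have h2 := hRl.mem t htm
  have hk : ∀ k ∈ lowFreq d N, ‖fc (fun x => f n t x - fl t x) k‖ ≤ η := fun k hk => by
    rw [fc_sub (integrable_of_memLp_two h1) (integrable_of_memLp_two h2)]
    exact hn t htm k hk
  have hX : ∫ x, (f n t x - fl t x) ^ 2 ∂(μT d) ≤ X := by
    have a1 := integral_sub_sq_le h1 h2
    have a2 := (hR n).bdd t htm
    have a3 := hRl.bdd t htm
    linarith
  rw [sobNorm, one_div, ENNReal.rpow_inv_le_iff two_pos, ENNReal.rpow_ofNat]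
  refine (sobNormSq_neg_le (h1.sub h2) hδ N hk hX).trans ?_
  rw [← ENNReal.ofReal_toReal hKt, ← ENNReal.ofReal_pow ENNReal.toReal_nonneg]
  refine ENNReal.ofReal_le_ofReal ?_
  linarith

end Convergence

/-- Weak stability of `L²` weak solutions of
`∂_t f − Δf = h·∇f + c f`: under uniform bounds and weak convergence of the data
`(f₀ⁿ, hⁿ, div hⁿ, cⁿ)`, the solutions `fⁿ` converge to the solution `f` for the limit
data, weakly in `L²_t H¹_x`, strongly in `L²([0,T]×𝕋^d)` and strongly in `C⁰_t H^{−δ}`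
for every `δ > 0`. -/
theorem statement3 (d : ℕ) (hd : 1 ≤ d) (T r : ℝ) (hT : 0 < T)
    (h : ℕ → ℝ → (Fin d → ℝ) → Fin d → ℝ) (divh c : ℕ → ℝ → (Fin d → ℝ) → ℝ)
    (hlim : ℝ → (Fin d → ℝ) → Fin d → ℝ) (divhlim clim : ℝ → (Fin d → ℝ) → ℝ)
    (hA : ∀ n, AssumptionA T r (h n) (divh n) (c n))
    (hAlim : AssumptionA T r hlim divhlim clim)
    (hbdd : ∃ K : ℝ≥0∞, K < ∞ ∧ ∀ n,
      LqLpV T 2 2 (h n) ≤ K ∧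
      LqLp T 2 (ENNReal.ofReal r) (divh n) ≤ K ∧ LqLp T 1 ∞ (divh n) ≤ K ∧
      LqLp T 2 (ENNReal.ofReal r) (c n) ≤ K ∧ LqLp T 1 ∞ (c n) ≤ K)
    (f0 : ℕ → (Fin d → ℝ) → ℝ) (f0lim : (Fin d → ℝ) → ℝ)
    (hf0meas : ∀ n, Measurable (f0 n)) (hf0per : ∀ n, ZPeriodic (f0 n))
    (hf0L2 : ∀ n, spLp 2 (f0 n) < ∞)
    (hf0lmeas : Measurable f0lim) (hf0lper : ZPeriodic f0lim) (hf0lL2 : spLp 2 f0lim < ∞)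
    -- f₀ⁿ → f₀ weakly in L²
    (hf0conv : ∀ g : (Fin d → ℝ) → ℝ, Measurable g → ZPeriodic g → spLp 2 g < ∞ →
      Tendsto (fun n => ∫ x, f0 n x * g x ∂(μT d)) atTop
        (nhds (∫ x, f0lim x * g x ∂(μT d))))
    -- hⁿ → h weakly in L²([0,T]×𝕋^d)
    (hhconv : ∀ Φ : ℝ → (Fin d → ℝ) → Fin d → ℝ, Measurable (Function.uncurry Φ) →
      LqLpV T 2 2 Φ < ∞ →
      Tendsto (fun n => ∫ t in Set.Icc (0:ℝ) T, ∫ x, (∑ i, h n t x i * Φ t x i) ∂(μT d))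
        atTop (nhds (∫ t in Set.Icc (0:ℝ) T, ∫ x, (∑ i, hlim t x i * Φ t x i) ∂(μT d))))
    -- div hⁿ → div h weakly in L²_t L^r_x
    (hdivconv : ∀ Φ : ℝ → (Fin d → ℝ) → ℝ, Measurable (Function.uncurry Φ) →
      LqLp T 2 (ENNReal.ofReal (conjExp r)) Φ < ∞ →
      Tendsto (fun n => ∫ t in Set.Icc (0:ℝ) T, ∫ x, divh n t x * Φ t x ∂(μT d))
        atTop (nhds (∫ t in Set.Icc (0:ℝ) T, ∫ x, divhlim t x * Φ t x ∂(μT d))))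
    -- cⁿ → c weakly in L²_t L^r_x
    (hcconv : ∀ Φ : ℝ → (Fin d → ℝ) → ℝ, Measurable (Function.uncurry Φ) →
      LqLp T 2 (ENNReal.ofReal (conjExp r)) Φ < ∞ →
      Tendsto (fun n => ∫ t in Set.Icc (0:ℝ) T, ∫ x, c n t x * Φ t x ∂(μT d))
        atTop (nhds (∫ t in Set.Icc (0:ℝ) T, ∫ x, clim t x * Φ t x ∂(μT d))))
    -- the weak solutions
    (f : ℕ → ℝ → (Fin d → ℝ) → ℝ) (flim : ℝ → (Fin d → ℝ) → ℝ)
    (hfsol : ∀ n, IsWeakSol T (h n) (divh n) (c n) (f0 n) (f n) ∧ SolClassL2 T (f n))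
    (hflimsol : IsWeakSol T hlim divhlim clim f0lim flim ∧ SolClassL2 T flim) :
    -- weak convergence in L²_t H¹_x
    (∀ G : ℝ → (Fin d → ℝ) → ℝ, Measurable (Function.uncurry G) →
      (∀ t, ZPeriodic (G t)) → (∫⁻ t in Set.Icc (0:ℝ) T, sobNormSq 1 (G t)) < ∞ →
      Tendsto (fun n => ∫ t in Set.Icc (0:ℝ) T, (sobPair 1 (f n t) (G t)).re)
        atTop (nhds (∫ t in Set.Icc (0:ℝ) T, (sobPair 1 (flim t) (G t)).re))) ∧
    -- strong convergence in L²([0,T]×𝕋^d)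
    Tendsto (fun n => LqLp T 2 2 (fun t x => f n t x - flim t x)) atTop (nhds 0) ∧
    -- strong convergence in C⁰_t H^{−δ} for every δ > 0
    (∀ δ : ℝ, 0 < δ →
      Tendsto (fun n => supSob T (-δ) (fun t x => f n t x - flim t x)) atTop (nhds 0)) := by
  obtain ⟨K₀, hK₀, hK⟩ := hbdd
  obtain ⟨-, -, -, -, -, -, -, n1, -, n2, n3, n4, n5⟩ := id hAlim
  obtain ⟨K, hKt, k0, k1, k2, k3, k4, k5⟩ : ∃ K : ℝ≥0∞, K < ∞ ∧ K₀ ≤ K ∧ LqLpV T 2 2 hlim ≤ K ∧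
      LqLp T 2 (ENNReal.ofReal r) divhlim ≤ K ∧ LqLp T 1 ∞ divhlim ≤ K ∧
      LqLp T 2 (ENNReal.ofReal r) clim ≤ K ∧ LqLp T 1 ∞ clim ≤ K := by
    refine ⟨max K₀ (max (LqLpV T 2 2 hlim) (max (LqLp T 2 (ENNReal.ofReal r) divhlim)
      (max (LqLp T 1 ∞ divhlim) (max (LqLp T 2 (ENNReal.ofReal r) clim) (LqLp T 1 ∞ clim))))),
      ?_, ?_⟩
    · simp only [max_lt_iff]
      exact ⟨hK₀, n1, n2, n3, n4, n5⟩
    · simp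
  have hC : ∀ n, Coef T r K (h n) (divh n) (c n) := fun n => by
    obtain ⟨b1, b2, b3, b4, b5⟩ := hK n
    exact Coef.of_assumption hKt (hA n) (b1.trans k0) (b2.trans k0) (b3.trans k0) (b4.trans k0)
      (b5.trans k0)
  have hCl : Coef T r K hlim divhlim clim := Coef.of_assumption hKt hAlim k1 k2 k3 k4 k5
  have m0 : ∀ n, MemLp (f0 n) 2 (μT d) := fun n => ⟨(hf0meas n).aestronglyMeasurable, hf0L2 n⟩
  have m0l : MemLp f0lim 2 (μT d) := ⟨hf0lmeas.aestronglyMeasurable, hf0lL2⟩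
  obtain ⟨A, -, hA0⟩ := exists_bound_of_weak_tendsto m0 hf0conv
  have hR := fun n => Reg.of_sol hT (hA n) (hC n) (m0 n) (hA0 n) (hfsol n).1 (hfsol n).2
  have hRl := Reg.of_sol hT hAlim hCl m0l le_rfl hflimsol.1 hflimsol.2
  have hE := weakEquicont_of_sol hT.le hC (fun n => (hfsol n).1) hR
  have hu := fun (k : Fin d → ℤ) (ε : ℝ) (hε : ε > 0) => uniform_fc hT hR hE hRl.mem
    (fun φ hφ t ht => tendsto_pairT hT ⟨hhconv, hdivconv, hcconv⟩ hC hCl hAlim m0l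
      (fun ψ hψ => hf0conv ψ hψ.continuous.measurable hψ.2 (hψ.memLp 2).2)
      (fun n => (hfsol n).1) hR hE hflimsol.1 hflimsol.2 hφ ht) k hε
  refine ⟨fun G hG _ hGs => ?_, tendsto_LqLp_sub hT hR hRl hu,
    fun δ hδ => tendsto_supSob_sub hR hRl hu hδ⟩
  simp only [integral_Icc_eq_integral_Ioc]
  rw [Measure.restrict_congr_set Ioc_ae_eq_Icc.symm] at hGs
  exact tendsto_integral_sobPair hT hR hRl hu hG hGs

end GaleatiLuo
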